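/- Let l₁,…,lₙ be positive integers, 1 < p < ∞ and 0 ≤ φ < π. There exists C > 0 such that for every λ ∈ S_φ, every t ∈ (0,∞)ⁿ and all complex-valued Schwartz functions u, f ∈ S(ℝⁿ; ℂ) satisfying Σₖ (−1)^{lₖ} tₖ ∂ₖ^{2lₖ} u(x) + (1 + λ) u(x) = f(x) for all x ∈ ℝⁿ, one has Σₖ Σ_{i=0}^{2lₖ} tₖ^{i/(2lₖ)} |λ|^{1−i/(2lₖ)} ‖∂ₖ^{i} u‖_{L^p(ℝⁿ)} + ‖u‖_{L^p(ℝⁿ)} ≤ C ‖f‖_{L^p(ℝⁿ)}. -/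

import Mathlib

open MeasureTheory

noncomputable section

/-- The sector `S_φ = {λ ∈ ℂ : |arg λ| ≤ φ} ∪ {0}`. -/
def Sector (φ : ℝ) : Set ℂ := {z | z = 0 ∨ |z.arg| ≤ φ}

/-- `i`-th classical partial derivative in the `k`-th coordinate of a Schwartz function. -/
def pdIter (n : ℕ) {H : Type*} [NormedAddCommGroup H] [NormedSpace ℝ H] (k : Fin n)
    (i : ℕ) (u : SchwartzMap (Fin n → ℝ) H) : SchwartzMap (Fin n → ℝ) H :=
  (fun v => LineDeriv.lineDerivOpCLM ℝ (SchwartzMap (Fin n → ℝ) H) (Pi.single k 1 : Fin n → ℝ) v)^[i] u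

/-- The `L^p(ℝⁿ)` norm `(∫ ‖f x‖ ^ p dx) ^ (1/p)` for a real exponent `p`. -/
def LpN (n : ℕ) {H : Type*} [NormedAddCommGroup H] (p : ℝ) (f : (Fin n → ℝ) → H) : ℝ :=
  (∫ x, ‖f x‖ ^ p) ^ (1 / p)

open scoped ENNReal NNReal Topology
open Filter Set

/-- A nested family of grids of boxes in `ℝⁿ`: the boxes of generation `j` have side lengths
`d j k`, and each side grows by the integer factor `r k` from one generation to the next. -/
structure BoxScale {n : ℕ} (r : Fin n → ℕ) where
  /-- The side lengths of generation `j`. -/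
  d : ℤ → Fin n → ℝ
  d_pos : ∀ j k, 0 < d j k
  two_le : ∀ k, 2 ≤ r k
  d_succ : ∀ j k, d (j + 1) k = r k * d j k

namespace BoxScale

variable {n : ℕ} {r : Fin n → ℕ} (S : BoxScale r)

/-- The index of the box of generation `j` containing `x`. -/
def idx (j : ℤ) (x : Fin n → ℝ) : Fin n → ℤ := fun k => ⌊x k / S.d j k⌋

/-- The box of generation `j` with index `q`. -/
def box (j : ℤ) (q : Fin n → ℤ) : Set (Fin n → ℝ) := S.idx j ⁻¹' {q}

/-- The volume of the boxes of generation `j`. -/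
def vol (j : ℤ) : ℝ≥0∞ := ∏ k, ENNReal.ofReal (S.d j k)

lemma measurable_idx (j : ℤ) : Measurable (S.idx j) := by
  unfold idx
  fun_prop

lemma measurableSet_box (j : ℤ) (q : Fin n → ℤ) : MeasurableSet (S.box j q) :=
  S.measurable_idx j (measurableSet_singleton q)

lemma box_eq_pi (j : ℤ) (q : Fin n → ℤ) :
    S.box j q = Set.pi univ fun k => Ico (q k * S.d j k) ((q k + 1) * S.d j k) := by
  ext x
  simp only [box, idx, mem_preimage, mem_singleton_iff, funext_iff, Set.mem_pi, mem_univ,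
    forall_const, mem_Ico, Int.floor_eq_iff]
  refine forall_congr' fun k => ?_
  rw [le_div_iff₀ (S.d_pos j k), div_lt_iff₀ (S.d_pos j k)]

lemma volume_box (j : ℤ) (q : Fin n → ℤ) : volume (S.box j q) = S.vol j := by
  rw [box_eq_pi, Real.volume_pi_Ico]
  exact Finset.prod_congr rfl fun k _ => by ring_nf

lemma vol_ne_zero (j : ℤ) : S.vol j ≠ 0 :=
  Finset.prod_ne_zero_iff.2 fun k _ => by simpa using S.d_pos j k

lemma vol_ne_top (j : ℤ) : S.vol j ≠ ∞ :=
  ENNReal.prod_ne_top fun _ _ => ENNReal.ofReal_ne_top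

lemma vol_succ (j : ℤ) : S.vol (j + 1) = (∏ k, (r k : ℝ≥0∞)) * S.vol j := by
  simp only [vol, ← Finset.prod_mul_distrib, S.d_succ]
  exact Finset.prod_congr rfl fun k _ => by
    rw [ENNReal.ofReal_mul (by positivity), ENNReal.ofReal_natCast]

lemma idx_succ (j : ℤ) (x : Fin n → ℝ) (k : Fin n) : S.idx (j + 1) x k = S.idx j x k / r k := by
  simp only [idx, S.d_succ]
  rw [mul_comm, ← div_div, Int.floor_div_natCast]

lemma idx_mono {i j : ℤ} (hij : j ≤ i) {x y : Fin n → ℝ} (h : S.idx j x = S.idx j y) :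
    S.idx i x = S.idx i y := by
  induction i, hij using Int.leInduction with
  | base => exact h
  | succ i _ ih => ext k; rw [idx_succ, idx_succ, ih]

lemma box_subset_succ (j : ℤ) (x : Fin n → ℝ) :
    S.box j (S.idx j x) ⊆ S.box (j + 1) (S.idx (j + 1) x) :=
  fun _ hy => S.idx_mono (by omega) hy

lemma d_neg_natCast (m : ℕ) (k : Fin n) : S.d (-m) k = ((r k : ℝ)⁻¹) ^ m * S.d 0 k := by
  have hr : (r k : ℝ) ≠ 0 := by have := S.two_le k; positivity
  induction m with
  | zero => simp
  | succ m ih =>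
    have h := S.d_succ (-(m + 1 : ℕ)) k
    rw [show -((m + 1 : ℕ) : ℤ) + 1 = -m by push_cast; ring, ih] at h
    rw [pow_succ, mul_assoc, mul_comm _ (S.d 0 k), ← mul_assoc, h]
    field_simp

lemma vol_two_mul_le [NeZero n] (j : ℤ) : 2 * S.vol j ≤ S.vol (j + 1) := by
  rw [vol_succ]
  gcongr
  have h : (2 : ℕ) ≤ ∏ k, r k :=
    (S.two_le 0).trans (Nat.le_of_dvd
      (Finset.prod_pos fun k _ => by have := S.two_le k; omega)
      (Finset.dvd_prod_of_mem r (Finset.mem_univ 0)))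
  exact_mod_cast h

lemma vol_mono [NeZero n] {i j : ℤ} (hij : i ≤ j) : S.vol i ≤ S.vol j := by
  induction j, hij using Int.leInduction with
  | base => exact le_rfl
  | succ j _ ih =>
    exact ih.trans (le_trans (by rw [two_mul]; exact le_self_add) (S.vol_two_mul_le j))

lemma exists_vol_ge [NeZero n] {c : ℝ≥0∞} (hc : c ≠ ∞) : ∃ m : ℕ, ∀ j : ℤ, m ≤ j → c ≤ S.vol j := by
  have key : ∀ m : ℕ, 2 ^ m * S.vol 0 ≤ S.vol m := by
    intro m
    induction m with
    | zero => simp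
    | succ m ih =>
      push_cast
      refine le_trans ?_ (S.vol_two_mul_le m)
      rw [pow_succ, mul_comm (2 ^ m) 2, mul_assoc]
      gcongr
  have h1 : c / S.vol 0 ≠ ∞ := ENNReal.div_ne_top hc (S.vol_ne_zero 0)
  obtain ⟨m, hm⟩ := ENNReal.exists_nat_gt h1
  refine ⟨m, fun j hj => le_trans ?_ (S.vol_mono hj)⟩
  refine le_trans ?_ (key m)
  rw [← ENNReal.div_le_iff (S.vol_ne_zero 0) (S.vol_ne_top 0)]
  refine hm.le.trans ?_
  exact_mod_cast (Nat.lt_two_pow_self (n := m)).le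

/-- Small boxes around a point are contained in a given neighbourhood. -/
lemma exists_box_subset {x : Fin n → ℝ} {U : Set (Fin n → ℝ)} (hU : U ∈ 𝓝 x) :
    ∃ j, S.box j (S.idx j x) ⊆ U := by
  obtain ⟨ε, hε, hU⟩ := Metric.mem_nhds_iff.1 hU
  have h : ∀ k, ∀ᶠ m : ℕ in atTop, S.d (-m) k < ε := by
    intro k
    have h2 : (2 : ℝ) ≤ r k := by exact_mod_cast S.two_le k
    have : Tendsto (fun m : ℕ => S.d (-m) k) atTop (𝓝 (0 * S.d 0 k)) := by
      simp only [d_neg_natCast]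
      exact (tendsto_pow_atTop_nhds_zero_of_lt_one (by positivity)
        (inv_lt_one_of_one_lt₀ (by linarith))).mul_const _
    rw [zero_mul] at this
    exact this.eventually_lt_const hε
  obtain ⟨m, hm⟩ := (eventually_all.2 h).exists
  refine ⟨-m, fun y hy => hU ?_⟩
  rw [Metric.mem_ball, dist_pi_lt_iff hε]
  intro k
  refine lt_of_le_of_lt ?_ (hm k)
  have hy' : S.idx (-m) y k = S.idx (-m) x k := congrFun hy k
  have hd := S.d_pos (-m) k
  have h1 := Int.abs_sub_lt_one_of_floor_eq_floor hy'
  rw [← sub_div, abs_div, abs_of_pos hd, div_lt_one hd] at h1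
  exact h1.le

variable (f : (Fin n → ℝ) → ℂ) (α : ℝ≥0∞)

/-- The average of `‖f‖` over the box of generation `j` around `x` exceeds `α`. -/
def IsHeavy (j : ℤ) (x : Fin n → ℝ) : Prop :=
  α * S.vol j < ∫⁻ y in S.box j (S.idx j x), ‖f y‖ₑ

/-- The stopping box with label `p`: the box `p.2` of generation `p.1` if it is a maximal heavy box,
and the empty set otherwise. -/
def stopBox (p : ℤ × (Fin n → ℤ)) : Set (Fin n → ℝ) :=
  {x | S.idx p.1 x = p.2 ∧ S.IsHeavy f α p.1 x ∧ ∀ i, p.1 < i → ¬ S.IsHeavy f α i x}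

variable {f α}

lemma isHeavy_congr {i j : ℤ} (hij : j ≤ i) {x y : Fin n → ℝ} (h : S.idx j x = S.idx j y) :
    S.IsHeavy f α i x ↔ S.IsHeavy f α i y := by
  unfold IsHeavy
  rw [S.idx_mono hij h]

lemma stopBox_eq_box {p : ℤ × (Fin n → ℤ)} {x : Fin n → ℝ} (hx : x ∈ S.stopBox f α p) :
    S.stopBox f α p = S.box p.1 p.2 := by
  obtain ⟨h1, h2, h3⟩ := hx
  ext y
  refine ⟨fun hy => hy.1, fun hy => ?_⟩
  have hxy : S.idx p.1 x = S.idx p.1 y := h1.trans (Eq.symm hy)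
  exact ⟨hy, (S.isHeavy_congr le_rfl hxy).1 h2,
    fun i hi => by rw [← S.isHeavy_congr hi.le hxy]; exact h3 i hi⟩

lemma stopBox_eq_empty_or (p : ℤ × (Fin n → ℤ)) :
    S.stopBox f α p = ∅ ∨ (S.stopBox f α p = S.box p.1 p.2 ∧ (S.stopBox f α p).Nonempty) := by
  rcases (S.stopBox f α p).eq_empty_or_nonempty with h | ⟨x, hx⟩
  · exact Or.inl h
  · exact Or.inr ⟨S.stopBox_eq_box hx, x, hx⟩

lemma measurableSet_stopBox (p : ℤ × (Fin n → ℤ)) : MeasurableSet (S.stopBox f α p) := by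
  rcases S.stopBox_eq_empty_or (f := f) (α := α) p with h | ⟨h, -⟩ <;> rw [h]
  · exact MeasurableSet.empty
  · exact S.measurableSet_box _ _

lemma pairwise_disjoint_stopBox : Pairwise (Function.onFun Disjoint (S.stopBox f α)) := by
  rintro ⟨i, q⟩ ⟨j, q'⟩ hne
  rw [Function.onFun, Set.disjoint_left]
  rintro x ⟨h1, h2, h3⟩ ⟨h4, h5, h6⟩
  simp only at h1 h2 h3 h4 h5 h6
  rcases lt_trichotomy i j with h | h | h
  · exact h3 j h h5
  · subst h; exact hne (by rw [← h1, ← h4])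
  · exact h6 i h h2

lemma mem_iUnion_stopBox [NeZero n] (hα : α ≠ 0) (hf : ∫⁻ y, ‖f y‖ₑ ≠ ∞) {j : ℤ}
    {x : Fin n → ℝ} (hx : S.IsHeavy f α j x) : x ∈ ⋃ p, S.stopBox f α p := by
  have hα' : α ≠ ∞ := by
    rintro rfl
    simp [IsHeavy, ENNReal.top_mul (S.vol_ne_zero j)] at hx
  obtain ⟨m, hm⟩ := S.exists_vol_ge (ENNReal.div_ne_top hf hα)
  have hb : ∀ i : ℤ, S.IsHeavy f α i x → i ≤ m := by
    intro i hi
    by_contra! hmi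
    have h1 := hm i hmi.le
    rw [ENNReal.div_le_iff hα hα', mul_comm] at h1
    exact absurd hi (not_lt.2 ((setLIntegral_le_lintegral _ _).trans h1))
  obtain ⟨i, hi, hmax⟩ := Int.exists_greatest_of_bdd (P := fun i => S.IsHeavy f α i x)
    ⟨m, hb⟩ ⟨j, hx⟩
  exact mem_iUnion.2 ⟨(i, S.idx i x), rfl, hi, fun i' hi' h => absurd (hmax i' h) (by omega)⟩

lemma mul_volume_stopBox_le (p : ℤ × (Fin n → ℤ)) :
    α * volume (S.stopBox f α p) ≤ ∫⁻ y in S.stopBox f α p, ‖f y‖ₑ := by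
  rcases S.stopBox_eq_empty_or (f := f) (α := α) p with h | ⟨h, x, hx⟩
  · simp [h]
  · have h2 := hx.2.1
    rw [IsHeavy, hx.1] at h2
    rw [h, volume_box]
    exact h2.le

lemma lintegral_stopBox_le (p : ℤ × (Fin n → ℤ)) :
    ∫⁻ y in S.stopBox f α p, ‖f y‖ₑ ≤ (∏ k, (r k : ℝ≥0∞)) * α * volume (S.stopBox f α p) := by
  rcases S.stopBox_eq_empty_or (f := f) (α := α) p with h | ⟨h, x, hx⟩
  · simp [h]
  · have h3 := hx.2.2 (p.1 + 1) (by omega)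
    rw [IsHeavy, not_lt, vol_succ] at h3
    rw [h, volume_box]
    refine (lintegral_mono_set ?_).trans (h3.trans (le_of_eq (by ring)))
    rw [← hx.1]
    exact S.box_subset_succ _ _

/-- Off the stopping boxes a continuous function is bounded by the level. -/
lemma enorm_le_of_notMem_stopBox [NeZero n] (hα : α ≠ 0) (hf : ∫⁻ y, ‖f y‖ₑ ≠ ∞)
    (hc : Continuous f) {x : Fin n → ℝ} (hx : x ∉ ⋃ p, S.stopBox f α p) : ‖f x‖ₑ ≤ α := by
  by_contra! hlt
  obtain ⟨β, h1, h2⟩ := exists_between hlt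
  have hU : {y | β < ‖f y‖ₑ} ∈ 𝓝 x := (isOpen_lt continuous_const hc.enorm).mem_nhds h2
  obtain ⟨j, hj⟩ := S.exists_box_subset hU
  refine hx (S.mem_iUnion_stopBox hα hf (j := j) ?_)
  calc α * S.vol j < β * S.vol j :=
        ENNReal.mul_lt_mul_left (S.vol_ne_zero j) (S.vol_ne_top j) h1
    _ = ∫⁻ y in S.box j (S.idx j x), β := by simp [volume_box]
    _ ≤ ∫⁻ y in S.box j (S.idx j x), ‖f y‖ₑ :=
        setLIntegral_mono' (S.measurableSet_box _ _) fun y hy => (hj hy).le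

end BoxScale

/-- Convolution of complex-valued functions on `ℝⁿ`. -/
def kconv {n : ℕ} (K f : (Fin n → ℝ) → ℂ) (x : Fin n → ℝ) : ℂ := ∫ y, K (x - y) * f y

/-- A convolution kernel, bounded and integrable, with `L²` operator norm at most `√B` and with
constant `H` in Hörmander's condition relative to the boxes of `S`. -/
structure IsCZKernel {n : ℕ} {r : Fin n → ℕ} (S : BoxScale r) (K : (Fin n → ℝ) → ℂ)
    (B H : ℝ≥0∞) : Prop where
  measurable : Measurable K
  integrable : Integrable K
  bounded : ∃ M : ℝ, ∀ x, ‖K x‖ ≤ M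
  lintegral_sq_le : ∀ g : (Fin n → ℝ) → ℂ, Integrable g → (∃ M : ℝ, ∀ x, ‖g x‖ ≤ M) →
    ∫⁻ x, ‖kconv K g x‖ₑ ^ 2 ≤ B * ∫⁻ x, ‖g x‖ₑ ^ 2
  hormander : ∀ j v, (∀ k, |v k| ≤ S.d j k) →
    ∫⁻ x in {x | ∃ k, 2 * S.d j k < |x k|}, ‖K (x - v) - K x‖ₑ ≤ H

section kconv

variable {n : ℕ} {K f g : (Fin n → ℝ) → ℂ}

lemma integrable_kconv_integrand (hK : Measurable K) (hb : ∃ M : ℝ, ∀ x, ‖K x‖ ≤ M)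
    (hf : Integrable f) (x : Fin n → ℝ) : Integrable fun y => K (x - y) * f y := by
  obtain ⟨M, hM⟩ := hb
  exact hf.bdd_mul (hK.comp (measurable_const.sub measurable_id)).aestronglyMeasurable
    (ae_of_all _ fun y => hM _)

lemma kconv_add (hK : Measurable K) (hb : ∃ M : ℝ, ∀ x, ‖K x‖ ≤ M)
    (hf : Integrable f) (hg : Integrable g) (x : Fin n → ℝ) :
    kconv K (fun y => f y + g y) x = kconv K f x + kconv K g x := by
  simp only [kconv, mul_add]
  exact integral_add (integrable_kconv_integrand hK hb hf x) (integrable_kconv_integrand hK hb hg x)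

lemma aestronglyMeasurable_kconv (hK : Integrable K) (hf : Integrable f) :
    AEStronglyMeasurable (kconv K f) volume := by
  have h := (hf.convolution_integrand (ContinuousLinearMap.mul ℝ ℂ) hK).integral_prod_left
  refine h.aestronglyMeasurable.congr (ae_of_all _ fun x => ?_)
  simp [kconv, mul_comm]

end kconv

namespace BoxScale

variable {n : ℕ} {r : Fin n → ℕ} (S : BoxScale r) (f : (Fin n → ℝ) → ℂ) (α : ℝ≥0∞)

open Classical in
/-- The good part of the Calderón–Zygmund decomposition of `f` at level `α`: the averages of `f`
over the stopping boxes, and `f` itself elsewhere. -/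
def good (x : Fin n → ℝ) : ℂ :=
  if h : ∃ p, x ∈ S.stopBox f α p then ⨍ y in S.stopBox f α h.choose, f y else f x

/-- The bad part of the Calderón–Zygmund decomposition. -/
def bad (x : Fin n → ℝ) : ℂ := f x - S.good f α x

/-- The lower corner of the box with label `p`. -/
def corner (p : ℤ × (Fin n → ℤ)) : Fin n → ℝ := fun k => p.2 k * S.d p.1 k

/-- The enlarged stopping boxes. -/
def starBox (p : ℤ × (Fin n → ℤ)) : Set (Fin n → ℝ) :=
  {x | (S.stopBox f α p).Nonempty ∧ ∀ k, |x k - S.corner p k| ≤ 2 * S.d p.1 k}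

variable {f α}

lemma good_eq_of_mem {p : ℤ × (Fin n → ℤ)} {x : Fin n → ℝ} (hx : x ∈ S.stopBox f α p) :
    S.good f α x = ⨍ y in S.stopBox f α p, f y := by
  have h : ∃ p, x ∈ S.stopBox f α p := ⟨p, hx⟩
  have hp : h.choose = p := by
    by_contra hne
    exact Set.disjoint_left.1 (S.pairwise_disjoint_stopBox hne) h.choose_spec hx
  rw [good, dif_pos h, hp]

lemma good_eq_of_notMem {x : Fin n → ℝ} (hx : x ∉ ⋃ p, S.stopBox f α p) :
    S.good f α x = f x := by
  rw [good, dif_neg (by simpa using hx)]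

lemma volume_stopBox_ne_top (p : ℤ × (Fin n → ℤ)) : volume (S.stopBox f α p) ≠ ∞ := by
  rcases S.stopBox_eq_empty_or (f := f) (α := α) p with h | ⟨h, -⟩ <;> rw [h]
  · simp
  · rw [volume_box]; exact S.vol_ne_top _

lemma volume_mul_enorm_average_le (p : ℤ × (Fin n → ℤ)) :
    volume (S.stopBox f α p) * ‖⨍ y in S.stopBox f α p, f y‖ₑ ≤
      ∫⁻ y in S.stopBox f α p, ‖f y‖ₑ := by
  have h := measure_smul_setAverage (μ := volume) f (S.volume_stopBox_ne_top (f := f) (α := α) p)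
  calc _ = ‖volume.real (S.stopBox f α p) • ⨍ y in S.stopBox f α p, f y‖ₑ := by
        rw [enorm_smul, Real.enorm_of_nonneg measureReal_nonneg,
          ofReal_measureReal (S.volume_stopBox_ne_top p)]
    _ ≤ _ := by rw [h]; exact enorm_integral_le_lintegral_enorm _

lemma one_le_prod (S : BoxScale r) : (1 : ℝ≥0∞) ≤ ∏ k, (r k : ℝ≥0∞) :=
  Finset.one_le_prod' fun k _ => by
    have := S.two_le k
    exact_mod_cast (by omega : 1 ≤ r k)

lemma enorm_good_le [NeZero n] (hα : α ≠ 0) (hf : ∫⁻ y, ‖f y‖ₑ ≠ ∞)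
    (hc : Continuous f) (x : Fin n → ℝ) : ‖S.good f α x‖ₑ ≤ (∏ k, (r k : ℝ≥0∞)) * α := by
  by_cases hx : x ∈ ⋃ p, S.stopBox f α p
  · obtain ⟨p, hp⟩ := mem_iUnion.1 hx
    rw [S.good_eq_of_mem hp]
    have h := (S.volume_mul_enorm_average_le (f := f) (α := α) p).trans (S.lintegral_stopBox_le p)
    rw [mul_comm] at h
    refine (ENNReal.mul_le_mul_iff_left ?_ (S.volume_stopBox_ne_top p)).1 h
    rw [S.stopBox_eq_box hp, volume_box]
    exact S.vol_ne_zero _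
  · rw [S.good_eq_of_notMem hx]
    refine (S.enorm_le_of_notMem_stopBox hα hf hc hx).trans ?_
    exact le_mul_of_one_le_left' S.one_le_prod

lemma measurableSet_iUnion_stopBox : MeasurableSet (⋃ p, S.stopBox f α p) :=
  MeasurableSet.iUnion fun p => S.measurableSet_stopBox p

lemma lintegral_eq_tsum_stopBox (F : (Fin n → ℝ) → ℝ≥0∞) :
    ∫⁻ x, F x = (∑' p, ∫⁻ x in S.stopBox f α p, F x) + ∫⁻ x in (⋃ p, S.stopBox f α p)ᶜ, F x := by
  rw [← lintegral_iUnion (fun p => S.measurableSet_stopBox p) S.pairwise_disjoint_stopBox,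
    lintegral_add_compl _ S.measurableSet_iUnion_stopBox]

lemma lintegral_good_le : ∫⁻ x, ‖S.good f α x‖ₑ ≤ ∫⁻ x, ‖f x‖ₑ := by
  rw [S.lintegral_eq_tsum_stopBox (f := f) (α := α) fun x => ‖S.good f α x‖ₑ,
    S.lintegral_eq_tsum_stopBox (f := f) (α := α) fun x => ‖f x‖ₑ]
  refine add_le_add (ENNReal.tsum_le_tsum fun p => ?_) (le_of_eq ?_)
  · refine le_trans (le_of_eq ?_) (S.volume_mul_enorm_average_le p)
    rw [setLIntegral_congr_fun (S.measurableSet_stopBox p)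
      (fun x hx => by rw [S.good_eq_of_mem hx]), setLIntegral_const, mul_comm]
  · exact setLIntegral_congr_fun S.measurableSet_iUnion_stopBox.compl
      fun x hx => by simp only [S.good_eq_of_notMem hx]

lemma integrable_good (hf : Integrable f) : Integrable (S.good f α) := by
  refine ⟨?_, S.lintegral_good_le.trans_lt hf.2⟩
  rw [← Measure.restrict_univ (μ := volume), ← union_compl_self (⋃ p, S.stopBox f α p),
    aestronglyMeasurable_union_iff]
  constructor
  · rw [aestronglyMeasurable_iUnion_iff]
    exact fun p => (aestronglyMeasurable_const
      (b := ⨍ y in S.stopBox f α p, f y)).congr <| by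
        filter_upwards [ae_restrict_mem (S.measurableSet_stopBox p)] with x hx
        rw [S.good_eq_of_mem hx]
  · refine hf.1.restrict.congr ?_
    filter_upwards [ae_restrict_mem S.measurableSet_iUnion_stopBox.compl] with x hx
    rw [S.good_eq_of_notMem hx]

lemma integrable_bad (hf : Integrable f) : Integrable (S.bad f α) := hf.sub (S.integrable_good hf)

lemma lintegral_bad_le (hf : Integrable f) : ∫⁻ x, ‖S.bad f α x‖ₑ ≤ 2 * ∫⁻ x, ‖f x‖ₑ := by
  calc ∫⁻ x, ‖S.bad f α x‖ₑ ≤ ∫⁻ x, (‖f x‖ₑ + ‖S.good f α x‖ₑ) :=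
        lintegral_mono fun x => enorm_sub_le
    _ = (∫⁻ x, ‖f x‖ₑ) + ∫⁻ x, ‖S.good f α x‖ₑ := lintegral_add_left' hf.1.enorm _
    _ ≤ _ := by rw [two_mul]; exact add_le_add le_rfl S.lintegral_good_le

lemma setIntegral_bad (hf : Integrable f) (p : ℤ × (Fin n → ℤ)) :
    ∫ x in S.stopBox f α p, S.bad f α x = 0 := by
  have h : ∫ x in S.stopBox f α p, S.good f α x = ∫ x in S.stopBox f α p, f x := by
    rw [setIntegral_congr_fun (S.measurableSet_stopBox p) (fun x hx => S.good_eq_of_mem hx),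
      setIntegral_const, measure_smul_setAverage _ (S.volume_stopBox_ne_top p)]
  simp only [bad]
  rw [integral_sub hf.integrableOn (S.integrable_good hf).integrableOn, h, sub_self]

lemma volume_starBox_le (p : ℤ × (Fin n → ℤ)) :
    volume (S.starBox f α p) ≤ 4 ^ n * volume (S.stopBox f α p) := by
  rcases S.stopBox_eq_empty_or (f := f) (α := α) p with h | ⟨h, -⟩
  · simp [starBox, h]
  · have hsub : S.starBox f α p ⊆ Set.pi univ fun k =>
        Icc (S.corner p k - 2 * S.d p.1 k) (S.corner p k + 2 * S.d p.1 k) := by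
      intro x hx k _
      have := abs_le.1 (hx.2 k)
      exact ⟨by linarith, by linarith⟩
    refine (measure_mono hsub).trans (le_of_eq ?_)
    rw [h, volume_box, vol, volume_pi_pi]
    simp only [Real.volume_Icc]
    calc _ = ∏ k, (4 * ENNReal.ofReal (S.d p.1 k)) := Finset.prod_congr rfl fun k _ => by
          rw [show S.corner p k + 2 * S.d p.1 k - (S.corner p k - 2 * S.d p.1 k) =
            4 * S.d p.1 k by ring, ENNReal.ofReal_mul (by norm_num)]
          norm_num
      _ = _ := by rw [Finset.prod_mul_distrib]; simp

lemma mul_volume_iUnion_starBox_le :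
    α * volume (⋃ p, S.starBox f α p) ≤ 4 ^ n * ∫⁻ x, ‖f x‖ₑ := by
  calc α * volume (⋃ p, S.starBox f α p) ≤ α * ∑' p, volume (S.starBox f α p) := by
        gcongr; exact measure_iUnion_le _
    _ = ∑' p, α * volume (S.starBox f α p) := ENNReal.tsum_mul_left.symm
    _ ≤ ∑' p, 4 ^ n * ∫⁻ x in S.stopBox f α p, ‖f x‖ₑ := ENNReal.tsum_le_tsum fun p => by
        refine (mul_le_mul_right (S.volume_starBox_le p) α).trans ?_
        rw [mul_left_comm]
        gcongr
        exact S.mul_volume_stopBox_le p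
    _ = 4 ^ n * ∑' p, ∫⁻ x in S.stopBox f α p, ‖f x‖ₑ := ENNReal.tsum_mul_left
    _ ≤ _ := by
        gcongr
        rw [S.lintegral_eq_tsum_stopBox (f := f) (α := α) fun x => ‖f x‖ₑ]
        exact le_self_add

lemma measurableSet_starBox (p : ℤ × (Fin n → ℤ)) : MeasurableSet (S.starBox f α p) := by
  unfold starBox
  measurability

end BoxScale

section Bad

variable {n : ℕ} {r : Fin n → ℕ} {S : BoxScale r} {K f : (Fin n → ℝ) → ℂ} {α B H : ℝ≥0∞}

lemma IsCZKernel.enorm_kconv_bad_le (hK : IsCZKernel S K B H) (hf : Integrable f)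
    (x : Fin n → ℝ) :
    ‖kconv K (S.bad f α) x‖ₑ ≤ ∑' p, ∫⁻ y in S.stopBox f α p,
      ‖K (x - y) - K (x - S.corner p)‖ₑ * ‖S.bad f α y‖ₑ := by
  have hb := S.integrable_bad (α := α) hf
  have hi := integrable_kconv_integrand hK.measurable hK.bounded hb x
  have h0 : kconv K (S.bad f α) x =
      ∑' p, ∫ y in S.stopBox f α p, K (x - y) * S.bad f α y := by
    rw [← integral_iUnion (fun p => S.measurableSet_stopBox p) S.pairwise_disjoint_stopBox
      hi.integrableOn, setIntegral_eq_integral_of_forall_compl_eq_zero]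
    · rfl
    · intro y hy
      simp [BoxScale.bad, S.good_eq_of_notMem hy]
  rw [h0]
  refine (enorm_tsum_le_tsum_enorm ..).trans (ENNReal.tsum_le_tsum fun p => ?_)
  have h1 : ∫ y in S.stopBox f α p, K (x - y) * S.bad f α y =
      ∫ y in S.stopBox f α p, (K (x - y) - K (x - S.corner p)) * S.bad f α y := by
    simp only [sub_mul]
    rw [integral_sub hi.integrableOn (hb.integrableOn.const_mul _), integral_const_mul,
      S.setIntegral_bad hf p, mul_zero, sub_zero]
  rw [h1]
  refine (enorm_integral_le_lintegral_enorm _).trans (le_of_eq ?_)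
  simp only [enorm_mul]

lemma IsCZKernel.lintegral_compl_starBox_le (hK : IsCZKernel S K B H) {p : ℤ × (Fin n → ℤ)}
    {y : Fin n → ℝ} (hy : y ∈ S.stopBox f α p) :
    ∫⁻ x in (⋃ p, S.starBox f α p)ᶜ, ‖K (x - y) - K (x - S.corner p)‖ₑ ≤ H := by
  set c := S.corner p
  set A : Set (Fin n → ℝ) := {x | ∃ k, 2 * S.d p.1 k < |x k|}
  have hA : MeasurableSet A := by
    simp only [A, ofPred_exists]
    exact MeasurableSet.iUnion fun k =>
      measurableSet_lt measurable_const (measurable_pi_apply k).abs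
  have hv : ∀ k, |(y - c) k| ≤ S.d p.1 k := by
    intro k
    have hy' := hy
    rw [S.stopBox_eq_box hy, S.box_eq_pi] at hy'
    have := hy' k (mem_univ k)
    simp only [mem_Ico] at this
    rw [abs_le]
    simp only [Pi.sub_apply, c, BoxScale.corner]
    have := S.d_pos p.1 k
    constructor <;> linarith
  refine le_trans ?_ (hK.hormander p.1 (y - c) hv)
  rw [← lintegral_indicator hA, ← lintegral_sub_right_eq_self (A.indicator _) c,
    ← lintegral_indicator (MeasurableSet.iUnion fun p => S.measurableSet_starBox p).compl]
  refine lintegral_mono fun x => ?_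
  by_cases hx : x ∈ (⋃ p, S.starBox f α p)ᶜ
  · have hxA : x - c ∈ A := by
      by_contra hxA
      simp only [A, mem_ofPred_eq, not_exists, not_lt] at hxA
      exact hx (mem_iUnion.2 ⟨p, ⟨y, hy⟩, hxA⟩)
    rw [indicator_of_mem hx, indicator_of_mem hxA, sub_sub_sub_cancel_right]
  · rw [indicator_of_notMem hx]
    exact zero_le

lemma IsCZKernel.lintegral_kconv_bad_le (hK : IsCZKernel S K B H) (hf : Integrable f) :
    ∫⁻ x in (⋃ p, S.starBox f α p)ᶜ, ‖kconv K (S.bad f α) x‖ₑ ≤ H * (2 * ∫⁻ x, ‖f x‖ₑ) := by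
  have hb := S.integrable_bad (α := α) hf
  have hmeas : ∀ p : ℤ × (Fin n → ℤ), AEMeasurable (fun z : (Fin n → ℝ) × (Fin n → ℝ) =>
      ‖K (z.1 - z.2) - K (z.1 - S.corner p)‖ₑ * ‖S.bad f α z.2‖ₑ)
      ((volume.restrict (⋃ p, S.starBox f α p)ᶜ).prod
        (volume.restrict (S.stopBox f α p))) := by
    intro p
    have h1 : Measurable fun z : (Fin n → ℝ) × (Fin n → ℝ) =>
        ‖K (z.1 - z.2) - K (z.1 - S.corner p)‖ₑ :=
      ((hK.measurable.comp (measurable_fst.sub measurable_snd)).sub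
        (hK.measurable.comp (measurable_fst.sub measurable_const))).enorm
    have h2 : AEMeasurable (fun y => ‖S.bad f α y‖ₑ) (volume.restrict (S.stopBox f α p)) :=
      hb.1.enorm.restrict
    exact h1.aemeasurable.mul h2.comp_snd
  calc _ ≤ ∫⁻ x in (⋃ p, S.starBox f α p)ᶜ, ∑' p, ∫⁻ y in S.stopBox f α p,
          ‖K (x - y) - K (x - S.corner p)‖ₑ * ‖S.bad f α y‖ₑ :=
        lintegral_mono fun x => hK.enorm_kconv_bad_le hf x
    _ = ∑' p, ∫⁻ x in (⋃ p, S.starBox f α p)ᶜ, ∫⁻ y in S.stopBox f α p,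
          ‖K (x - y) - K (x - S.corner p)‖ₑ * ‖S.bad f α y‖ₑ :=
        lintegral_tsum fun p => (hmeas p).lintegral_prod_right'
    _ ≤ ∑' p, ∫⁻ y in S.stopBox f α p, H * ‖S.bad f α y‖ₑ := ENNReal.tsum_le_tsum fun p => by
        rw [lintegral_lintegral_swap (hmeas p)]
        refine setLIntegral_mono_ae' (S.measurableSet_stopBox p) (ae_of_all _ fun y hy => ?_)
        have hm : Measurable fun x => ‖K (x - y) - K (x - S.corner p)‖ₑ :=
          ((hK.measurable.comp (measurable_id.sub measurable_const)).sub
            (hK.measurable.comp (measurable_id.sub measurable_const))).enorm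
        rw [lintegral_mul_const _ hm]
        gcongr
        exact hK.lintegral_compl_starBox_le hy
    _ = ∑' p, H * ∫⁻ y in S.stopBox f α p, ‖S.bad f α y‖ₑ := by
        congr 1; ext p; exact lintegral_const_mul'' _ hb.1.enorm.restrict
    _ = H * ∑' p, ∫⁻ y in S.stopBox f α p, ‖S.bad f α y‖ₑ := ENNReal.tsum_mul_left
    _ ≤ H * ∫⁻ y, ‖S.bad f α y‖ₑ := by
        gcongr
        rw [S.lintegral_eq_tsum_stopBox (f := f) (α := α) fun x => ‖S.bad f α x‖ₑ]
        exact le_self_add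
    _ ≤ _ := by gcongr; exact S.lintegral_bad_le hf

/-- The weak type `(1, 1)` inequality. -/
theorem IsCZKernel.weak_type [NeZero n] (hK : IsCZKernel S K B H) (hf : Integrable f)
    (hc : Continuous f) (hα : α ≠ 0) (hα' : α ≠ ∞) :
    α * volume {x | α < ‖kconv K f x‖ₑ} ≤
      (4 * B * (∏ k, (r k : ℝ≥0∞)) + 4 ^ n + 4 * H) * ∫⁻ x, ‖f x‖ₑ := by
  set D := ∏ k, (r k : ℝ≥0∞)
  have hD : D ≠ ∞ := ENNReal.prod_ne_top fun k _ => ENNReal.natCast_ne_top _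
  set U := ⋃ p, S.starBox f α p
  have hg := S.integrable_good (α := α) hf
  have hb := S.integrable_bad (α := α) hf
  have hgle := S.enorm_good_le hα hf.2.ne hc
  have hT : ∀ x, kconv K f x = kconv K (S.good f α) x + kconv K (S.bad f α) x := by
    intro x
    rw [← kconv_add hK.measurable hK.bounded hg hb]
    simp [BoxScale.bad]
  have hsub : {x | α < ‖kconv K f x‖ₑ} ⊆ {x | α / 2 ≤ ‖kconv K (S.good f α) x‖ₑ} ∪
      (U ∪ ({x | α / 2 ≤ ‖kconv K (S.bad f α) x‖ₑ} ∩ Uᶜ)) := by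
    intro x hx
    by_contra hcon
    simp only [mem_union, mem_inter_iff, mem_ofPred_eq, mem_compl_iff, not_or, not_and, not_le]
      at hcon
    obtain ⟨h1, h2, h3⟩ := hcon
    have h4 : ‖kconv K (S.bad f α) x‖ₑ < α / 2 := by
      by_contra! h; exact h3 h h2
    have := (enorm_add_le (kconv K (S.good f α) x) (kconv K (S.bad f α) x)).trans_lt
      (ENNReal.add_lt_add h1 h4)
    rw [← hT, ENNReal.add_halves] at this
    exact lt_asymm this hx
  have hα2 : α / 2 ≠ 0 := by simpa using hα
  have hα2' : α / 2 ≠ ∞ := ENNReal.div_ne_top hα' (by norm_num)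
  have e : 2 * (α / 2) = α := ENNReal.mul_div_cancel (by norm_num) (by norm_num)
  have hgood : α * volume {x | α / 2 ≤ ‖kconv K (S.good f α) x‖ₑ} ≤
      4 * B * D * ∫⁻ x, ‖f x‖ₑ := by
    have h1 : (α / 2) ^ 2 * volume {x | α / 2 ≤ ‖kconv K (S.good f α) x‖ₑ} ≤
        ∫⁻ x, ‖kconv K (S.good f α) x‖ₑ ^ 2 := by
      refine le_trans ?_ (mul_meas_ge_le_lintegral₀
        ((aestronglyMeasurable_kconv hK.integrable hg).enorm.pow_const 2) ((α / 2) ^ 2))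
      exact mul_le_mul_right (measure_mono fun x (hx : α / 2 ≤ _) => pow_le_pow_left' hx 2) _
    have h2 : ∫⁻ x, ‖kconv K (S.good f α) x‖ₑ ^ 2 ≤ B * (D * α * ∫⁻ x, ‖f x‖ₑ) := by
      refine (hK.lintegral_sq_le _ hg ⟨(D * α).toReal, fun x => ?_⟩).trans ?_
      · rw [← toReal_enorm]
        exact ENNReal.toReal_mono (ENNReal.mul_ne_top hD hα') (hgle x)
      · gcongr
        calc ∫⁻ x, ‖S.good f α x‖ₑ ^ 2 ≤ ∫⁻ x, D * α * ‖S.good f α x‖ₑ :=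
              lintegral_mono fun x => by rw [sq]; gcongr; exact hgle x
          _ = D * α * ∫⁻ x, ‖S.good f α x‖ₑ := lintegral_const_mul'' _ hg.1.enorm
          _ ≤ _ := mul_le_mul_right S.lintegral_good_le _
    refine (ENNReal.mul_le_mul_iff_right hα hα').1 ?_
    calc α * (α * volume {x | α / 2 ≤ ‖kconv K (S.good f α) x‖ₑ})
        = 4 * ((α / 2) ^ 2 * volume {x | α / 2 ≤ ‖kconv K (S.good f α) x‖ₑ}) := by
          nth_rw 1 [← e]
          nth_rw 2 [← e]
          ring
      _ ≤ 4 * (B * (D * α * ∫⁻ x, ‖f x‖ₑ)) := mul_le_mul_right (h1.trans h2) _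
      _ = _ := by ring
  have hbad : α * volume ({x | α / 2 ≤ ‖kconv K (S.bad f α) x‖ₑ} ∩ Uᶜ) ≤
      4 * H * ∫⁻ x, ‖f x‖ₑ := by
    have hU : MeasurableSet Uᶜ :=
      (MeasurableSet.iUnion fun p => S.measurableSet_starBox p).compl
    rw [← Measure.restrict_apply' hU]
    have h1 := mul_meas_ge_le_lintegral₀ (μ := volume.restrict Uᶜ)
      (aestronglyMeasurable_kconv hK.integrable hb).enorm.restrict (α / 2)
    nth_rw 1 [← e]
    rw [mul_assoc]
    refine (mul_le_mul_right (h1.trans (hK.lintegral_kconv_bad_le hf)) 2).trans (le_of_eq ?_)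
    ring
  calc _ ≤ α * (volume {x | α / 2 ≤ ‖kconv K (S.good f α) x‖ₑ} + (volume U +
          volume ({x | α / 2 ≤ ‖kconv K (S.bad f α) x‖ₑ} ∩ Uᶜ))) := by
        gcongr
        exact (measure_mono hsub).trans ((measure_union_le _ _).trans
          (by gcongr; exact measure_union_le _ _))
    _ ≤ 4 * B * D * (∫⁻ x, ‖f x‖ₑ) + (4 ^ n * (∫⁻ x, ‖f x‖ₑ) + 4 * H * ∫⁻ x, ‖f x‖ₑ) := by
        rw [mul_add, mul_add]
        exact add_le_add hgood (add_le_add S.mul_volume_iUnion_starBox_le hbad)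
    _ = _ := by ring

end Bad

section Interpolation

lemma lintegral_Ioo_mul_rpow {p a : ℝ} (hp : 1 < p) (ha : 0 ≤ a) :
    ∫⁻ t in Ioo 0 a, ENNReal.ofReal (a * t ^ (p - 2)) = ENNReal.ofReal (a ^ p / (p - 1)) := by
  have h_int : IntegrableOn (fun t : ℝ => a * t ^ (p - 2)) (Ioo 0 a) :=
    (((intervalIntegrable_iff_integrableOn_Ioc_of_le ha).1
      (intervalIntegral.intervalIntegrable_rpow' (by linarith))).mono_set
        Ioo_subset_Ioc_self).const_mul a
  rw [← ofReal_integral_eq_lintegral_ofReal h_int, integral_const_mul,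
    ← integral_Ioc_eq_integral_Ioo, ← intervalIntegral.integral_of_le ha,
    integral_rpow (Or.inl (by linarith))]
  · congr 1
    rcases ha.eq_or_lt with rfl | ha'
    · rw [zero_mul, Real.zero_rpow (by linarith), zero_div]
    · rw [show p - 2 + 1 = p - 1 by ring, Real.zero_rpow (by linarith), sub_zero, ← mul_div_assoc]
      congr 1
      rw [← Real.rpow_one_add' ha (by linarith)]
      ring_nf
  · filter_upwards [ae_restrict_mem measurableSet_Ioo] with t ht
    have := ht.1
    positivity

lemma lintegral_min_sq_mul_rpow_le {p a : ℝ} (hp : 1 < p) (hp2 : p < 2) (ha : 0 ≤ a) :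
    ∫⁻ t in Ioi 0, ENNReal.ofReal (min a t ^ 2 * t ^ (p - 3)) ≤
      ENNReal.ofReal (a ^ p * (1 / p + 1 / (2 - p))) := by
  rcases ha.eq_or_lt with rfl | ha'
  · rw [setLIntegral_congr_fun (g := fun _ => 0) measurableSet_Ioi]
    · simp
    · intro t ht
      simp [min_eq_left (le_of_lt (mem_Ioi.1 ht))]
  rw [← Ioc_union_Ioi_eq_Ioi ha]
  refine (lintegral_union_le _ _ _).trans ?_
  have h1 : ∫⁻ t in Ioc 0 a, ENNReal.ofReal (min a t ^ 2 * t ^ (p - 3)) =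
      ENNReal.ofReal (a ^ p / p) := by
    rw [setLIntegral_congr_fun (g := fun t => ENNReal.ofReal (t ^ (p - 1))) measurableSet_Ioc]
    · have h_int : IntegrableOn (fun t : ℝ => t ^ (p - 1)) (Ioc 0 a) :=
        (intervalIntegrable_iff_integrableOn_Ioc_of_le ha).1
          (intervalIntegral.intervalIntegrable_rpow' (by linarith))
      rw [← ofReal_integral_eq_lintegral_ofReal h_int, ← intervalIntegral.integral_of_le ha,
        integral_rpow (Or.inl (by linarith))]
      · rw [sub_add_cancel, Real.zero_rpow (by linarith), sub_zero]
      · filter_upwards [ae_restrict_mem measurableSet_Ioc] with t ht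
        have := ht.1
        positivity
    · intro t ht
      simp only
      rw [min_eq_right ht.2, ← Real.rpow_natCast t 2, ← Real.rpow_add ht.1]
      congr 2
      push_cast; ring
  have h2 : ∫⁻ t in Ioi a, ENNReal.ofReal (min a t ^ 2 * t ^ (p - 3)) =
      ENNReal.ofReal (a ^ p / (2 - p)) := by
    rw [setLIntegral_congr_fun (g := fun t => ENNReal.ofReal (a ^ 2 * t ^ (p - 3)))
      measurableSet_Ioi]
    · have h_int : IntegrableOn (fun t : ℝ => a ^ 2 * t ^ (p - 3)) (Ioi a) :=
        (integrableOn_Ioi_rpow_of_lt (by linarith) ha').const_mul _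
      rw [← ofReal_integral_eq_lintegral_ofReal h_int, integral_const_mul,
        integral_Ioi_rpow_of_lt (by linarith) ha']
      · congr 1
        rw [show p - 3 + 1 = p - 2 by ring, ← neg_sub 2 p, neg_div_neg_eq, ← mul_div_assoc,
          ← Real.rpow_natCast a 2, ← Real.rpow_add ha']
        congr 2
        push_cast; ring
      · filter_upwards [ae_restrict_mem measurableSet_Ioi] with t ht
        have : 0 < t := ha'.trans ht
        positivity
    · intro t ht
      simp only
      rw [min_eq_left (le_of_lt ht)]
  rw [h1, h2, ← ENNReal.ofReal_add (by positivity) (div_nonneg (by positivity) (by linarith))]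
  apply le_of_eq
  congr 1
  ring

variable {n : ℕ}

/-- The part of `f` of size at most `t`. -/
def clip (f : (Fin n → ℝ) → ℂ) (t : ℝ) (x : Fin n → ℝ) : ℂ := ((t / max ‖f x‖ t : ℝ) : ℂ) * f x

variable {f : (Fin n → ℝ) → ℂ} {t : ℝ}

lemma continuous_clip (hf : Continuous f) (ht : 0 < t) : Continuous (clip f t) := by
  refine Continuous.mul (Complex.continuous_ofReal.comp ?_) hf
  exact continuous_const.div (hf.norm.max continuous_const) fun x => (lt_max_of_lt_right ht).ne'

lemma norm_clip (ht : 0 < t) (x : Fin n → ℝ) : ‖clip f t x‖ = min ‖f x‖ t := by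
  have hm : 0 < max ‖f x‖ t := lt_max_of_lt_right ht
  rw [clip, norm_mul, Complex.norm_of_nonneg (by positivity), div_mul_eq_mul_div, mul_comm,
    ← min_mul_max, mul_div_assoc, div_self hm.ne', mul_one]

lemma norm_sub_clip_le (ht : 0 < t) (x : Fin n → ℝ) :
    ‖f x - clip f t x‖ ≤ if t < ‖f x‖ then ‖f x‖ else 0 := by
  split_ifs with h
  · rw [clip, max_eq_left h.le, ← one_sub_mul, norm_mul]
    refine mul_le_of_le_one_left (norm_nonneg _) ?_
    rw [← Complex.ofReal_one, ← Complex.ofReal_sub, Complex.norm_real, Real.norm_eq_abs, abs_le]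
    have h1 : t / ‖f x‖ ≤ 1 := (div_le_one (ht.trans h)).2 h.le
    have h2 : 0 ≤ t / ‖f x‖ := by positivity
    constructor <;> linarith
  · rw [clip, max_eq_right (not_lt.1 h), div_self ht.ne']
    simp

variable {r : Fin n → ℕ} {S : BoxScale r} {K : (Fin n → ℝ) → ℂ} {B H : ℝ≥0∞}

/-- The constant in the weak type inequality. -/
def weakConst (r : Fin n → ℕ) (B H : ℝ≥0∞) : ℝ≥0∞ :=
  4 * B * (∏ k, (r k : ℝ≥0∞)) + 4 ^ n + 4 * H

lemma weakConst_ne_top (r : Fin n → ℕ) (hB : B ≠ ∞) (hH : H ≠ ∞) : weakConst r B H ≠ ∞ := by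
  have : ∏ k, (r k : ℝ≥0∞) ≠ ∞ := ENNReal.prod_ne_top fun k _ => ENNReal.natCast_ne_top _
  unfold weakConst
  finiteness

lemma IsCZKernel.volume_lt_mul_rpow_le [NeZero n] (hK : IsCZKernel S K B H) (hf : Integrable f)
    (hc : Continuous f) (hfb : ∃ M : ℝ, ∀ x, ‖f x‖ ≤ M) {p : ℝ} (ht : 0 < t) :
    volume {x | t < ‖kconv K f x‖} * ENNReal.ofReal (t ^ (p - 1)) ≤
      2 * weakConst r B H * (∫⁻ x, {x | t < ‖f x‖}.indicator
        (fun x => ENNReal.ofReal (‖f x‖ * t ^ (p - 2))) x) +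
      4 * B * ∫⁻ x, ENNReal.ofReal (min ‖f x‖ t ^ 2 * t ^ (p - 3)) := by
  obtain ⟨M, hM⟩ := hfb
  have hc2 := continuous_clip hc ht
  have hc1 : Continuous fun x => f x - clip f t x := hc.sub hc2
  have hf2 : Integrable (clip f t) := hf.mono hc2.aestronglyMeasurable (ae_of_all _ fun x => by
    rw [norm_clip ht]; exact min_le_left _ _)
  have hf1 : Integrable fun x => f x - clip f t x := hf.sub hf2
  have hT : ∀ x, kconv K f x = kconv K (fun x => f x - clip f t x) x + kconv K (clip f t) x := by
    intro x
    rw [← kconv_add hK.measurable hK.bounded hf1 hf2]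
    simp
  set τ : ℝ≥0∞ := ENNReal.ofReal (t / 2) with hτ
  have hτ0 : τ ≠ 0 := by simpa [hτ] using ht
  have hsub : {x | t < ‖kconv K f x‖} ⊆ {x | τ < ‖kconv K (fun x => f x - clip f t x) x‖ₑ} ∪
      {x | τ ≤ ‖kconv K (clip f t) x‖ₑ} := by
    intro x hx
    by_contra hcon
    simp only [mem_union, mem_ofPred_eq, not_or, not_lt, not_le, hτ, ← ofReal_norm] at hcon
    have h1 := (ENNReal.ofReal_le_ofReal_iff (by positivity)).1 hcon.1
    have h2 := (ENNReal.ofReal_lt_ofReal_iff (by positivity)).1 hcon.2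
    have h3 := norm_add_le (kconv K (fun x => f x - clip f t x) x) (kconv K (clip f t) x)
    rw [← hT] at h3
    have : t < ‖kconv K f x‖ := hx
    linarith
  have hA := hK.weak_type hf1 hc1 hτ0 ENNReal.ofReal_ne_top
  rw [← weakConst.eq_1] at hA
  have hB : τ ^ 2 * volume {x | τ ≤ ‖kconv K (clip f t) x‖ₑ} ≤
      B * ∫⁻ x, ‖clip f t x‖ₑ ^ 2 := by
    refine le_trans ?_ (hK.lintegral_sq_le _ hf2 ⟨t, fun x => by
      rw [norm_clip ht]; exact min_le_right _ _⟩)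
    refine le_trans ?_ (mul_meas_ge_le_lintegral₀
      ((aestronglyMeasurable_kconv hK.integrable hf2).enorm.pow_const 2) (τ ^ 2))
    exact mul_le_mul_right (measure_mono fun x (hx : τ ≤ _) => pow_le_pow_left' hx 2) _
  have e1 : ENNReal.ofReal (t ^ (p - 1)) = 2 * ENNReal.ofReal (t ^ (p - 2)) * τ := by
    rw [hτ, mul_assoc, ← ENNReal.ofReal_mul (by positivity)]
    rw [show (2 : ℝ≥0∞) = ENNReal.ofReal 2 by norm_num, ← ENNReal.ofReal_mul (by norm_num)]
    rw [show p - 1 = p - 2 + 1 by ring, Real.rpow_add_one ht.ne']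
    congr 1
    ring
  have e2 : ENNReal.ofReal (t ^ (p - 1)) = 4 * ENNReal.ofReal (t ^ (p - 3)) * τ ^ 2 := by
    rw [hτ, mul_assoc, ← ENNReal.ofReal_pow (by positivity), ← ENNReal.ofReal_mul (by positivity)]
    rw [show (4 : ℝ≥0∞) = ENNReal.ofReal 4 by norm_num, ← ENNReal.ofReal_mul (by norm_num)]
    rw [show p - 1 = p - 3 + 1 + 1 by ring, Real.rpow_add_one ht.ne', Real.rpow_add_one ht.ne']
    congr 1
    ring
  calc _ ≤ (volume {x | τ < ‖kconv K (fun x => f x - clip f t x) x‖ₑ} +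
        volume {x | τ ≤ ‖kconv K (clip f t) x‖ₑ}) * ENNReal.ofReal (t ^ (p - 1)) := by
        gcongr
        exact (measure_mono hsub).trans (measure_union_le _ _)
    _ = 2 * ENNReal.ofReal (t ^ (p - 2)) *
          (τ * volume {x | τ < ‖kconv K (fun x => f x - clip f t x) x‖ₑ}) +
        4 * ENNReal.ofReal (t ^ (p - 3)) *
          (τ ^ 2 * volume {x | τ ≤ ‖kconv K (clip f t) x‖ₑ}) := by
        rw [add_mul]
        nth_rw 1 [e1]
        rw [e2]
        ring
    _ ≤ 2 * ENNReal.ofReal (t ^ (p - 2)) *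
          (weakConst r B H * ∫⁻ x, ‖f x - clip f t x‖ₑ) +
        4 * ENNReal.ofReal (t ^ (p - 3)) * (B * ∫⁻ x, ‖clip f t x‖ₑ ^ 2) := by
        exact add_le_add (mul_le_mul_right hA _) (mul_le_mul_right hB _)
    _ = 2 * weakConst r B H * (∫⁻ x, ENNReal.ofReal (t ^ (p - 2)) * ‖f x - clip f t x‖ₑ) +
        4 * B * ∫⁻ x, ENNReal.ofReal (t ^ (p - 3)) * ‖clip f t x‖ₑ ^ 2 := by
        rw [lintegral_const_mul' _ _ ENNReal.ofReal_ne_top,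
          lintegral_const_mul' _ _ ENNReal.ofReal_ne_top]
        ring
    _ ≤ _ := by
        refine add_le_add (mul_le_mul_right (lintegral_mono fun x => ?_) _)
          (mul_le_mul_right (lintegral_mono fun x => ?_) _)
        · have h := norm_sub_clip_le (f := f) ht x
          by_cases hx : t < ‖f x‖
          · rw [indicator_of_mem (show x ∈ {x | t < ‖f x‖} from hx), ← ofReal_norm,
              ← ENNReal.ofReal_mul (by positivity), mul_comm]
            rw [if_pos hx] at h
            gcongr
          · rw [if_neg hx] at h
            rw [indicator_of_notMem (show x ∉ {x | t < ‖f x‖} from hx), ← ofReal_norm,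
              le_antisymm h (norm_nonneg _)]
            simp
        · rw [← ofReal_norm, norm_clip ht, ← ENNReal.ofReal_pow (by positivity),
            ← ENNReal.ofReal_mul (by positivity), mul_comm]

lemma lintegral_enorm_rpow (F : (Fin n → ℝ) → ℂ) {p : ℝ} (hp : 0 ≤ p) :
    ∫⁻ x, ‖F x‖ₑ ^ p = ∫⁻ x, ENNReal.ofReal (‖F x‖ ^ p) :=
  lintegral_congr fun x => by
    rw [← ofReal_norm, ENNReal.ofReal_rpow_of_nonneg (norm_nonneg _) hp]

/-- Strong type `(p, p)` for `1 < p < 2`, by interpolation between the weak type `(1, 1)` and the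
strong type `(2, 2)` estimates. -/
theorem IsCZKernel.strong_type_lt_two [NeZero n] (hK : IsCZKernel S K B H) (hf : Integrable f)
    (hc : Continuous f) (hfb : ∃ M : ℝ, ∀ x, ‖f x‖ ≤ M) {p : ℝ} (hp : 1 < p) (hp2 : p < 2) :
    ∫⁻ x, ‖kconv K f x‖ₑ ^ p ≤
      ENNReal.ofReal p * (2 * weakConst r B H * ENNReal.ofReal (1 / (p - 1)) +
        4 * B * ENNReal.ofReal (1 / p + 1 / (2 - p))) * ∫⁻ x, ‖f x‖ₑ ^ p := by
  have hm := hc.measurable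
  have m1 : Measurable (Function.uncurry fun (t : ℝ) (x : Fin n → ℝ) =>
      {x | t < ‖f x‖}.indicator (fun x => ENNReal.ofReal (‖f x‖ * t ^ (p - 2))) x) := by
    have : (Function.uncurry fun (t : ℝ) (x : Fin n → ℝ) =>
      {x | t < ‖f x‖}.indicator (fun x => ENNReal.ofReal (‖f x‖ * t ^ (p - 2))) x) =
      {z : ℝ × (Fin n → ℝ) | z.1 < ‖f z.2‖}.indicator
        (fun z => ENNReal.ofReal (‖f z.2‖ * z.1 ^ (p - 2))) := rfl
    rw [this]
    exact Measurable.indicator (by fun_prop)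
      (measurableSet_lt measurable_fst (hm.comp measurable_snd).norm)
  have m2 : Measurable (Function.uncurry fun (t : ℝ) (x : Fin n → ℝ) =>
      ENNReal.ofReal (min ‖f x‖ t ^ 2 * t ^ (p - 3))) := by
    unfold Function.uncurry
    fun_prop
  have hmain : ∀ x, (∫⁻ t in Ioi 0, {x | t < ‖f x‖}.indicator
      (fun x => ENNReal.ofReal (‖f x‖ * t ^ (p - 2))) x) =
      ENNReal.ofReal (1 / (p - 1)) * ‖f x‖ₑ ^ p := by
    intro x
    have : ∀ t : ℝ, {x | t < ‖f x‖}.indicator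
        (fun x => ENNReal.ofReal (‖f x‖ * t ^ (p - 2))) x =
        (Iio ‖f x‖).indicator (fun t => ENNReal.ofReal (‖f x‖ * t ^ (p - 2))) t := fun t => rfl
    simp only [this]
    rw [lintegral_indicator measurableSet_Iio, Measure.restrict_restrict measurableSet_Iio,
      inter_comm, Ioi_inter_Iio, lintegral_Ioo_mul_rpow hp (norm_nonneg _), ← ofReal_norm,
      ENNReal.ofReal_rpow_of_nonneg (norm_nonneg _) (by linarith),
      ← ENNReal.ofReal_mul (by simpa using by linarith)]
    congr 1
    ring
  have hmain2 : ∀ x, (∫⁻ t in Ioi 0, ENNReal.ofReal (min ‖f x‖ t ^ 2 * t ^ (p - 3))) ≤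
      ENNReal.ofReal (1 / p + 1 / (2 - p)) * ‖f x‖ₑ ^ p := by
    intro x
    refine (lintegral_min_sq_mul_rpow_le hp hp2 (norm_nonneg _)).trans (le_of_eq ?_)
    rw [← ofReal_norm, ENNReal.ofReal_rpow_of_nonneg (norm_nonneg _) (by linarith), mul_comm,
      ENNReal.ofReal_mul]
    have : 0 < 2 - p := by linarith
    positivity
  rw [lintegral_enorm_rpow _ (by linarith), lintegral_rpow_eq_lintegral_meas_lt_mul volume
    (ae_of_all _ fun x => norm_nonneg _)
    (aestronglyMeasurable_kconv hK.integrable hf).norm.aemeasurable (by linarith), mul_assoc]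
  refine mul_le_mul_right ?_ _
  calc _ ≤ ∫⁻ t in Ioi (0 : ℝ), (2 * weakConst r B H * (∫⁻ x, {x | t < ‖f x‖}.indicator
        (fun x => ENNReal.ofReal (‖f x‖ * t ^ (p - 2))) x) +
      4 * B * ∫⁻ x, ENNReal.ofReal (min ‖f x‖ t ^ 2 * t ^ (p - 3))) :=
        setLIntegral_mono' measurableSet_Ioi fun t ht =>
          hK.volume_lt_mul_rpow_le hf hc hfb ht
    _ = 2 * weakConst r B H * (∫⁻ x, ∫⁻ t in Ioi (0 : ℝ), {x | t < ‖f x‖}.indicator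
        (fun x => ENNReal.ofReal (‖f x‖ * t ^ (p - 2))) x) +
      4 * B * ∫⁻ x, ∫⁻ t in Ioi (0 : ℝ), ENNReal.ofReal (min ‖f x‖ t ^ 2 * t ^ (p - 3)) := by
        have n1 : Measurable fun t : ℝ => ∫⁻ x, {x | t < ‖f x‖}.indicator
          (fun x => ENNReal.ofReal (‖f x‖ * t ^ (p - 2))) x := m1.lintegral_prod_right'
        have n2 : Measurable fun t : ℝ => ∫⁻ x, ENNReal.ofReal (min ‖f x‖ t ^ 2 * t ^ (p - 3)) :=
          m2.lintegral_prod_right'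
        rw [lintegral_add_left (n1.const_mul _), lintegral_const_mul _ n1,
          lintegral_const_mul _ n2,
          lintegral_lintegral_swap m1.aemeasurable, lintegral_lintegral_swap m2.aemeasurable]
    _ ≤ 2 * weakConst r B H * (∫⁻ x, ENNReal.ofReal (1 / (p - 1)) * ‖f x‖ₑ ^ p) +
      4 * B * ∫⁻ x, ENNReal.ofReal (1 / p + 1 / (2 - p)) * ‖f x‖ₑ ^ p := by
        simp only [hmain]
        exact add_le_add le_rfl (mul_le_mul_right (lintegral_mono hmain2) _)
    _ = _ := by
        rw [lintegral_const_mul' _ _ ENNReal.ofReal_ne_top,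
          lintegral_const_mul' _ _ ENNReal.ofReal_ne_top]
        ring

end Interpolation

section Duality

variable {n : ℕ} {r : Fin n → ℕ} {S : BoxScale r} {K f : (Fin n → ℝ) → ℂ} {B H : ℝ≥0∞}

lemma kconv_comp_neg (K g : (Fin n → ℝ) → ℂ) (x : Fin n → ℝ) :
    kconv (fun x => K (-x)) g x = kconv K (fun x => g (-x)) (-x) := by
  unfold kconv
  rw [← integral_neg_eq_self]
  simp [sub_eq_add_neg, add_comm]

lemma IsCZKernel.comp_neg (hK : IsCZKernel S K B H) :
    IsCZKernel S (fun x => K (-x)) B H where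
  measurable := hK.measurable.comp measurable_neg
  integrable := hK.integrable.comp_neg
  bounded := hK.bounded.imp fun M hM x => hM (-x)
  lintegral_sq_le g hg hb := by
    have h := hK.lintegral_sq_le (fun x => g (-x)) hg.comp_neg (hb.imp fun M hM x => hM (-x))
    simp only [kconv_comp_neg]
    rw [← lintegral_neg_eq_self (fun x => ‖g x‖ₑ ^ 2)]
    rwa [lintegral_neg_eq_self (fun x => ‖kconv K (fun x => g (-x)) x‖ₑ ^ 2)]
  hormander j v hv := by
    have h := hK.hormander j (-v) (by simpa using hv)
    refine le_trans (le_of_eq ?_) h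
    have hpre : {x : Fin n → ℝ | ∃ k, 2 * S.d j k < |x k|} =
      Neg.neg ⁻¹' {x : Fin n → ℝ | ∃ k, 2 * S.d j k < |x k|} := by ext; simp
    rw [← (Measure.measurePreserving_neg (volume : Measure (Fin n → ℝ))
      ).setLIntegral_comp_preimage_emb
      (MeasurableEquiv.neg _).measurableEmbedding, ← hpre]
    simp [sub_eq_add_neg, add_comm]

lemma integrable_kconv (hK : Integrable K) (hf : Integrable f) : Integrable (kconv K f) :=
  hf.integrable_convolution (ContinuousLinearMap.mul ℝ ℂ).flip hK

lemma kconv_eq_integral_mul (K f : (Fin n → ℝ) → ℂ) (x : Fin n → ℝ) :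
    kconv K f x = ∫ y, K y * f (x - y) := by
  unfold kconv
  rw [← integral_sub_left_eq_self _ volume x]
  simp

lemma continuous_kconv (hK : Integrable K) (hc : Continuous f) (hfb : ∃ M : ℝ, ∀ x, ‖f x‖ ≤ M) :
    Continuous (kconv K f) := by
  obtain ⟨M, hM⟩ := hfb
  rw [show kconv K f = fun x => ∫ y, K y * f (x - y) from funext (kconv_eq_integral_mul K f)]
  refine continuous_of_dominated (bound := fun y => ‖K y‖ * M) (fun x => ?_) (fun x => ?_)
    (hK.norm.mul_const _) (ae_of_all _ fun y => by fun_prop)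
  · exact hK.aestronglyMeasurable.mul (by fun_prop)
  · refine ae_of_all _ fun y => ?_
    rw [norm_mul]
    gcongr
    exact hM _

lemma norm_kconv_le (hK : Integrable K) (hfb : ∃ M : ℝ, ∀ x, ‖f x‖ ≤ M) :
    ∃ M : ℝ, ∀ x, ‖kconv K f x‖ ≤ M := by
  obtain ⟨M, hM⟩ := hfb
  refine ⟨∫ y, ‖K y‖ * M, fun x => ?_⟩
  rw [kconv_eq_integral_mul]
  refine norm_integral_le_of_norm_le (hK.norm.mul_const _) (ae_of_all _ fun y => ?_)
  rw [norm_mul]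
  gcongr
  exact hM _

lemma integral_kconv_mul (hK : Integrable K) (hf : Integrable f) {g : (Fin n → ℝ) → ℂ}
    (hg : Measurable g) (hgb : ∃ M : ℝ, ∀ x, ‖g x‖ ≤ M) :
    ∫ x, kconv K f x * g x = ∫ y, f y * kconv (fun x => K (-x)) g y := by
  obtain ⟨M, hM⟩ := hgb
  have hi : Integrable (fun z : (Fin n → ℝ) × (Fin n → ℝ) => K (z.1 - z.2) * f z.2 * g z.1)
      (volume.prod volume) :=
    (hf.convolution_integrand (ContinuousLinearMap.mul ℝ ℂ).flip hK).mul_bdd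
      (hg.comp measurable_fst).aestronglyMeasurable (ae_of_all _ fun z => hM z.1)
  unfold kconv
  simp only [← integral_mul_const, ← integral_const_mul]
  rw [integral_integral_swap hi]
  congr! 4 with y x
  rw [neg_sub]
  ring

theorem IsCZKernel.strong_type_two_lt [NeZero n] (hK : IsCZKernel S K B H) (hf : Integrable f)
    (hc : Continuous f) (hfb : ∃ M : ℝ, ∀ x, ‖f x‖ ≤ M) {p q : ℝ} (hpq : p.HolderConjugate q)
    (hq : 2 < q) {C : ℝ≥0∞} (hC : ∀ g : (Fin n → ℝ) → ℂ, Continuous g → Integrable g →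
      (∃ M : ℝ, ∀ x, ‖g x‖ ≤ M) →
      ∫⁻ x, ‖kconv (fun x => K (-x)) g x‖ₑ ^ p ≤ C * ∫⁻ x, ‖g x‖ₑ ^ p) :
    ∫⁻ x, ‖kconv K f x‖ₑ ^ q ≤ C ^ (q / p) * ∫⁻ x, ‖f x‖ₑ ^ q := by
  set F := kconv K f with hF
  have hFc : Continuous F := continuous_kconv hK.integrable hc hfb
  have hFi : Integrable F := integrable_kconv hK.integrable hf
  obtain ⟨M, hM⟩ := norm_kconv_le hK.integrable hfb
  have hp0 := hpq.pos
  have hq0 := hpq.symm.pos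
  have hpow : ∀ {s : ℝ}, 1 < s → Integrable fun x => ‖F x‖ ^ s := by
    intro s hs
    refine (hFi.norm.const_mul (M ^ (s - 1))).mono'
      (hFc.norm.rpow_const fun x => Or.inr (by linarith)).aestronglyMeasurable
      (ae_of_all _ fun x => ?_)
    rw [Real.norm_of_nonneg (by positivity)]
    calc ‖F x‖ ^ s = ‖F x‖ ^ (s - 1) * ‖F x‖ := by
          rw [← Real.rpow_add_one' (norm_nonneg _) (by linarith)]; simp
      _ ≤ _ := by
          refine mul_le_mul_of_nonneg_right ?_ (norm_nonneg _)
          exact Real.rpow_le_rpow (norm_nonneg _) (hM x) (by linarith)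
  let g : (Fin n → ℝ) → ℂ := fun x => (starRingEnd ℂ) (F x) * ((‖F x‖ ^ (q - 2) : ℝ) : ℂ)
  have hgc : Continuous g := (Complex.continuous_conj.comp hFc).mul
    (Complex.continuous_ofReal.comp (hFc.norm.rpow_const fun x => Or.inr (by linarith)))
  have hgn : ∀ x, ‖g x‖ = ‖F x‖ ^ (q - 1) := fun x => by
    simp only [g, norm_mul, RCLike.norm_conj, Complex.norm_real]
    rw [Real.norm_of_nonneg (by positivity), ← Real.rpow_one_add' (norm_nonneg _) (by linarith)]
    ring_nf
  have hgi : Integrable g := by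
    refine ((hpow (s := q - 1) (by linarith))).mono' hgc.aestronglyMeasurable
      (ae_of_all _ fun x => (hgn x).le)
  have hgb : ∃ M : ℝ, ∀ x, ‖g x‖ ≤ M := ⟨M ^ (q - 1), fun x => by
    rw [hgn]
    gcongr
    · linarith
    · exact hM x⟩
  set X := ∫⁻ x, ‖F x‖ₑ ^ q with hX
  set Y := ∫⁻ x, ‖f x‖ₑ ^ q with hY
  have hXtop : X ≠ ∞ := by
    rw [hX, lintegral_enorm_rpow F hq0.le]
    exact (hpow (s := q) (by linarith)).lintegral_lt_top.ne
  have hgX : ∫⁻ x, ‖g x‖ₑ ^ p = X := by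
    rw [lintegral_enorm_rpow g hp0.le, hX, lintegral_enorm_rpow F hq0.le]
    refine lintegral_congr fun x => ?_
    rw [hgn, ← Real.rpow_mul (norm_nonneg _)]
    congr 3
    linarith [hpq.mul_eq_add]
  have hXeq : X = ‖∫ x, F x * g x‖ₑ := by
    have h1 : ∀ x, F x * g x = ((‖F x‖ ^ q : ℝ) : ℂ) := fun x => by
      simp only [g]
      rw [← mul_assoc, Complex.mul_conj, Complex.normSq_eq_norm_sq, ← Complex.ofReal_mul,
        ← Real.rpow_two, ← Real.rpow_add' (norm_nonneg _) (by linarith)]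
      congr 2; ring
    simp only [h1]
    rw [integral_complex_ofReal, ← ofReal_norm, Complex.norm_real,
      Real.norm_of_nonneg (integral_nonneg fun x => by positivity),
      ofReal_integral_eq_lintegral_ofReal (hpow (by linarith)) (ae_of_all _ fun x => by positivity),
      hX, lintegral_enorm_rpow F hq0.le]
  have hmain : X ≤ Y ^ (1 / q) * (C ^ (1 / p) * X ^ (1 / p)) := by
    calc X = ‖∫ y, f y * kconv (fun x => K (-x)) g y‖ₑ := by
          rw [hXeq, hF, integral_kconv_mul hK.integrable hf hgc.measurable hgb]
      _ ≤ ∫⁻ y, ‖f y‖ₑ * ‖kconv (fun x => K (-x)) g y‖ₑ := by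
          refine (enorm_integral_le_lintegral_enorm _).trans (le_of_eq ?_)
          simp only [enorm_mul]
      _ ≤ Y ^ (1 / q) * (∫⁻ y, ‖kconv (fun x => K (-x)) g y‖ₑ ^ p) ^ (1 / p) :=
          ENNReal.lintegral_mul_le_Lp_mul_Lq volume hpq.symm hc.measurable.enorm.aemeasurable
            (aestronglyMeasurable_kconv hK.integrable.comp_neg hgi).enorm
      _ ≤ _ := by
          refine mul_le_mul_right ?_ _
          rw [← ENNReal.mul_rpow_of_nonneg _ _ (by positivity)]
          refine ENNReal.rpow_le_rpow ?_ (by positivity)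
          rw [← hgX]
          exact hC g hgc hgi hgb
  rcases eq_or_ne X 0 with h0 | h0
  · rw [h0]; exact zero_le
  have hXp : X = X ^ (1 / p) * X ^ (1 / q) := by
    rw [← ENNReal.rpow_add _ _ h0 hXtop, one_div, one_div, hpq.inv_add_inv_eq_one, ENNReal.rpow_one]
  have h2 : X ^ (1 / q) ≤ C ^ (1 / p) * Y ^ (1 / q) := by
    have h3 : X ^ (1 / p) * X ^ (1 / q) ≤ X ^ (1 / p) * (C ^ (1 / p) * Y ^ (1 / q)) := by
      rw [← hXp]
      exact hmain.trans (le_of_eq (by ring))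
    have hne : X ^ (1 / p) ≠ 0 := by simp [h0, hXtop]
    have hnt : X ^ (1 / p) ≠ ∞ := ENNReal.rpow_ne_top_of_nonneg (by positivity) hXtop
    exact (ENNReal.mul_le_mul_iff_right hne hnt).1 h3
  have h4 := ENNReal.rpow_le_rpow h2 hq0.le
  rw [ENNReal.mul_rpow_of_nonneg _ _ hq0.le, ← ENNReal.rpow_mul, ← ENNReal.rpow_mul,
    ← ENNReal.rpow_mul, one_div_mul_cancel hq0.ne', ENNReal.rpow_one, ENNReal.rpow_one] at h4
  rwa [div_eq_mul_one_div q p, mul_comm q]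

/-- The `L^p` boundedness of Calderón–Zygmund convolution operators, with a constant depending only
on `p` and the constants of the kernel. -/
theorem exists_strong_type (r : Fin n → ℕ) [NeZero n] {p : ℝ} (hp : 1 < p) (hB : B ≠ ∞)
    (hH : H ≠ ∞) : ∃ C : ℝ≥0∞, C ≠ ∞ ∧ ∀ (S : BoxScale r) (K f : (Fin n → ℝ) → ℂ),
      IsCZKernel S K B H → Continuous f → Integrable f → (∃ M : ℝ, ∀ x, ‖f x‖ ≤ M) →
      ∫⁻ x, ‖kconv K f x‖ₑ ^ p ≤ C * ∫⁻ x, ‖f x‖ₑ ^ p := by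
  have hlt : ∀ {p : ℝ}, 1 < p → p < 2 → ∃ C : ℝ≥0∞, C ≠ ∞ ∧ ∀ (S : BoxScale r)
      (K f : (Fin n → ℝ) → ℂ), IsCZKernel S K B H → Continuous f → Integrable f →
      (∃ M : ℝ, ∀ x, ‖f x‖ ≤ M) → ∫⁻ x, ‖kconv K f x‖ₑ ^ p ≤ C * ∫⁻ x, ‖f x‖ₑ ^ p := by
    intro p hp hp2
    refine ⟨_, ?_, fun S K f hK hc hf hfb => hK.strong_type_lt_two hf hc hfb hp hp2⟩
    have := weakConst_ne_top r hB hH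
    finiteness
  rcases lt_trichotomy p 2 with h | rfl | h
  · exact hlt hp h
  · refine ⟨B, hB, fun S K f hK hc hf hfb => ?_⟩
    simpa only [ENNReal.rpow_two] using hK.lintegral_sq_le f hf hfb
  · have hpq := (Real.HolderConjugate.conjExponent hp).symm
    have h1 := hpq.lt
    have h2 : p.conjExponent < 2 := by
      rw [Real.conjExponent, div_lt_iff₀ (by linarith)]
      linarith
    obtain ⟨C, hC, hCb⟩ := hlt h1 h2
    refine ⟨C ^ (p / p.conjExponent), ENNReal.rpow_ne_top_of_nonneg (by positivity) hC,
      fun S K f hK hc hf hfb => hK.strong_type_two_lt hf hc hfb hpq h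
        fun g hg hgi hgb => hCb S _ g hK.comp_neg hg hgi hgb⟩

end Duality

section Multiplier

open scoped FourierTransform SchwartzMap Convolution
open ContinuousLinearMap (mul)

variable {V : Type*} [NormedAddCommGroup V] [InnerProductSpace ℝ V] [FiniteDimensional ℝ V]
  [MeasurableSpace V] [BorelSpace V] {K : V → ℂ}

lemma SchwartzMap.exists_norm_le {V : Type*} [NormedAddCommGroup V] [NormedSpace ℝ V]
    (φ : 𝓢(V, ℂ)) : ∃ M : ℝ, ∀ x, ‖φ x‖ ≤ M :=
  ⟨_, fun x => SchwartzMap.norm_le_seminorm ℝ φ x⟩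

lemma integrable_norm_sq_of_bounded {α : Type*} [MeasurableSpace α] {μ : Measure α} {g : α → ℂ}
    (hg : Integrable g μ) (hb : ∃ M : ℝ, ∀ x, ‖g x‖ ≤ M) : Integrable (fun x => ‖g x‖ ^ 2) μ := by
  obtain ⟨M, hM⟩ := hb
  refine (hg.norm.const_mul M).mono' (hg.aestronglyMeasurable.norm.pow 2) (ae_of_all _ fun x => ?_)
  rw [Real.norm_of_nonneg (by positivity), sq]
  exact mul_le_mul_of_nonneg_right (hM x) (norm_nonneg _)

lemma memLp_two_of_bounded {α : Type*} [MeasurableSpace α] {μ : Measure α} {g : α → ℂ}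
    (hg : Integrable g μ) (hb : ∃ M : ℝ, ∀ x, ‖g x‖ ≤ M) : MemLp g 2 μ :=
  (memLp_two_iff_integrable_sq_norm hg.aestronglyMeasurable).2 (integrable_norm_sq_of_bounded hg hb)

lemma eLpNorm_two_sq {α : Type*} [MeasurableSpace α] {μ : Measure α} (g : α → ℂ) :
    eLpNorm g 2 μ ^ 2 = ∫⁻ x, ‖g x‖ₑ ^ 2 ∂μ := by
  have := eLpNorm_nnreal_pow_eq_lintegral (μ := μ) (f := g) (p := 2) (by norm_num)
  simpa using this

lemma bounded_convolution_schwartz (hK : Integrable K) (φ : 𝓢(V, ℂ)) :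
    ∃ M : ℝ, ∀ x, ‖(K ⋆[mul ℂ ℂ] φ) x‖ ≤ M := by
  obtain ⟨M, hM⟩ := φ.exists_norm_le
  refine ⟨∫ y, ‖K y‖ * M, fun x => ?_⟩
  refine norm_integral_le_of_norm_le (hK.norm.mul_const _) (ae_of_all _ fun y => ?_)
  rw [ContinuousLinearMap.mul_apply', norm_mul]
  exact mul_le_mul_of_nonneg_left (hM _) (norm_nonneg _)

lemma continuous_convolution_schwartz (hK : Integrable K) (φ : 𝓢(V, ℂ)) :
    Continuous (K ⋆[mul ℂ ℂ] φ) := by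
  obtain ⟨M, hM⟩ := φ.exists_norm_le
  exact BddAbove.continuous_convolution_right_of_integrable _
    ⟨M, by rintro _ ⟨x, rfl⟩; exact hM x⟩ hK φ.continuous

lemma fourier_convolution_schwartz (hK : Integrable K) (φ : 𝓢(V, ℂ)) :
    𝓕 (K ⋆[mul ℂ ℂ] φ) = fun ξ => 𝓕 K ξ * 𝓕 φ ξ := by
  ext ξ
  rw [Real.fourier_mul_convolution_eq hK φ.integrable, SchwartzMap.fourier_coe]

lemma integrable_fourier_mul_schwartz (hK : Integrable K) (φ : 𝓢(V, ℂ)) :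
    Integrable fun ξ => 𝓕 K ξ * 𝓕 φ ξ := by
  have hc : Continuous (𝓕 K) := VectorFourier.fourierIntegral_continuous Real.continuous_fourierChar
    (L := innerₗ V) continuous_inner hK
  refine (𝓕 φ).integrable.bdd_mul (c := ∫ x, ‖K x‖) hc.aestronglyMeasurable
    (ae_of_all _ fun ξ => ?_)
  exact VectorFourier.norm_fourierIntegral_le_integral_norm _ _ _ _ _

/-- Convolution with an integrable function acts on Schwartz functions as a Fourier multiplier. -/
lemma convolution_schwartz_eq_fourierInv (hK : Integrable K) (φ : 𝓢(V, ℂ)) :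
    𝓕⁻ (fun ξ => 𝓕 K ξ * 𝓕 φ ξ) = K ⋆[mul ℂ ℂ] φ := by
  rw [← fourier_convolution_schwartz hK φ]
  refine (continuous_convolution_schwartz hK φ).fourierInv_fourier_eq
    (hK.integrable_convolution _ φ.integrable) ?_
  rw [fourier_convolution_schwartz hK φ]
  exact integrable_fourier_mul_schwartz hK φ

lemma integral_norm_sq_convolution_schwartz (hK : Integrable K) (φ : 𝓢(V, ℂ)) :
    ∫ ξ, ‖𝓕 K ξ * 𝓕 φ ξ‖ ^ 2 = ∫ x, ‖(K ⋆[mul ℂ ℂ] φ) x‖ ^ 2 := by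
  have h := VectorFourier.integral_sesq_fourierIntegral_eq_neg_flip (innerSL ℂ : ℂ →L⋆[ℂ] ℂ →L[ℂ] ℂ)
    (L := innerₗ V) Real.continuous_fourierChar continuous_inner
    (hK.integrable_convolution (mul ℂ ℂ) φ.integrable) (integrable_fourier_mul_schwartz hK φ)
  have h1 : VectorFourier.fourierIntegral Real.fourierChar volume (innerₗ V)
    (K ⋆[mul ℂ ℂ] φ) = fun ξ => 𝓕 K ξ * 𝓕 φ ξ := fourier_convolution_schwartz hK φ
  have h2 : VectorFourier.fourierIntegral Real.fourierChar volume (-(innerₗ V).flip)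
      (fun ξ => 𝓕 K ξ * 𝓕 φ ξ) = K ⋆[mul ℂ ℂ] φ := by
    rw [← convolution_schwartz_eq_fourierInv hK φ, flip_innerₗ]
    rfl
  rw [h1, h2] at h
  apply Complex.ofRealLI.injective
  simpa [← LinearIsometry.integral_comp_comm, inner_self_eq_norm_sq_to_K] using h

lemma eLpNorm_convolution_schwartz_le (hK : Integrable K) {B : ℝ≥0} (hB : ∀ ξ, ‖𝓕 K ξ‖ ≤ B)
    (φ : 𝓢(V, ℂ)) : eLpNorm (K ⋆[mul ℂ ℂ] φ) 2 ≤ B * eLpNorm φ 2 := by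
  have hψi := hK.integrable_convolution (mul ℂ ℂ) φ.integrable
  have key : eLpNorm (K ⋆[mul ℂ ℂ] φ) 2 ^ 2 ≤ (B * eLpNorm φ 2) ^ 2 := by
    rw [mul_pow, eLpNorm_two_sq, eLpNorm_two_sq]
    have e : ∀ g : V → ℂ, Integrable (fun x => ‖g x‖ ^ 2) →
        ∫⁻ x, ‖g x‖ₑ ^ 2 = ENNReal.ofReal (∫ x, ‖g x‖ ^ 2) := by
      intro g hg
      rw [ofReal_integral_eq_lintegral_ofReal hg (ae_of_all _ fun x => by positivity)]
      simp [ENNReal.ofReal_pow]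
    rw [e _ (integrable_norm_sq_of_bounded hψi (bounded_convolution_schwartz hK φ)),
      e _ (integrable_norm_sq_of_bounded φ.integrable φ.exists_norm_le),
      ← integral_norm_sq_convolution_schwartz hK φ, ← SchwartzMap.integral_norm_sq_fourier,
      ← ENNReal.ofReal_coe_nnreal, ← ENNReal.ofReal_pow (by positivity),
      ← ENNReal.ofReal_mul (by positivity), ← integral_const_mul]
    refine ENNReal.ofReal_le_ofReal (integral_mono_of_nonneg (ae_of_all _ fun x => by positivity)
      ((integrable_norm_sq_of_bounded (𝓕 φ).integrable (𝓕 φ).exists_norm_le).const_mul _)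
      (ae_of_all _ fun ξ => ?_))
    simp only [norm_mul, mul_pow]
    have := hB ξ
    gcongr
  exact (ENNReal.pow_le_pow_left_iff (by norm_num)).1 key

lemma enorm_convolution_le (hK : AEStronglyMeasurable K volume) {g : V → ℂ}
    (hg : AEStronglyMeasurable g volume) (x : V) :
    ‖∫ y, K y * g (x - y)‖ₑ ≤ eLpNorm K 2 * eLpNorm g 2 := by
  have hmp : MeasurePreserving (fun y : V => x - y) := Measure.measurePreserving_sub_left _ x
  calc _ ≤ ∫⁻ y, ‖K y‖ₑ * ‖g (x - y)‖ₑ := by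
        refine (enorm_integral_le_lintegral_enorm _).trans (le_of_eq ?_)
        simp only [enorm_mul]
    _ ≤ (∫⁻ y, ‖K y‖ₑ ^ (2 : ℝ)) ^ (1 / (2 : ℝ)) * (∫⁻ y, ‖g (x - y)‖ₑ ^ (2 : ℝ)) ^ (1 / (2 : ℝ)) :=
        ENNReal.lintegral_mul_le_Lp_mul_Lq _ Real.HolderConjugate.two_two hK.enorm
          (hg.comp_measurePreserving hmp).enorm
    _ = eLpNorm K 2 * eLpNorm (g ∘ fun y => x - y) 2 := by
        simp [eLpNorm_eq_lintegral_rpow_enorm_toReal]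
    _ = _ := by rw [eLpNorm_comp_measurePreserving hg hmp]

lemma exists_seq_schwartz_tendsto {g : V → ℂ} (hg : MemLp g 2) :
    ∃ φ : ℕ → 𝓢(V, ℂ), Tendsto (fun m => eLpNorm (fun x => φ m x - g x) 2) atTop (𝓝 0) := by
  obtain ⟨s, hs, hlim⟩ := mem_closure_iff_seq_limit.1
    (SchwartzMap.denseRange_toLpCLM (E := V) (F := ℂ) (p := 2) (μ := volume)
      ENNReal.ofNat_ne_top (hg.toLp g))
  choose φ hφ using hs
  refine ⟨φ, ?_⟩
  have h1 := (Lp.tendsto_Lp_iff_tendsto_eLpNorm' _ _).1 hlim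
  refine h1.congr fun m => eLpNorm_congr_ae ?_
  have h2 : (s m : V → ℂ) =ᵐ[volume] φ m := by
    rw [← hφ m]
    exact SchwartzMap.coeFn_toLp _ _ _
  filter_upwards [h2, hg.coeFn_toLp] with x hx hx2
  simp [hx, hx2]

lemma tendsto_convolution_schwartz (hK : Integrable K) (hK2 : MemLp K 2) {g : V → ℂ}
    (hg : MemLp g 2) {φ : ℕ → 𝓢(V, ℂ)}
    (hlim2 : Tendsto (fun m => eLpNorm (fun x => φ m x - g x) 2) atTop (𝓝 0)) (x : V) :
    Tendsto (fun m => (K ⋆[mul ℂ ℂ] φ m) x) atTop (𝓝 (∫ y, K y * g (x - y))) := by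
  have h_int : ∀ h : V → ℂ, MemLp h 2 → ∀ x, Integrable fun y => K y * h (x - y) := by
    intro h hh x
    exact hK2.integrable_mul (hh.comp_measurePreserving (Measure.measurePreserving_sub_left _ x))
  rw [tendsto_iff_edist_tendsto_0]
  refine tendsto_of_tendsto_of_tendsto_of_le_of_le tendsto_const_nhds
    (h := fun m => eLpNorm K 2 * eLpNorm (fun x => φ m x - g x) 2) ?_ (fun m => zero_le)
    (fun m => ?_)
  · simpa using ENNReal.Tendsto.const_mul hlim2 (Or.inr hK2.eLpNorm_ne_top)
  · rw [edist_eq_enorm_sub]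
    have : (K ⋆[mul ℂ ℂ] φ m) x - ∫ y, K y * g (x - y) =
        ∫ y, K y * (φ m (x - y) - g (x - y)) := by
      simp only [mul_sub]
      rw [integral_sub (h_int _ ((φ m).memLp 2 _) x) (h_int _ hg x)]
      rfl
    rw [this]
    exact enorm_convolution_le hK.aestronglyMeasurable
      ((φ m).continuous.aestronglyMeasurable.sub hg.aestronglyMeasurable) x

lemma liminf_le_of_le_of_tendsto {a b : ℕ → ℝ≥0∞} {c : ℝ≥0∞} (h : ∀ m, a m ≤ b m)
    (hb : Tendsto b atTop (𝓝 c)) : liminf a atTop ≤ c :=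
  (liminf_le_liminf (Eventually.of_forall h)).trans hb.liminf_eq.le

/-- An integrable and square-integrable kernel with Fourier transform bounded by `B` acts on `L²`
with norm at most `B`. -/
lemma eLpNorm_convolution_le (hK : Integrable K) (hK2 : MemLp K 2) {B : ℝ≥0}
    (hB : ∀ ξ, ‖𝓕 K ξ‖ ≤ B) {g : V → ℂ} (hg : MemLp g 2) :
    eLpNorm (fun x => ∫ y, K y * g (x - y)) 2 ≤ B * eLpNorm g 2 := by
  obtain ⟨φ, hlim2⟩ := exists_seq_schwartz_tendsto hg
  have hpt := tendsto_convolution_schwartz hK hK2 hg hlim2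
  have hF := Lp.eLpNorm_lim_le_liminf_eLpNorm (p := 2) (μ := volume)
    (f := fun m => K ⋆[mul ℂ ℂ] φ m)
    (fun m => (continuous_convolution_schwartz hK (φ m)).aestronglyMeasurable)
    (fun x => ∫ y, K y * g (x - y)) (ae_of_all _ hpt)
  have hub : ∀ m, eLpNorm (K ⋆[mul ℂ ℂ] φ m) 2 ≤
      B * (eLpNorm (fun x => φ m x - g x) 2 + eLpNorm g 2) := by
    intro m
    refine (eLpNorm_convolution_schwartz_le hK hB (φ m)).trans (mul_le_mul_right ?_ _)
    have := eLpNorm_add_le (μ := volume) (p := 2) (f := fun x => φ m x - g x) (g := g)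
      ((φ m).continuous.aestronglyMeasurable.sub hg.aestronglyMeasurable) hg.aestronglyMeasurable
      (by norm_num)
    refine le_trans (le_of_eq ?_) this
    congr 1
    ext x
    simp
  have hlim3 : Tendsto (fun m => (B : ℝ≥0∞) * (eLpNorm (fun x => φ m x - g x) 2 + eLpNorm g 2))
      atTop (𝓝 (B * eLpNorm g 2)) := by
    have := ENNReal.Tendsto.const_mul (a := B) (hlim2.add_const (eLpNorm g 2))
      (Or.inr ENNReal.coe_ne_top)
    simpa using this
  exact hF.trans (liminf_le_of_le_of_tendsto hub hlim3)

end Multiplier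

section Transport

open scoped FourierTransform SchwartzMap Convolution
open ContinuousLinearMap (mul)

variable {n : ℕ} {K : (Fin n → ℝ) → ℂ}

/-- The Fourier transform of a function on `Fin n → ℝ`. -/
def piFourier (K : (Fin n → ℝ) → ℂ) (ξ : Fin n → ℝ) : ℂ :=
  ∫ x, Complex.exp (((-2 * Real.pi * ∑ k, x k * ξ k : ℝ) : ℂ) * Complex.I) * K x

lemma fourier_comp_ofLp (K : (Fin n → ℝ) → ℂ) (ξ : EuclideanSpace ℝ (Fin n)) :
    𝓕 (fun x : EuclideanSpace ℝ (Fin n) => K x.ofLp) ξ = piFourier K ξ.ofLp := by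
  rw [Real.fourier_eq', piFourier,
    ← (PiLp.volume_preserving_ofLp (Fin n)).integral_comp
      (MeasurableEquiv.toLp 2 (Fin n → ℝ)).symm.measurableEmbedding]
  refine integral_congr_ae (ae_of_all _ fun x => ?_)
  simp [PiLp.inner_apply, mul_comm]

lemma kconv_eq_convolution (K f : (Fin n → ℝ) → ℂ) (x : EuclideanSpace ℝ (Fin n)) :
    kconv K f x.ofLp = ∫ y : EuclideanSpace ℝ (Fin n), K y.ofLp * f (x - y).ofLp := by
  rw [kconv_eq_integral_mul, ← (PiLp.volume_preserving_ofLp (Fin n)).integral_comp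
      (MeasurableEquiv.toLp 2 (Fin n → ℝ)).symm.measurableEmbedding]
  rfl

lemma integrable_comp_ofLp (hK : Integrable K) :
    Integrable fun x : EuclideanSpace ℝ (Fin n) => K x.ofLp :=
  ((PiLp.volume_preserving_ofLp (Fin n)).integrable_comp_emb
    (MeasurableEquiv.toLp 2 (Fin n → ℝ)).symm.measurableEmbedding).2 hK

lemma lintegral_comp_ofLp (F : (Fin n → ℝ) → ℝ≥0∞) :
    ∫⁻ x : EuclideanSpace ℝ (Fin n), F x.ofLp = ∫⁻ x, F x :=
  (PiLp.volume_preserving_ofLp (Fin n)).lintegral_comp_emb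
    (MeasurableEquiv.toLp 2 (Fin n → ℝ)).symm.measurableEmbedding F

lemma lintegral_sq_kconv_le (hK : Integrable K) (hKb : ∃ M : ℝ, ∀ x, ‖K x‖ ≤ M) {B : ℝ≥0}
    (hB : ∀ ξ, ‖piFourier K ξ‖ ≤ B) {g : (Fin n → ℝ) → ℂ} (hg : Integrable g)
    (hgb : ∃ M : ℝ, ∀ x, ‖g x‖ ≤ M) :
    ∫⁻ x, ‖kconv K g x‖ₑ ^ 2 ≤ B ^ 2 * ∫⁻ x, ‖g x‖ₑ ^ 2 := by
  have hK' := integrable_comp_ofLp hK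
  have hg' := integrable_comp_ofLp hg
  have h := eLpNorm_convolution_le hK' (memLp_two_of_bounded hK' (hKb.imp fun M h x => h _))
    (B := B) (fun ξ => by rw [fourier_comp_ofLp]; exact hB _)
    (memLp_two_of_bounded hg' (hgb.imp fun M h x => h _))
  have h2 := pow_le_pow_left' h 2
  simp only [← kconv_eq_convolution] at h2
  rwa [mul_pow, eLpNorm_two_sq, eLpNorm_two_sq, lintegral_comp_ofLp fun x => ‖kconv K g x‖ₑ ^ 2,
    lintegral_comp_ofLp fun x => ‖g x‖ₑ ^ 2] at h2

/-- A Schwartz function on `Fin n → ℝ`, seen on the Euclidean space. -/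
def onEuclidean (f : 𝓢(Fin n → ℝ, ℂ)) : 𝓢(EuclideanSpace ℝ (Fin n), ℂ) :=
  SchwartzMap.compCLMOfContinuousLinearEquiv ℂ (EuclideanSpace.equiv (Fin n) ℝ) f

lemma onEuclidean_apply (f : 𝓢(Fin n → ℝ, ℂ)) (x : EuclideanSpace ℝ (Fin n)) :
    onEuclidean f x = f x.ofLp := rfl

lemma kconv_schwartz_eq_fourierInv (hK : Integrable K) (f : 𝓢(Fin n → ℝ, ℂ))
    (x : EuclideanSpace ℝ (Fin n)) :
    kconv K f x.ofLp = 𝓕⁻ (fun ξ => piFourier K ξ.ofLp * 𝓕 (onEuclidean f) ξ) x := by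
  simp only [← fourier_comp_ofLp]
  rw [convolution_schwartz_eq_fourierInv (integrable_comp_ofLp hK), kconv_eq_convolution]
  rfl

open LineDeriv in
lemma fourier_onEuclidean_lineDeriv (f : 𝓢(Fin n → ℝ, ℂ)) (k : Fin n)
    (ξ : EuclideanSpace ℝ (Fin n)) :
    𝓕 (onEuclidean (lineDerivOpCLM ℝ 𝓢(Fin n → ℝ, ℂ) (Pi.single k (1 : ℝ) : Fin n → ℝ) f)) ξ =
      (2 * Real.pi * Complex.I * ξ k) * 𝓕 (onEuclidean f) ξ := by
  have h : onEuclidean (lineDerivOpCLM ℝ 𝓢(Fin n → ℝ, ℂ) (Pi.single k (1 : ℝ) : Fin n → ℝ) f) =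
      ∂_{EuclideanSpace.single k (1 : ℝ)} (onEuclidean f) := by
    have := SchwartzMap.lineDerivOp_compCLMOfContinuousLinearEquiv ℂ
      (EuclideanSpace.single k (1 : ℝ)) (EuclideanSpace.equiv (Fin n) ℝ) f
    rw [onEuclidean, onEuclidean, this]
    congr 1
  have hT : (fun x : EuclideanSpace ℝ (Fin n) =>
      inner ℝ x (EuclideanSpace.single k (1 : ℝ))).HasTemperateGrowth := by
    fun_prop
  rw [h, SchwartzMap.fourier_lineDerivOp_eq, _root_.smul_apply,
    SchwartzMap.smulLeftCLM_apply_apply hT]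
  simp [EuclideanSpace.inner_single_right]
  ring

end Transport

section ExpPow

open scoped FourierTransform SchwartzMap
open Polynomial

/-- The function `x ↦ exp (-c x ^ (2 l))`. -/
def expNegPow (c : ℂ) (l : ℕ) (x : ℝ) : ℂ := Complex.exp (-(c * (x : ℂ) ^ (2 * l)))

lemma norm_expNegPow (c : ℂ) (l : ℕ) (x : ℝ) :
    ‖expNegPow c l x‖ = Real.exp (-(c.re * (x ^ 2) ^ l)) := by
  rw [expNegPow, Complex.norm_exp, ← Complex.ofReal_pow, Complex.neg_re, Complex.re_mul_ofReal,
    pow_mul]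

lemma iteratedDeriv_expNegPow (c : ℂ) (l m : ℕ) :
    ∃ P : ℂ[X], iteratedDeriv m (expNegPow c l) =
      fun x : ℝ => P.eval (x : ℂ) * expNegPow c l x := by
  induction m with
  | zero => exact ⟨1, by ext; simp⟩
  | succ m ih =>
    obtain ⟨P, hP⟩ := ih
    refine ⟨derivative P - P * derivative (C c * X ^ (2 * l)), ?_⟩
    ext x
    rw [iteratedDeriv_succ, hP]
    have h1 : HasDerivAt (fun x : ℝ => P.eval (x : ℂ)) ((derivative P).eval (x : ℂ)) x :=
      (P.hasDerivAt (x : ℂ)).comp_ofReal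
    have h2 : HasDerivAt (expNegPow c l)
        (Complex.exp (-(c * (x : ℂ) ^ (2 * l))) *
          -(derivative (C c * X ^ (2 * l))).eval (x : ℂ)) x := by
      have := ((C c * X ^ (2 * l)).hasDerivAt (x : ℂ)).comp_ofReal.fun_neg.cexp
      have e : expNegPow c l = fun x : ℝ => Complex.exp (-(C c * X ^ (2 * l)).eval (x : ℂ)) := by
        ext; simp [expNegPow]
      rw [e]
      convert this using 2
      simp
    rw [(h1.fun_mul h2).deriv, eval_sub, eval_mul]
    unfold expNegPow
    ring

lemma contDiff_expNegPow (c : ℂ) (l : ℕ) : ContDiff ℝ (⊤ : ℕ∞) (expNegPow c l) := by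
  unfold expNegPow
  have : ContDiff ℝ (⊤ : ℕ∞) (fun x : ℝ => (x : ℂ)) := Complex.ofRealCLM.contDiff
  fun_prop

lemma pow_mul_exp_neg_le {c : ℝ} (hc : 0 < c) {l : ℕ} (hl : 0 < l) (j : ℕ) (x : ℝ) :
    |x| ^ j * Real.exp (-(c * (x ^ 2) ^ l)) ≤ 1 + j.factorial / c ^ j := by
  set y := (x ^ 2) ^ l with hy
  have hy0 : 0 ≤ y := by positivity
  have h1 : |x| ^ j ≤ 1 + y ^ j := by
    rcases le_total |x| 1 with h | h
    · have := pow_le_one₀ (n := j) (abs_nonneg x) h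
      have : 0 ≤ y ^ j := by positivity
      linarith
    · have : |x| ^ j ≤ y ^ j := by
        rw [hy, ← sq_abs, ← pow_mul |x|]
        exact pow_le_pow_left₀ (abs_nonneg x) (le_self_pow₀ h (by positivity)) _
      linarith
  have h2 : y ^ j ≤ j.factorial / c ^ j * Real.exp (c * y) := by
    have := Real.pow_div_factorial_le_exp (c * y) (by positivity) j
    rw [div_le_iff₀ (by positivity), mul_pow] at this
    rw [div_mul_eq_mul_div, le_div_iff₀ (by positivity)]
    linarith
  have h3 : (1 : ℝ) ≤ Real.exp (c * y) := Real.one_le_exp (by positivity)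
  rw [Real.exp_neg, ← div_eq_mul_inv, div_le_iff₀ (Real.exp_pos _)]
  linarith

lemma exists_pow_mul_eval_mul_expNegPow_le {c : ℂ} (hc : 0 < c.re) {l : ℕ} (hl : 0 < l) (k : ℕ)
    (P : ℂ[X]) : ∃ M : ℝ, ∀ x : ℝ, |x| ^ k * ‖P.eval (x : ℂ) * expNegPow c l x‖ ≤ M := by
  refine ⟨∑ i ∈ P.support, ‖P.coeff i‖ * (1 + (k + i).factorial / c.re ^ (k + i)), fun x => ?_⟩
  rw [norm_mul, norm_expNegPow, eval_eq_sum, Polynomial.sum]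
  have h1 : ‖∑ i ∈ P.support, P.coeff i * (x : ℂ) ^ i‖ ≤
      ∑ i ∈ P.support, ‖P.coeff i‖ * |x| ^ i := by
    refine (norm_sum_le _ _).trans (le_of_eq (Finset.sum_congr rfl fun i _ => ?_))
    rw [norm_mul, norm_pow, Complex.norm_real, Real.norm_eq_abs]
  calc _ ≤ |x| ^ k * ((∑ i ∈ P.support, ‖P.coeff i‖ * |x| ^ i) *
        Real.exp (-(c.re * (x ^ 2) ^ l))) := by gcongr
    _ = ∑ i ∈ P.support, ‖P.coeff i‖ * (|x| ^ (k + i) * Real.exp (-(c.re * (x ^ 2) ^ l))) := by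
        rw [Finset.sum_mul, Finset.mul_sum]
        refine Finset.sum_congr rfl fun i _ => ?_
        rw [pow_add]; ring
    _ ≤ _ := Finset.sum_le_sum fun i _ =>
        mul_le_mul_of_nonneg_left (pow_mul_exp_neg_le hc hl _ x) (norm_nonneg _)

/-- The Schwartz function `x ↦ exp (-c x ^ (2 l))`. -/
def expNegPowSchwartz {c : ℂ} (hc : 0 < c.re) {l : ℕ} (hl : 0 < l) : 𝓢(ℝ, ℂ) where
  toFun := expNegPow c l
  smooth' := contDiff_expNegPow c l
  decay' k m := by
    obtain ⟨P, hP⟩ := iteratedDeriv_expNegPow c l m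
    obtain ⟨M, hM⟩ := exists_pow_mul_eval_mul_expNegPow_le hc hl k P
    refine ⟨M, fun x => ?_⟩
    rw [norm_iteratedFDeriv_eq_norm_iteratedDeriv, hP, Real.norm_eq_abs]
    exact hM x

/-- A Schwartz function with Fourier transform `(2πiξ) ^ i exp (-c ξ ^ (2 l))`. -/
lemma exists_schwartz_fourier_eq {c : ℂ} (hc : 0 < c.re) {l : ℕ} (hl : 0 < l) (i : ℕ) :
    ∃ η : 𝓢(ℝ, ℂ), ∀ ξ : ℝ, 𝓕 η ξ = (2 * Real.pi * Complex.I * ξ) ^ i * expNegPow c l ξ := by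
  induction i with
  | zero => exact ⟨𝓕⁻ (expNegPowSchwartz hc hl), fun ξ => by
      rw [FourierTransform.fourier_fourierInv_eq, pow_zero, one_mul]; rfl⟩
  | succ i ih =>
    obtain ⟨η, h⟩ := ih
    refine ⟨LineDeriv.lineDerivOp (1 : ℝ) η, fun ξ => ?_⟩
    have hT : (fun x : ℝ => inner ℝ x (1 : ℝ)).HasTemperateGrowth := by fun_prop
    rw [SchwartzMap.fourier_lineDerivOp_eq, _root_.smul_apply,
      SchwartzMap.smulLeftCLM_apply_apply hT, h]
    simp
    ring

end ExpPow

section Dilation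

open scoped SchwartzMap

/-- The `L¹`-normalised dilation of `η` by `c`. -/
def dil (η : 𝓢(ℝ, ℂ)) (c x : ℝ) : ℂ := (c : ℂ)⁻¹ * η (x / c)

variable {η : 𝓢(ℝ, ℂ)} {c : ℝ}

lemma norm_dil (hc : 0 < c) (x : ℝ) : ‖dil η c x‖ = c⁻¹ * ‖η (x / c)‖ := by
  rw [dil, norm_mul, norm_inv, Complex.norm_of_nonneg hc.le]

lemma continuous_dil (η : 𝓢(ℝ, ℂ)) (c : ℝ) : Continuous (dil η c) := by
  unfold dil
  have := η.continuous
  fun_prop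

lemma integrable_dil (hc : 0 < c) : Integrable (dil η c) :=
  (η.integrable.comp_div hc.ne').const_mul _

lemma integral_norm_dil (hc : 0 < c) : ∫ x, ‖dil η c x‖ = ∫ x, ‖η x‖ := by
  simp only [norm_dil hc]
  rw [integral_const_mul, Measure.integral_comp_div (fun x => ‖η x‖), abs_of_pos hc, smul_eq_mul,
    inv_mul_cancel_left₀ hc.ne']

lemma integrable_abs_mul_norm_schwartz (η : 𝓢(ℝ, ℂ)) : Integrable fun x : ℝ => |x| * ‖η x‖ := by
  simpa using η.integrable_pow_mul volume 1

lemma abs_mul_norm_dil (hc : 0 < c) (x : ℝ) : |x| * ‖dil η c x‖ = |x / c| * ‖η (x / c)‖ := by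
  rw [norm_dil hc, abs_div, abs_of_pos hc]
  ring

lemma integrable_abs_mul_dil (hc : 0 < c) : Integrable fun x => |x| * ‖dil η c x‖ := by
  simp only [abs_mul_norm_dil hc]
  exact (integrable_abs_mul_norm_schwartz η).comp_div hc.ne'

lemma integral_abs_mul_norm_dil (hc : 0 < c) :
    ∫ x, |x| * ‖dil η c x‖ = c * ∫ x, |x| * ‖η x‖ := by
  simp only [abs_mul_norm_dil hc]
  rw [Measure.integral_comp_div (fun x => |x| * ‖η x‖), abs_of_pos hc, smul_eq_mul]

lemma integrable_deriv_schwartz (η : 𝓢(ℝ, ℂ)) : Integrable (deriv η) :=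
  (SchwartzMap.derivCLM ℝ ℂ η).integrable

lemma integral_norm_sub_schwartz_le (η : 𝓢(ℝ, ℂ)) (a : ℝ) :
    ∫ x, ‖η (x - a) - η x‖ ≤ |a| * ∫ x, ‖deriv η x‖ := by
  have hd : Continuous (deriv η) := (SchwartzMap.derivCLM ℝ ℂ η).continuous
  have hrep : ∀ x, ‖η (x - a) - η x‖ₑ ≤
      ∫⁻ s in Ioc (0 : ℝ) 1, ENNReal.ofReal |a| * ‖deriv η (x - s * a)‖ₑ := by
    intro x
    have h1 : ∀ s ∈ uIcc (0 : ℝ) 1, HasDerivAt (fun s => η (x - s * a))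
        ((-a) • deriv η (x - s * a)) s := by
      intro s _
      have h2 : HasDerivAt (fun s : ℝ => x - s * a) (-a) s := by
        simpa using ((hasDerivAt_id s).mul_const a).const_sub x
      exact HasDerivAt.scomp s η.differentiableAt.hasDerivAt h2
    have h3 := intervalIntegral.integral_eq_sub_of_hasDerivAt h1
      (by apply Continuous.intervalIntegrable; fun_prop)
    simp only [one_mul, zero_mul, sub_zero] at h3
    rw [← h3, intervalIntegral.integral_of_le zero_le_one]
    refine (enorm_integral_le_lintegral_enorm _).trans (le_of_eq (lintegral_congr fun s => ?_))
    rw [enorm_smul, enorm_neg, Real.enorm_eq_ofReal_abs]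
  have hi : Integrable fun x => η (x - a) - η x := (η.integrable.comp_sub_right a).sub η.integrable
  rw [← ENNReal.ofReal_le_ofReal_iff (by positivity), ofReal_integral_norm_eq_lintegral_enorm hi,
    ENNReal.ofReal_mul (abs_nonneg a),
    ofReal_integral_norm_eq_lintegral_enorm (integrable_deriv_schwartz η)]
  calc _ ≤ ∫⁻ x, ∫⁻ s in Ioc (0 : ℝ) 1, ENNReal.ofReal |a| * ‖deriv η (x - s * a)‖ₑ :=
        lintegral_mono hrep
    _ = ∫⁻ s in Ioc (0 : ℝ) 1, ∫⁻ x, ENNReal.ofReal |a| * ‖deriv η (x - s * a)‖ₑ := by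
        refine lintegral_lintegral_swap (Measurable.aemeasurable ?_)
        refine Measurable.const_mul (Continuous.measurable ?_).enorm _
        exact hd.comp (by fun_prop)
    _ = ∫⁻ s in Ioc (0 : ℝ) 1, ENNReal.ofReal |a| * ∫⁻ x, ‖deriv η x‖ₑ := by
        refine lintegral_congr fun s => ?_
        rw [lintegral_const_mul' _ _ ENNReal.ofReal_ne_top,
          lintegral_sub_right_eq_self (fun x => ‖deriv η x‖ₑ)]
    _ = _ := by simp

lemma integral_norm_dil_sub_le (hc : 0 < c) (a : ℝ) :
    ∫ x, ‖dil η c (x - a) - dil η c x‖ ≤ |a| / c * ∫ x, ‖deriv η x‖ := by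
  have h : ∀ x, ‖dil η c (x - a) - dil η c x‖ = c⁻¹ * ‖η (x / c - a / c) - η (x / c)‖ := by
    intro x
    rw [dil, dil, ← mul_sub, norm_mul, norm_inv, Complex.norm_of_nonneg hc.le, sub_div]
  simp only [h]
  rw [integral_const_mul, Measure.integral_comp_div (fun x => ‖η (x - a / c) - η x‖),
    abs_of_pos hc, smul_eq_mul, inv_mul_cancel_left₀ hc.ne']
  refine (integral_norm_sub_schwartz_le η (a / c)).trans (le_of_eq ?_)
  rw [abs_div, abs_of_pos hc]

variable {n : ℕ}

lemma lintegral_ofReal_prod {f : Fin n → ℝ → ℝ} (h0 : ∀ i x, 0 ≤ f i x)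
    (hi : ∀ i, Integrable (f i)) :
    ∫⁻ x : Fin n → ℝ, ENNReal.ofReal (∏ i, f i (x i)) = ENNReal.ofReal (∏ i, ∫ y, f i y) := by
  have h : Integrable fun x : Fin n → ℝ => ∏ i, f i (x i) := Integrable.fintype_prod hi
  rw [← ofReal_integral_eq_lintegral_ofReal h
    (ae_of_all _ fun x => Finset.prod_nonneg fun i _ => h0 i _),
    integral_fintype_prod_volume_eq_prod]

lemma lintegral_sum_ofReal_prod {F : Fin n → Fin n → ℝ → ℝ} (h0 : ∀ k i x, 0 ≤ F k i x)
    (hc : ∀ k i, Continuous (F k i)) (hi : ∀ k i, Integrable (F k i)) :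
    ∫⁻ x : Fin n → ℝ, ∑ k, ENNReal.ofReal (∏ i, F k i (x i)) =
      ∑ k, ENNReal.ofReal (∏ i, ∫ y, F k i y) := by
  rw [lintegral_finsetSum _ fun k _ => ?_]
  · exact Finset.sum_congr rfl fun k _ => lintegral_ofReal_prod (h0 k) (hi k)
  · exact ENNReal.measurable_ofReal.comp (Finset.measurable_prod _ fun j _ =>
      (hc k j).measurable.comp (measurable_pi_apply j))

lemma prod_le_mul_prod {A B : Fin n → ℝ} {q : ℝ} {k : Fin n} (hB : ∀ j, 0 ≤ B j)
    (h : ∀ j, j ≠ k → B j ≤ A j) (hk : B k ≤ q * A k) : ∏ j, B j ≤ q * ∏ j, A j := by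
  have : ∏ j, (if j = k then q else 1) * A j = q * ∏ j, A j := by
    rw [Finset.prod_mul_distrib, Finset.prod_ite_eq' Finset.univ k]
    simp
  rw [← this]
  refine Finset.prod_le_prod (fun j _ => hB j) fun j _ => ?_
  split_ifs with hj
  · rwa [hj]
  · rw [one_mul]; exact h j hj

lemma norm_prod_sub_prod_le {ι : Type*} [DecidableEq ι] (s : Finset ι) (a b : ι → ℂ) :
    ‖∏ j ∈ s, a j - ∏ j ∈ s, b j‖ ≤
      ∑ k ∈ s, ∏ j ∈ s, if j = k then ‖a j - b j‖ else ‖a j‖ + ‖b j‖ := by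
  induction s using Finset.induction_on with
  | empty => simp
  | insert i s hi ih =>
    rw [Finset.prod_insert hi, Finset.prod_insert hi, Finset.sum_insert hi, Finset.prod_insert hi,
      if_pos rfl]
    have h1 : ∏ j ∈ s, (if j = i then ‖a j - b j‖ else ‖a j‖ + ‖b j‖) =
        ∏ j ∈ s, (‖a j‖ + ‖b j‖) :=
      Finset.prod_congr rfl fun j hj => if_neg (by rintro rfl; exact hi hj)
    have h2 : ∑ k ∈ s, ∏ j ∈ insert i s, (if j = k then ‖a j - b j‖ else ‖a j‖ + ‖b j‖) =
        (‖a i‖ + ‖b i‖) * ∑ k ∈ s, ∏ j ∈ s, if j = k then ‖a j - b j‖ else ‖a j‖ + ‖b j‖ := by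
      rw [Finset.mul_sum]
      refine Finset.sum_congr rfl fun k hk => ?_
      rw [Finset.prod_insert hi, if_neg (by rintro rfl; exact hi hk)]
    rw [h1, h2]
    have h3 : ‖∏ j ∈ s, a j‖ ≤ ∏ j ∈ s, (‖a j‖ + ‖b j‖) := by
      rw [norm_prod]
      exact Finset.prod_le_prod (fun _ _ => norm_nonneg _) fun j _ => by
        linarith [norm_nonneg (b j)]
    calc _ = ‖(a i - b i) * ∏ j ∈ s, a j + b i * (∏ j ∈ s, a j - ∏ j ∈ s, b j)‖ := by
          congr 1; ring
      _ ≤ ‖a i - b i‖ * ‖∏ j ∈ s, a j‖ + ‖b i‖ * ‖∏ j ∈ s, a j - ∏ j ∈ s, b j‖ := by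
          refine (norm_add_le _ _).trans (le_of_eq ?_)
          rw [norm_mul, norm_mul]
      _ ≤ _ := by
          gcongr
          linarith [norm_nonneg (a i)]

/-- The tensor product of dilations. -/
def prodDil (η : Fin n → 𝓢(ℝ, ℂ)) (σ x : Fin n → ℝ) : ℂ := ∏ j, dil (η j) (σ j) (x j)

/-- A constant dominating the `L¹` norms of `η`, `x η` and the derivative of `η`. -/
def momentConst (η : 𝓢(ℝ, ℂ)) : ℝ :=
  2 * (∫ x, ‖η x‖) + (∫ x, |x| * ‖η x‖) + ∫ x, ‖deriv η x‖

lemma integral_norm_nonneg_schwartz (η : 𝓢(ℝ, ℂ)) : 0 ≤ ∫ x, ‖η x‖ ∧ 0 ≤ ∫ x, |x| * ‖η x‖ ∧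
    0 ≤ ∫ x, ‖deriv η x‖ :=
  ⟨integral_nonneg fun _ => by positivity, integral_nonneg fun _ => by positivity,
    integral_nonneg fun _ => by positivity⟩

lemma momentConst_nonneg (η : 𝓢(ℝ, ℂ)) : 0 ≤ momentConst η := by
  obtain ⟨h1, h2, h3⟩ := integral_norm_nonneg_schwartz η
  unfold momentConst
  linarith

variable {η : Fin n → 𝓢(ℝ, ℂ)} {σ d v : Fin n → ℝ}

lemma continuous_prodDil (η : Fin n → 𝓢(ℝ, ℂ)) (σ : Fin n → ℝ) : Continuous (prodDil η σ) :=
  continuous_finsetProd _ fun j _ => (continuous_dil _ _).comp (continuous_apply j)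

lemma lintegral_tail_prodDil_le (hσ : ∀ j, 0 < σ j) (hd : ∀ j, 0 < d j) :
    ∫⁻ x in {x | ∃ k, d k < |x k|}, ‖prodDil η σ x‖ₑ ≤
      ENNReal.ofReal ((∏ j, momentConst (η j)) * ∑ k, σ k / d k) := by
  let F : Fin n → Fin n → ℝ → ℝ := fun k j y =>
    if j = k then (d j)⁻¹ * (|y| * ‖dil (η j) (σ j) y‖) else ‖dil (η j) (σ j) y‖
  have hF0 : ∀ k j y, 0 ≤ F k j y := fun k j y => by
    have := hd j
    simp only [F]
    split_ifs <;> positivity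
  have hFi : ∀ k j, Integrable (F k j) := fun k j => by
    simp only [F]
    split_ifs
    · exact (integrable_abs_mul_dil (hσ j)).const_mul _
    · exact (integrable_dil (hσ j)).norm
  have hmeas : MeasurableSet {x : Fin n → ℝ | ∃ k, d k < |x k|} := by
    rw [show {x : Fin n → ℝ | ∃ k, d k < |x k|} = ⋃ k, {x | d k < |x k|} by ext; simp]
    exact MeasurableSet.iUnion fun k => measurableSet_lt measurable_const (by fun_prop)
  have hFc : ∀ k j, Continuous (F k j) := by
    intro k j
    have := continuous_dil (η j) (σ j)
    simp only [F]
    split_ifs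
    · fun_prop
    · fun_prop
  calc _ ≤ ∫⁻ x : Fin n → ℝ in {x | ∃ k, d k < |x k|}, ∑ k, ENNReal.ofReal (∏ j, F k j (x j)) := by
        refine setLIntegral_mono' hmeas ?_
        rintro x ⟨k, hk⟩
        refine le_trans ?_ (Finset.single_le_sum (f := fun k => ENNReal.ofReal (∏ j, F k j (x j)))
          (fun _ _ => zero_le) (Finset.mem_univ k))
        rw [← ofReal_norm, prodDil, norm_prod]
        refine ENNReal.ofReal_le_ofReal (Finset.prod_le_prod (fun _ _ => norm_nonneg _)
          fun j _ => ?_)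
        simp only [F]
        split_ifs with hj
        · subst hj
          rw [← mul_assoc]
          refine le_mul_of_one_le_left (norm_nonneg _) ?_
          rw [inv_mul_eq_div, one_le_div (hd _)]
          exact hk.le
        · exact le_rfl
    _ ≤ ∫⁻ x : Fin n → ℝ, ∑ k, ENNReal.ofReal (∏ j, F k j (x j)) := setLIntegral_le_lintegral _ _
    _ = ∑ k, ENNReal.ofReal (∏ j, ∫ y, F k j y) :=
        lintegral_sum_ofReal_prod hF0 hFc hFi
    _ ≤ ∑ k, ENNReal.ofReal (σ k / d k * ∏ j, momentConst (η j)) := by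
        refine Finset.sum_le_sum fun k _ => ENNReal.ofReal_le_ofReal (prod_le_mul_prod (k := k)
          (fun j => integral_nonneg (hF0 k j)) (fun j hj => ?_) ?_)
        · obtain ⟨h1, h2, h3⟩ := integral_norm_nonneg_schwartz (η j)
          simp only [F, if_neg hj, integral_norm_dil (hσ j), momentConst]
          linarith
        · obtain ⟨h1, h2, h3⟩ := integral_norm_nonneg_schwartz (η k)
          simp only [F, if_true, integral_const_mul, integral_abs_mul_norm_dil (hσ k)]
          rw [← mul_assoc, inv_mul_eq_div]
          refine mul_le_mul_of_nonneg_left ?_ (div_nonneg (hσ k).le (hd k).le)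
          unfold momentConst
          linarith
    _ = _ := by
        rw [← ENNReal.ofReal_sum_of_nonneg, ← Finset.sum_mul, mul_comm]
        exact fun k _ => mul_nonneg (div_nonneg (hσ k).le (hd k).le)
          (Finset.prod_nonneg fun j _ => momentConst_nonneg _)

lemma lintegral_prodDil_sub_le (hσ : ∀ j, 0 < σ j) (hv : ∀ k, |v k| ≤ d k) :
    ∫⁻ x, ‖prodDil η σ (x - v) - prodDil η σ x‖ₑ ≤
      ENNReal.ofReal ((∏ j, momentConst (η j)) * ∑ k, d k / σ k) := by
  let F : Fin n → Fin n → ℝ → ℝ := fun k j y =>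
    if j = k then ‖dil (η j) (σ j) (y - v j) - dil (η j) (σ j) y‖
    else ‖dil (η j) (σ j) (y - v j)‖ + ‖dil (η j) (σ j) y‖
  have hF0 : ∀ k j y, 0 ≤ F k j y := fun k j y => by
    simp only [F]
    split_ifs <;> positivity
  have hFi : ∀ k j, Integrable (F k j) := fun k j => by
    have h := integrable_dil (η := η j) (hσ j)
    simp only [F]
    split_ifs
    · exact ((h.comp_sub_right (v j)).sub h).norm
    · exact (h.comp_sub_right (v j)).norm.add h.norm
  have hFc : ∀ k j, Continuous (F k j) := by
    intro k j
    have := continuous_dil (η j) (σ j)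
    simp only [F]
    split_ifs
    · fun_prop
    · fun_prop
  have hd : ∀ k, 0 ≤ d k := fun k => (abs_nonneg _).trans (hv k)
  calc _ ≤ ∫⁻ x : Fin n → ℝ, ∑ k, ENNReal.ofReal (∏ j, F k j (x j)) := by
        refine lintegral_mono fun x => ?_
        rw [← ENNReal.ofReal_sum_of_nonneg fun k _ => Finset.prod_nonneg fun j _ => hF0 k j _,
          ← ofReal_norm]
        exact ENNReal.ofReal_le_ofReal (norm_prod_sub_prod_le Finset.univ
          (fun j => dil (η j) (σ j) (x j - v j)) (fun j => dil (η j) (σ j) (x j)))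
    _ = ∑ k, ENNReal.ofReal (∏ j, ∫ y, F k j y) :=
        lintegral_sum_ofReal_prod hF0 hFc hFi
    _ ≤ ∑ k, ENNReal.ofReal (d k / σ k * ∏ j, momentConst (η j)) := by
        refine Finset.sum_le_sum fun k _ => ENNReal.ofReal_le_ofReal (prod_le_mul_prod (k := k)
          (fun j => integral_nonneg (hF0 k j)) (fun j hj => ?_) ?_)
        · obtain ⟨h1, h2, h3⟩ := integral_norm_nonneg_schwartz (η j)
          have h := integrable_dil (η := η j) (hσ j)
          simp only [F, if_neg hj]
          rw [integral_add (h.comp_sub_right (v j)).norm h.norm,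
            integral_sub_right_eq_self (fun y => ‖dil (η j) (σ j) y‖), integral_norm_dil (hσ j)]
          unfold momentConst
          linarith
        · obtain ⟨h1, h2, h3⟩ := integral_norm_nonneg_schwartz (η k)
          simp only [F, if_true]
          refine (integral_norm_dil_sub_le (hσ k) (v k)).trans ?_
          refine mul_le_mul ?_ ?_ h3 (div_nonneg (hd k) (hσ k).le)
          · exact div_le_div_of_nonneg_right (hv k) (hσ k).le
          · unfold momentConst
            linarith
    _ = _ := by
        rw [← ENNReal.ofReal_sum_of_nonneg, ← Finset.sum_mul, mul_comm]
        exact fun k _ => mul_nonneg (div_nonneg (hd k) (hσ k).le)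
          (Finset.prod_nonneg fun j _ => momentConst_nonneg _)

lemma lintegral_tail_prodDil_sub_le (hσ : ∀ j, 0 < σ j) (hd : ∀ j, 0 < d j)
    (hv : ∀ k, |v k| ≤ d k) :
    ∫⁻ x in {x | ∃ k, 2 * d k < |x k|}, ‖prodDil η σ (x - v) - prodDil η σ x‖ₑ ≤
      2 * ENNReal.ofReal ((∏ j, momentConst (η j)) * ∑ k, σ k / d k) := by
  have hc := continuous_prodDil η σ
  have hsub : {x : Fin n → ℝ | ∃ k, 2 * d k < |x k|} ⊆
      (fun x => x - v) ⁻¹' {x | ∃ k, d k < |x k|} := by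
    rintro x ⟨k, hk⟩
    refine ⟨k, ?_⟩
    have h1 := abs_sub_abs_le_abs_sub (x k) (v k)
    have h2 := hv k
    change d k < |x k - v k|
    linarith
  have hsub2 : {x : Fin n → ℝ | ∃ k, 2 * d k < |x k|} ⊆ {x | ∃ k, d k < |x k|} := by
    rintro x ⟨k, hk⟩
    exact ⟨k, by linarith [hd k]⟩
  calc _ ≤ ∫⁻ x in {x | ∃ k, 2 * d k < |x k|}, (‖prodDil η σ (x - v)‖ₑ + ‖prodDil η σ x‖ₑ) :=
        lintegral_mono fun x => enorm_sub_le
    _ = (∫⁻ x in {x | ∃ k, 2 * d k < |x k|}, ‖prodDil η σ (x - v)‖ₑ) +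
        ∫⁻ x in {x | ∃ k, 2 * d k < |x k|}, ‖prodDil η σ x‖ₑ :=
        lintegral_add_right _ hc.measurable.enorm
    _ ≤ (∫⁻ x in (fun x => x - v) ⁻¹' {x | ∃ k, d k < |x k|}, ‖prodDil η σ (x - v)‖ₑ) +
        ∫⁻ x in {x | ∃ k, d k < |x k|}, ‖prodDil η σ x‖ₑ :=
        add_le_add (lintegral_mono_set hsub) (lintegral_mono_set hsub2)
    _ = 2 * ∫⁻ x in {x | ∃ k, d k < |x k|}, ‖prodDil η σ x‖ₑ := by
        rw [(measurePreserving_sub_right volume v).setLIntegral_comp_preimage_emb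
          (MeasurableEquiv.subRight v).measurableEmbedding (fun x => ‖prodDil η σ x‖ₑ), two_mul]
    _ ≤ _ := mul_le_mul_right (lintegral_tail_prodDil_le hσ hd) _

end Dilation

section ScaleKernel

open scoped SchwartzMap

variable {n : ℕ}

/-- The anisotropic scales `(tⱼ s) ^ aⱼ`. -/
def scaleAt (t a : Fin n → ℝ) (s : ℝ) (j : Fin n) : ℝ := (t j * s) ^ a j

/-- A superposition over the scales `s > ε` of tensor products of dilations. -/
def scaleKernel (w : ℝ → ℂ) (η : Fin n → 𝓢(ℝ, ℂ)) (t a : Fin n → ℝ) (ε : ℝ) (x : Fin n → ℝ) : ℂ :=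
  ∫ s in Ioi ε, w s * prodDil η (scaleAt t a s) x

variable {t a : Fin n → ℝ} {w : ℝ → ℂ} {η : Fin n → 𝓢(ℝ, ℂ)} {s ρ ε A : ℝ}

lemma scaleAt_pos (ht : ∀ j, 0 < t j) (hs : 0 < s) (j : Fin n) : 0 < scaleAt t a s j :=
  Real.rpow_pos_of_pos (mul_pos (ht j) hs) _

lemma scaleAt_div (ht : ∀ j, 0 < t j) (hs : 0 < s) (hρ : 0 < ρ) (j : Fin n) :
    scaleAt t a s j / scaleAt t a ρ j = (s / ρ) ^ a j := by
  rw [scaleAt, scaleAt, ← Real.div_rpow (mul_pos (ht j) hs).le (mul_pos (ht j) hρ).le,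
    mul_div_mul_left _ _ (ht j).ne']

lemma scaleAt_mono (ht : ∀ j, 0 < t j) (ha : ∀ j, 0 < a j) (hε : 0 < ε) (h : ε ≤ s) (j : Fin n) :
    scaleAt t a ε j ≤ scaleAt t a s j :=
  Real.rpow_le_rpow (mul_pos (ht j) hε).le (mul_le_mul_of_nonneg_left h (ht j).le) (ha j).le

lemma measurable_scaleAt (t a : Fin n → ℝ) (j : Fin n) : Measurable fun s => scaleAt t a s j := by
  unfold scaleAt
  fun_prop

lemma measurable_prodDil_scaleAt (η : Fin n → 𝓢(ℝ, ℂ)) (t a : Fin n → ℝ) :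
    Measurable fun q : (Fin n → ℝ) × ℝ => prodDil η (scaleAt t a q.2) q.1 := by
  unfold prodDil dil
  refine Finset.measurable_fun_prod _ fun j _ => ?_
  have h : Measurable fun q : (Fin n → ℝ) × ℝ => scaleAt t a q.2 j :=
    (measurable_scaleAt t a j).comp measurable_snd
  refine (Complex.measurable_ofReal.comp h).inv.mul ((η j).continuous.measurable.comp ?_)
  exact ((measurable_pi_apply j).comp measurable_fst).div h

lemma exists_norm_prodDil_le (η : Fin n → 𝓢(ℝ, ℂ)) (ht : ∀ j, 0 < t j) (ha : ∀ j, 0 < a j)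
    (hε : 0 < ε) : ∃ M, ∀ s, ε ≤ s → ∀ x, ‖prodDil η (scaleAt t a s) x‖ ≤ M := by
  choose M hM using fun j => (η j).exists_norm_le
  refine ⟨∏ j, (scaleAt t a ε j)⁻¹ * M j, fun s hs x => ?_⟩
  rw [prodDil, norm_prod]
  refine Finset.prod_le_prod (fun _ _ => norm_nonneg _) fun j _ => ?_
  rw [norm_dil (scaleAt_pos ht (hε.trans_le hs) j)]
  exact mul_le_mul (inv_anti₀ (scaleAt_pos ht hε j) (scaleAt_mono ht ha hε hs j)) (hM j _)
    (norm_nonneg _) (inv_nonneg.2 (scaleAt_pos ht hε j).le)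

lemma lintegral_enorm_prodDil {σ : Fin n → ℝ} (hσ : ∀ j, 0 < σ j) :
    ∫⁻ x, ‖prodDil η σ x‖ₑ = ENNReal.ofReal (∏ j, ∫ y, ‖η j y‖) := by
  have h : ∀ x : Fin n → ℝ, ‖prodDil η σ x‖ₑ =
      ENNReal.ofReal (∏ j, ‖dil (η j) (σ j) (x j)‖) := fun x => by
    rw [← ofReal_norm, prodDil, norm_prod]
  simp only [h]
  rw [lintegral_ofReal_prod (f := fun j y => ‖dil (η j) (σ j) y‖) (fun _ _ => norm_nonneg _)
    fun j => (integrable_dil (hσ j)).norm]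
  simp only [integral_norm_dil (hσ _)]

lemma integrable_prod_scale (ht : ∀ j, 0 < t j) (hε : 0 < ε) (hw : Measurable w)
    (hwi : IntegrableOn w (Ioi ε)) :
    Integrable (fun q : (Fin n → ℝ) × ℝ => w q.2 * prodDil η (scaleAt t a q.2) q.1)
      (volume.prod (volume.restrict (Ioi ε))) := by
  have hm : Measurable fun q : (Fin n → ℝ) × ℝ => w q.2 * prodDil η (scaleAt t a q.2) q.1 :=
    (hw.comp measurable_snd).mul (measurable_prodDil_scaleAt η t a)
  refine ⟨hm.aestronglyMeasurable, ?_⟩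
  rw [HasFiniteIntegral, lintegral_prod_symm _ hm.enorm.aemeasurable]
  have h : ∀ s ∈ Ioi ε, ∫⁻ x, ‖w s * prodDil η (scaleAt t a s) x‖ₑ =
      ‖w s‖ₑ * ENNReal.ofReal (∏ j, ∫ y, ‖η j y‖) := by
    intro s hs
    simp only [enorm_mul]
    rw [lintegral_const_mul' _ _ enorm_ne_top,
      lintegral_enorm_prodDil (scaleAt_pos ht (hε.trans hs))]
  rw [setLIntegral_congr_fun measurableSet_Ioi h,
    lintegral_mul_const' _ _ ENNReal.ofReal_ne_top]
  exact ENNReal.mul_lt_top hwi.2 ENNReal.ofReal_lt_top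

lemma integrableOn_scale (ht : ∀ j, 0 < t j) (ha : ∀ j, 0 < a j) (hε : 0 < ε)
    (hwi : IntegrableOn w (Ioi ε)) (x : Fin n → ℝ) :
    IntegrableOn (fun s => w s * prodDil η (scaleAt t a s) x) (Ioi ε) := by
  obtain ⟨M, hM⟩ := exists_norm_prodDil_le η ht ha hε
  refine Integrable.mul_bdd (c := M) hwi ?_ ?_
  · exact ((measurable_prodDil_scaleAt η t a).comp
      (measurable_const.prodMk measurable_id)).aestronglyMeasurable
  · exact (ae_restrict_iff' measurableSet_Ioi).2 (ae_of_all _ fun s hs => hM s (le_of_lt hs) x)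

lemma measurable_scaleKernel (hw : Measurable w) : Measurable (scaleKernel w η t a ε) := by
  have hm : Measurable fun q : (Fin n → ℝ) × ℝ => w q.2 * prodDil η (scaleAt t a q.2) q.1 :=
    (hw.comp measurable_snd).mul (measurable_prodDil_scaleAt η t a)
  exact (hm.stronglyMeasurable.integral_prod_right' (ν := volume.restrict (Ioi ε))).measurable

lemma integrable_scaleKernel (ht : ∀ j, 0 < t j) (hε : 0 < ε) (hw : Measurable w)
    (hwi : IntegrableOn w (Ioi ε)) : Integrable (scaleKernel w η t a ε) :=
  (integrable_prod_scale ht hε hw hwi).integral_prod_left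

lemma exists_norm_scaleKernel_le (ht : ∀ j, 0 < t j) (ha : ∀ j, 0 < a j) (hε : 0 < ε)
    (hwi : IntegrableOn w (Ioi ε)) : ∃ M : ℝ, ∀ x, ‖scaleKernel w η t a ε x‖ ≤ M := by
  obtain ⟨M, hM⟩ := exists_norm_prodDil_le η ht ha hε
  refine ⟨(∫ s in Ioi ε, ‖w s‖) * M, fun x => ?_⟩
  rw [← integral_mul_const]
  refine (norm_integral_le_integral_norm _).trans ?_
  refine setIntegral_mono_on (integrableOn_scale ht ha hε hwi x).norm (hwi.norm.mul_const _)
    measurableSet_Ioi fun s hs => ?_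
  rw [norm_mul]
  exact mul_le_mul_of_nonneg_left (hM s (le_of_lt hs) x) (norm_nonneg _)

lemma setLIntegral_inv_mul_rpow_Ioc {b : ℝ} (hb : 0 < b) (hρ : 0 < ρ) :
    ∫⁻ s in Ioc 0 ρ, ENNReal.ofReal (s⁻¹ * (s / ρ) ^ b) = ENNReal.ofReal b⁻¹ := by
  have h : ∀ s ∈ Ioc 0 ρ, s⁻¹ * (s / ρ) ^ b = (ρ ^ b)⁻¹ * s ^ (b - 1) := by
    intro s hs
    rw [Real.div_rpow hs.1.le hρ.le, Real.rpow_sub_one hs.1.ne']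
    field_simp
  have hi : IntegrableOn (fun s : ℝ => (ρ ^ b)⁻¹ * s ^ (b - 1)) (Ioc 0 ρ) := by
    refine Integrable.const_mul ?_ _
    exact (intervalIntegrable_iff_integrableOn_Ioc_of_le hρ.le).1
      (intervalIntegral.intervalIntegrable_rpow' (by linarith))
  rw [setLIntegral_congr_fun measurableSet_Ioc (fun s hs => by rw [h s hs]),
    ← ofReal_integral_eq_lintegral_ofReal hi, integral_const_mul,
    ← intervalIntegral.integral_of_le hρ.le, integral_rpow (Or.inl (by linarith))]
  · congr 1
    have := Real.rpow_pos_of_pos hρ b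
    rw [sub_add_cancel, Real.zero_rpow hb.ne']
    field_simp
    simp
  · exact (ae_restrict_iff' measurableSet_Ioc).2 (ae_of_all _ fun s hs => by
      have := hs.1
      positivity)

lemma setLIntegral_inv_mul_rpow_Ioi {b : ℝ} (hb : 0 < b) (hρ : 0 < ρ) :
    ∫⁻ s in Ioi ρ, ENNReal.ofReal (s⁻¹ * (ρ / s) ^ b) = ENNReal.ofReal b⁻¹ := by
  have h : ∀ s ∈ Ioi ρ, s⁻¹ * (ρ / s) ^ b = ρ ^ b * s ^ (-b - 1) := by
    intro s hs
    have hs0 : 0 < s := hρ.trans hs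
    rw [Real.div_rpow hρ.le hs0.le, Real.rpow_sub_one hs0.ne', Real.rpow_neg hs0.le]
    field_simp
  have hi : IntegrableOn (fun s : ℝ => ρ ^ b * s ^ (-b - 1)) (Ioi ρ) :=
    (integrableOn_Ioi_rpow_of_lt (by linarith) hρ).const_mul _
  rw [setLIntegral_congr_fun measurableSet_Ioi (fun s hs => by rw [h s hs]),
    ← ofReal_integral_eq_lintegral_ofReal hi, integral_const_mul,
    integral_Ioi_rpow_of_lt (by linarith) hρ]
  · congr 1
    have := Real.rpow_pos_of_pos hρ b
    rw [sub_add_cancel, Real.rpow_neg hρ.le]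
    field_simp
  · exact (ae_restrict_iff' measurableSet_Ioi).2 (ae_of_all _ fun s hs => by
      have : 0 < s := hρ.trans hs
      positivity)

/-- The Hörmander constant of a scale kernel. -/
def hormanderConst (η : Fin n → 𝓢(ℝ, ℂ)) (a : Fin n → ℝ) (A : ℝ) : ℝ≥0∞ :=
  2 * (ENNReal.ofReal (2 * (A * ∏ j, momentConst (η j))) * ∑ k, ENNReal.ofReal (a k)⁻¹)

lemma setLIntegral_mul_sum_le {c : ℝ} {I : Set ℝ} (hI : MeasurableSet I) {F : ℝ → ℝ≥0∞}
    {g : Fin n → ℝ → ℝ} (hg : ∀ k, Measurable (g k)) (hg0 : ∀ k, ∀ s ∈ I, 0 ≤ g k s)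
    (hgI : ∀ k, ∫⁻ s in I, ENNReal.ofReal (g k s) = ENNReal.ofReal (a k)⁻¹)
    (hF : ∀ s ∈ I, F s ≤ ENNReal.ofReal (c * ∑ k, g k s)) (hc : 0 ≤ c) :
    ∫⁻ s in I, F s ≤ ENNReal.ofReal c * ∑ k, ENNReal.ofReal (a k)⁻¹ := by
  calc _ ≤ ∫⁻ s in I, ENNReal.ofReal c * ∑ k, ENNReal.ofReal (g k s) := by
        refine setLIntegral_mono' hI fun s hs => (hF s hs).trans (le_of_eq ?_)
        rw [ENNReal.ofReal_mul hc, ENNReal.ofReal_sum_of_nonneg fun k _ => hg0 k s hs]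
    _ = _ := by
        rw [lintegral_const_mul' _ _ ENNReal.ofReal_ne_top,
          lintegral_finsetSum _ fun k _ => (hg k).ennreal_ofReal]
        simp only [hgI]

lemma enorm_scaleKernel_sub_le (ht : ∀ j, 0 < t j) (ha : ∀ j, 0 < a j) (hε : 0 < ε)
    (hwi : IntegrableOn w (Ioi ε)) (x v : Fin n → ℝ) :
    ‖scaleKernel w η t a ε (x - v) - scaleKernel w η t a ε x‖ₑ ≤
      ∫⁻ s in Ioi ε, ‖w s‖ₑ *
        ‖prodDil η (scaleAt t a s) (x - v) - prodDil η (scaleAt t a s) x‖ₑ := by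
  unfold scaleKernel
  rw [← integral_sub (integrableOn_scale ht ha hε hwi _) (integrableOn_scale ht ha hε hwi _)]
  refine (enorm_integral_le_lintegral_enorm _).trans (le_of_eq (lintegral_congr fun s => ?_))
  rw [← mul_sub, enorm_mul]

lemma lintegral_scaleKernel_sub_le (ht : ∀ j, 0 < t j) (ha : ∀ j, 0 < a j) (hε : 0 < ε)
    (hw : Measurable w) (hwi : IntegrableOn w (Ioi ε)) (hA : 0 ≤ A)
    (hwA : ∀ s, 0 < s → ‖w s‖ ≤ A / s) (hρ : 0 < ρ) {v : Fin n → ℝ}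
    (hv : ∀ k, |v k| ≤ scaleAt t a ρ k) :
    ∫⁻ x in {x | ∃ k, 2 * scaleAt t a ρ k < |x k|},
      ‖scaleKernel w η t a ε (x - v) - scaleKernel w η t a ε x‖ₑ ≤ hormanderConst η a A := by
  set T : Set (Fin n → ℝ) := {x | ∃ k, 2 * scaleAt t a ρ k < |x k|} with hT
  let D : ℝ → (Fin n → ℝ) → ℝ≥0∞ := fun s x =>
    ‖prodDil η (scaleAt t a s) (x - v) - prodDil η (scaleAt t a s) x‖ₑ
  have hDm : Measurable fun q : (Fin n → ℝ) × ℝ => D q.2 q.1 := by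
    refine Measurable.enorm (Measurable.sub ?_ (measurable_prodDil_scaleAt η t a))
    exact (measurable_prodDil_scaleAt η t a).comp
      ((measurable_fst.sub_const v).prodMk measurable_snd)
  have hM : 0 ≤ ∏ j, momentConst (η j) := Finset.prod_nonneg fun j _ => momentConst_nonneg _
  have hσ := fun (s : ℝ) (hs : 0 < s) => scaleAt_pos (a := a) ht hs
  have hwe : ∀ s, 0 < s → ‖w s‖ₑ ≤ ENNReal.ofReal (A / s) := fun s hs => by
    rw [← ofReal_norm]
    exact ENNReal.ofReal_le_ofReal (hwA s hs)
  have hlow : ∀ s ∈ Ioc 0 ρ, ‖w s‖ₑ * ∫⁻ x in T, D s x ≤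
      ENNReal.ofReal (2 * (A * ∏ j, momentConst (η j)) * ∑ k, s⁻¹ * (s / ρ) ^ a k) := by
    intro s hs
    calc _ ≤ ENNReal.ofReal (A / s) * (2 * ENNReal.ofReal ((∏ j, momentConst (η j)) *
          ∑ k, scaleAt t a s k / scaleAt t a ρ k)) :=
          mul_le_mul' (hwe s hs.1) (lintegral_tail_prodDil_sub_le (hσ s hs.1) (hσ ρ hρ) hv)
      _ = _ := by
          simp only [scaleAt_div ht hs.1 hρ]
          rw [← ENNReal.ofReal_ofNat 2, ← ENNReal.ofReal_mul (by norm_num),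
            ← ENNReal.ofReal_mul (div_nonneg hA hs.1.le), ← Finset.mul_sum]
          congr 1
          ring
  have hhigh : ∀ s ∈ Ioi ρ, ‖w s‖ₑ * ∫⁻ x in T, D s x ≤
      ENNReal.ofReal (2 * (A * ∏ j, momentConst (η j)) * ∑ k, s⁻¹ * (ρ / s) ^ a k) := by
    intro s hs
    have hs0 : 0 < s := hρ.trans hs
    calc _ ≤ ENNReal.ofReal (A / s) * ENNReal.ofReal ((∏ j, momentConst (η j)) *
          ∑ k, scaleAt t a ρ k / scaleAt t a s k) :=
          mul_le_mul' (hwe s hs0) ((setLIntegral_le_lintegral _ _).trans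
            (lintegral_prodDil_sub_le (hσ s hs0) hv))
      _ ≤ _ := by
          simp only [scaleAt_div ht hρ hs0]
          rw [← ENNReal.ofReal_mul (div_nonneg hA hs0.le), ← Finset.mul_sum]
          refine ENNReal.ofReal_le_ofReal ?_
          have hS : 0 ≤ ∑ k, (ρ / s) ^ a k :=
            Finset.sum_nonneg fun k _ => Real.rpow_nonneg (div_nonneg hρ.le hs0.le) _
          have h1 : 0 ≤ A / s * ((∏ j, momentConst (η j)) * ∑ k, (ρ / s) ^ a k) :=
            mul_nonneg (div_nonneg hA hs0.le) (mul_nonneg hM hS)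
          rw [show 2 * (A * ∏ j, momentConst (η j)) * (s⁻¹ * ∑ k, (ρ / s) ^ a k) =
            2 * (A / s * ((∏ j, momentConst (η j)) * ∑ k, (ρ / s) ^ a k)) by ring]
          linarith
  have hc : 0 ≤ 2 * (A * ∏ j, momentConst (η j)) := by positivity
  calc _ ≤ ∫⁻ x in T, ∫⁻ s in Ioi ε, ‖w s‖ₑ * D s x :=
        lintegral_mono fun x => enorm_scaleKernel_sub_le ht ha hε hwi x v
    _ = ∫⁻ s in Ioi ε, ∫⁻ x in T, ‖w s‖ₑ * D s x := by
        refine lintegral_lintegral_swap (Measurable.aemeasurable ?_)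
        exact (hw.enorm.comp measurable_snd).mul hDm
    _ = ∫⁻ s in Ioi ε, ‖w s‖ₑ * ∫⁻ x in T, D s x :=
        lintegral_congr fun s => lintegral_const_mul' _ _ enorm_ne_top
    _ ≤ ∫⁻ s in Ioc 0 ρ ∪ Ioi ρ, ‖w s‖ₑ * ∫⁻ x in T, D s x := by
        refine lintegral_mono_set fun s hs => ?_
        rw [Ioc_union_Ioi_eq_Ioi hρ.le]
        exact hε.trans hs
    _ ≤ (∫⁻ s in Ioc 0 ρ, ‖w s‖ₑ * ∫⁻ x in T, D s x) +
        ∫⁻ s in Ioi ρ, ‖w s‖ₑ * ∫⁻ x in T, D s x := lintegral_union_le _ _ _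
    _ ≤ hormanderConst η a A := by
        rw [hormanderConst, two_mul]
        refine add_le_add ?_ ?_
        · refine setLIntegral_mul_sum_le measurableSet_Ioc (fun k => ?_) (fun k s hs => ?_)
            (fun k => setLIntegral_inv_mul_rpow_Ioc (ha k) hρ) hlow hc
          · fun_prop
          · have := hs.1
            positivity
        · refine setLIntegral_mul_sum_le measurableSet_Ioi (fun k => ?_) (fun k s hs => ?_)
            (fun k => setLIntegral_inv_mul_rpow_Ioi (ha k) hρ) hhigh hc
          · fun_prop
          · have : 0 < s := hρ.trans hs
            positivity

end ScaleKernel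

section ScaleKernelFourier

open scoped SchwartzMap FourierTransform

variable {n : ℕ} {t a : Fin n → ℝ} {w : ℝ → ℂ} {η : Fin n → 𝓢(ℝ, ℂ)} {ε A : ℝ}

lemma integral_exp_mul_dil (η : 𝓢(ℝ, ℂ)) {c : ℝ} (hc : 0 < c) (ξ : ℝ) :
    ∫ x, Complex.exp (((-2 * Real.pi * (x * ξ) : ℝ) : ℂ) * Complex.I) * dil η c x =
      𝓕 η (c * ξ) := by
  have h : ∀ x : ℝ, Complex.exp (((-2 * Real.pi * (x * ξ) : ℝ) : ℂ) * Complex.I) * dil η c x =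
      (c : ℂ)⁻¹ * (fun y : ℝ => Complex.exp (((-2 * Real.pi * y * (c * ξ) : ℝ) : ℂ) * Complex.I) *
        η y) (x / c) := by
    intro x
    have : -2 * Real.pi * (x / c) * (c * ξ) = -2 * Real.pi * (x * ξ) := by field_simp
    simp only [this, dil]
    ring
  simp only [h]
  rw [integral_const_mul, Measure.integral_comp_div (fun y : ℝ =>
    Complex.exp (((-2 * Real.pi * y * (c * ξ) : ℝ) : ℂ) * Complex.I) * η y),
    abs_of_pos hc, Complex.real_smul,
    inv_mul_cancel_left₀ (by exact_mod_cast hc.ne'), SchwartzMap.fourier_coe,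
    Real.fourier_real_eq_integral_exp_smul]
  simp only [smul_eq_mul]

lemma piFourier_prodDil {σ : Fin n → ℝ} (hσ : ∀ j, 0 < σ j) (ξ : Fin n → ℝ) :
    piFourier (prodDil η σ) ξ = ∏ j, 𝓕 (η j) (σ j * ξ j) := by
  have h : ∀ x : Fin n → ℝ, Complex.exp (((-2 * Real.pi * ∑ k, x k * ξ k : ℝ) : ℂ) * Complex.I) *
      prodDil η σ x = ∏ j, (Complex.exp (((-2 * Real.pi * (x j * ξ j) : ℝ) : ℂ) * Complex.I) *
        dil (η j) (σ j) (x j)) := by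
    intro x
    rw [Finset.prod_mul_distrib, ← Complex.exp_sum, prodDil, Finset.mul_sum, Complex.ofReal_sum,
      Finset.sum_mul]
  rw [piFourier]
  simp only [h]
  rw [integral_fintype_prod_volume_eq_prod (fun j y =>
    Complex.exp (((-2 * Real.pi * (y * ξ j) : ℝ) : ℂ) * Complex.I) * dil (η j) (σ j) y)]
  exact Finset.prod_congr rfl fun j _ => integral_exp_mul_dil _ (hσ j) _

lemma piFourier_scaleKernel (ht : ∀ j, 0 < t j) (hε : 0 < ε) (hw : Measurable w)
    (hwi : IntegrableOn w (Ioi ε)) (ξ : Fin n → ℝ) :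
    piFourier (scaleKernel w η t a ε) ξ =
      ∫ s in Ioi ε, w s * ∏ j, 𝓕 (η j) (scaleAt t a s j * ξ j) := by
  let e : (Fin n → ℝ) → ℂ := fun x =>
    Complex.exp (((-2 * Real.pi * ∑ k, x k * ξ k : ℝ) : ℂ) * Complex.I)
  have he : Continuous e := by
    simp only [e]
    fun_prop
  have h_int : Integrable (fun q : (Fin n → ℝ) × ℝ =>
      e q.1 * (w q.2 * prodDil η (scaleAt t a q.2) q.1))
      (volume.prod (volume.restrict (Ioi ε))) := by
    refine (integrable_prod_scale ht hε hw hwi).bdd_mul (c := 1)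
      (he.comp continuous_fst).aestronglyMeasurable (ae_of_all _ fun q => ?_)
    exact (Complex.norm_exp_ofReal_mul_I _).le
  calc _ = ∫ x, ∫ s in Ioi ε, e x * (w s * prodDil η (scaleAt t a s) x) :=
        integral_congr_ae (ae_of_all _ fun x => (integral_const_mul (e x) _).symm)
    _ = ∫ s in Ioi ε, ∫ x, e x * (w s * prodDil η (scaleAt t a s) x) :=
        integral_integral_swap h_int
    _ = _ := by
        refine setIntegral_congr_fun measurableSet_Ioi fun s hs => ?_
        rw [← piFourier_prodDil (scaleAt_pos ht (hε.trans hs)), piFourier, ← integral_const_mul]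
        refine integral_congr_ae (ae_of_all _ fun x => ?_)
        simp only [e]
        ring

/-- The ratios of consecutive dyadic boxes adapted to the orders `2 lₖ`. -/
def boxRatio (l : Fin n → ℕ) (k : Fin n) : ℕ := 2 ^ ((∏ j, l j) / l k)

lemma four_pow_rpow {N l : ℕ} (hl : 0 < l) (hN : l ∣ N) :
    ((4 : ℝ) ^ N) ^ ((1 : ℝ) / (2 * l)) = ((2 ^ (N / l) : ℕ) : ℝ) := by
  obtain ⟨m, rfl⟩ := hN
  rw [Nat.mul_div_cancel_left m hl, ← Real.rpow_natCast, ← Real.rpow_mul (by norm_num),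
    show (4 : ℝ) = 2 ^ (2 : ℝ) by norm_num, ← Real.rpow_mul (by norm_num), Nat.cast_pow,
    ← Real.rpow_natCast]
  congr 1
  have : (l : ℝ) ≠ 0 := by positivity
  push_cast
  field_simp

/-- The scale of boxes with sides `(tₖ 4 ^ (N j)) ^ (1 / (2 lₖ))`, where `N = ∏ lₖ`. -/
def anisotropicScale (l : Fin n → ℕ) (hl : ∀ k, 0 < l k) (ht : ∀ j, 0 < t j) :
    BoxScale (boxRatio l) where
  d j k := scaleAt t (fun k => 1 / (2 * l k)) (((4 : ℝ) ^ ∏ k, l k) ^ j) k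
  d_pos j k := scaleAt_pos ht (by positivity) k
  two_le k := by
    have h : l k ≤ ∏ j, l j := Nat.le_of_dvd (Finset.prod_pos fun j _ => hl j)
      (Finset.dvd_prod_of_mem l (Finset.mem_univ k))
    exact Nat.le_self_pow (Nat.div_pos h (hl k)).ne' 2
  d_succ j k := by
    rw [boxRatio, ← four_pow_rpow (hl k) (Finset.dvd_prod_of_mem l (Finset.mem_univ k)), scaleAt,
      scaleAt, ← Real.mul_rpow (by positivity) (mul_pos (ht k) (by positivity)).le,
      zpow_add_one₀ (by positivity)]
    congr 1
    ring

lemma isCZKernel_scaleKernel {l : Fin n → ℕ} (hl : ∀ k, 0 < l k) (ht : ∀ j, 0 < t j)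
    (hε : 0 < ε) (hw : Measurable w) (hwi : IntegrableOn w (Ioi ε)) (hA : 0 ≤ A)
    (hwA : ∀ s, 0 < s → ‖w s‖ ≤ A / s) {B : ℝ≥0}
    (hB : ∀ ξ, ‖piFourier (scaleKernel w η t (fun k => 1 / (2 * l k)) ε) ξ‖ ≤ B) :
    IsCZKernel (anisotropicScale l hl ht) (scaleKernel w η t (fun k => 1 / (2 * l k)) ε) (B ^ 2)
      (hormanderConst η (fun k => 1 / (2 * l k)) A) := by
  have ha : ∀ k : Fin n, (0 : ℝ) < 1 / (2 * l k) := fun k => by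
    have : (0 : ℝ) < l k := by exact_mod_cast hl k
    positivity
  have hK := integrable_scaleKernel (η := η) (a := fun k => 1 / (2 * l k)) ht hε hw hwi
  have hb := exists_norm_scaleKernel_le (η := η) ht ha hε hwi
  exact ⟨measurable_scaleKernel hw, hK, hb, fun g hg hgb => lintegral_sq_kconv_le hK hb hB hg hgb,
    fun j v hv => lintegral_scaleKernel_sub_le ht ha hε hw hwi hA hwA (by positivity) hv⟩

lemma hormanderConst_ne_top (η : Fin n → 𝓢(ℝ, ℂ)) (a : Fin n → ℝ) (A : ℝ) :
    hormanderConst η a A ≠ ∞ := by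
  unfold hormanderConst
  refine ENNReal.mul_ne_top ENNReal.ofNat_ne_top (ENNReal.mul_ne_top ENNReal.ofReal_ne_top ?_)
  exact ENNReal.sum_ne_top.2 fun k _ => ENNReal.ofReal_ne_top

end ScaleKernelFourier

section Resolvent

open scoped SchwartzMap FourierTransform

variable {n : ℕ} {t : Fin n → ℝ} {l : Fin n → ℕ} {η : Fin n → 𝓢(ℝ, ℂ)} {ε c γ : ℝ} {ω μ : ℂ}

/-- The weight which represents `|μ| ^ (1 - γ) P ^ γ / (μ + P)` as a superposition of
semigroups along the ray in direction `ω`. -/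
def rayWeight (ω μ : ℂ) (γ s : ℝ) : ℂ :=
  ω * Complex.exp (-(ω * μ) * s) * ((‖μ‖ ^ (1 - γ) * s ^ (-γ) : ℝ) : ℂ)

lemma measurable_rayWeight : Measurable (rayWeight ω μ γ) := by
  unfold rayWeight
  fun_prop

lemma norm_rayWeight (hω : ‖ω‖ = 1) {s : ℝ} (hs : 0 < s) :
    ‖rayWeight ω μ γ s‖ = Real.exp (-((ω * μ).re * s)) * (‖μ‖ ^ (1 - γ) * s ^ (-γ)) := by
  rw [rayWeight, norm_mul, norm_mul, hω, one_mul, Complex.norm_exp, Complex.re_mul_ofReal,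
    Complex.neg_re, neg_mul, Complex.norm_of_nonneg (by positivity)]

lemma rpow_le_one_add {y b : ℝ} (hy : 0 ≤ y) (hb0 : 0 ≤ b) (hb1 : b ≤ 1) : y ^ b ≤ 1 + y := by
  rcases le_total y 1 with h | h
  · linarith [Real.rpow_le_one hy h hb0]
  · have := Real.rpow_le_rpow_of_exponent_le h hb1
    rw [Real.rpow_one] at this
    linarith

lemma norm_rayWeight_le (hω : ‖ω‖ = 1) (hc : 0 < c) (hμ : c * ‖μ‖ ≤ (ω * μ).re)
    (hγ0 : 0 ≤ γ) (hγ1 : γ ≤ 1) {s : ℝ} (hs : 0 < s) :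
    ‖rayWeight ω μ γ s‖ ≤ (1 + c⁻¹) / s := by
  rw [norm_rayWeight hω hs, le_div_iff₀ hs]
  have h1 : ‖μ‖ ^ (1 - γ) * s ^ (-γ) * s = (‖μ‖ * s) ^ (1 - γ) := by
    rw [Real.mul_rpow (norm_nonneg _) hs.le, mul_assoc, ← Real.rpow_add_one hs.ne']
    congr 2
    ring
  have hy : 0 ≤ ‖μ‖ * s := by positivity
  have h2 : Real.exp (-((ω * μ).re * s)) ≤ Real.exp (-(c * (‖μ‖ * s))) := by
    refine Real.exp_le_exp.2 (neg_le_neg ?_)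
    rw [← mul_assoc]
    exact mul_le_mul_of_nonneg_right hμ hs.le
  rw [mul_assoc, h1]
  have h3 := rpow_le_one_add (b := 1 - γ) hy (by linarith) (by linarith)
  refine (mul_le_mul h2 h3 (by positivity) (Real.exp_pos _).le).trans ?_
  have h4 := Real.add_one_le_exp (c * (‖μ‖ * s))
  rw [Real.exp_neg, inv_mul_le_iff₀ (Real.exp_pos _)]
  have h5 : 1 + ‖μ‖ * s ≤ (1 + c * (‖μ‖ * s)) * (1 + c⁻¹) := by
    have : c * (‖μ‖ * s) * c⁻¹ = ‖μ‖ * s := by field_simp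
    have h6 : 0 ≤ c * (‖μ‖ * s) := by positivity
    have h7 : 0 ≤ c⁻¹ := by positivity
    nlinarith
  refine h5.trans (mul_le_mul_of_nonneg_right (by linarith) (by positivity))

lemma integrableOn_rayWeight (hω : ‖ω‖ = 1) (hμ : 0 < (ω * μ).re) (hγ0 : 0 ≤ γ) (hε : 0 < ε) :
    IntegrableOn (rayWeight ω μ γ) (Ioi ε) := by
  have h : IntegrableOn (fun s : ℝ => Real.exp (-(ω * μ).re * s) * (‖μ‖ ^ (1 - γ) * ε ^ (-γ)))
      (Ioi ε) := (integrableOn_exp_mul_Ioi (by linarith) ε).mul_const _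
  refine Integrable.mono' h measurable_rayWeight.aestronglyMeasurable
    ((ae_restrict_iff' measurableSet_Ioi).2 (ae_of_all _ fun s hs => ?_))
  have hs0 : 0 < s := hε.trans hs
  rw [norm_rayWeight hω hs0, neg_mul]
  refine mul_le_mul_of_nonneg_left (mul_le_mul_of_nonneg_left ?_ (by positivity))
    (Real.exp_pos _).le
  exact Real.rpow_le_rpow_of_nonpos hε (le_of_lt hs) (by linarith)

/-- The symbol `∑ tⱼ (2 π ξⱼ) ^ (2 lⱼ)` of the anisotropic elliptic operator. -/
def ellipticSymbol (t : Fin n → ℝ) (l : Fin n → ℕ) (ξ : Fin n → ℝ) : ℝ :=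
  ∑ j, t j * (2 * Real.pi * ξ j) ^ (2 * l j)

lemma ellipticSymbol_term_nonneg (ht : ∀ j, 0 < t j) (ξ : Fin n → ℝ) (j : Fin n) :
    0 ≤ t j * (2 * Real.pi * ξ j) ^ (2 * l j) :=
  mul_nonneg (ht j).le ((even_two_mul _).pow_nonneg _)

lemma ellipticSymbol_nonneg (ht : ∀ j, 0 < t j) (ξ : Fin n → ℝ) : 0 ≤ ellipticSymbol t l ξ :=
  Finset.sum_nonneg fun j _ => ellipticSymbol_term_nonneg ht ξ j

lemma le_re_mul_add_ofReal (hcω : c ≤ ω.re) (hμ : c * ‖μ‖ ≤ (ω * μ).re) {P : ℝ} (hP : 0 ≤ P) :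
    c * (‖μ‖ + P) ≤ (ω * (μ + P)).re := by
  rw [mul_add ω, Complex.add_re, Complex.re_mul_ofReal, mul_add c]
  exact add_le_add hμ (mul_le_mul_of_nonneg_right hcω hP)

lemma le_norm_add_ofReal (hω : ‖ω‖ = 1) (hcω : c ≤ ω.re) (hμ : c * ‖μ‖ ≤ (ω * μ).re) {P : ℝ}
    (hP : 0 ≤ P) : c * (‖μ‖ + P) ≤ ‖μ + P‖ := by
  refine (le_re_mul_add_ofReal hcω hμ hP).trans ((Complex.re_le_norm _).trans ?_)
  rw [norm_mul, hω, one_mul]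

lemma rpow_mul_rpow_le_add {x y : ℝ} (hx : 0 ≤ x) (hy : 0 ≤ y) (hγ0 : 0 ≤ γ) (hγ1 : γ ≤ 1) :
    x ^ (1 - γ) * y ^ γ ≤ x + y := by
  have := Real.geom_mean_le_arith_mean2_weighted (by linarith : 0 ≤ 1 - γ) hγ0 hx hy (by ring)
  nlinarith

lemma scaleAt_pow (ht : ∀ j, 0 < t j) {s : ℝ} (hs : 0 < s) (j : Fin n) (m : ℕ) :
    scaleAt t (fun k => 1 / (2 * l k)) s j ^ m = t j ^ ((m : ℝ) / (2 * l j)) *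
      s ^ ((m : ℝ) / (2 * l j)) := by
  rw [scaleAt, ← Real.rpow_mul_natCast (mul_pos (ht j) hs).le, Real.mul_rpow (ht j).le hs.le]
  congr 2 <;> ring

lemma scaleAt_pow_order (hl : ∀ k, 0 < l k) (ht : ∀ j, 0 < t j) {s : ℝ} (hs : 0 < s) (j : Fin n) :
    scaleAt t (fun k => 1 / (2 * l k)) s j ^ (2 * l j) = t j * s := by
  have : (l j : ℝ) ≠ 0 := by exact_mod_cast (hl j).ne'
  rw [scaleAt_pow ht hs]
  push_cast
  rw [div_self (by positivity), Real.rpow_one, Real.rpow_one]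

/-- The tensor factors of the kernel for the `i`-th derivative in the `k`-th direction. -/
def IsRayFactor (η : Fin n → 𝓢(ℝ, ℂ)) (l : Fin n → ℕ) (ω : ℂ) (k : Fin n) (i : ℕ) : Prop :=
  ∀ j (ξ : ℝ), 𝓕 (η j) ξ = (2 * Real.pi * Complex.I * ξ) ^ (if j = k then i else 0) *
    expNegPow (ω * ((2 * Real.pi) ^ (2 * l j) : ℝ)) (l j) ξ

lemma exists_isRayFactor (hl : ∀ k, 0 < l k) (hω : 0 < ω.re) (k : Fin n) (i : ℕ) :
    ∃ η, IsRayFactor η l ω k i := by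
  choose η hη using fun j => exists_schwartz_fourier_eq
    (c := ω * ((2 * Real.pi) ^ (2 * l j) : ℝ)) (l := l j) (by
      rw [Complex.re_mul_ofReal]
      exact mul_pos hω (by positivity)) (hl j) (if j = k then i else 0)
  exact ⟨η, hη⟩

variable {k : Fin n} {i : ℕ}

lemma prod_fourier_rayFactor (hη : IsRayFactor η l ω k i) (hl : ∀ k, 0 < l k)
    (ht : ∀ j, 0 < t j) {s : ℝ} (hs : 0 < s) (ξ : Fin n → ℝ) :
    ∏ j, 𝓕 (η j) (scaleAt t (fun k => 1 / (2 * l k)) s j * ξ j) =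
      ((t k ^ ((i : ℝ) / (2 * l k)) * s ^ ((i : ℝ) / (2 * l k)) : ℝ) : ℂ) *
        (2 * Real.pi * Complex.I * ξ k) ^ i *
          Complex.exp (-(ω * ellipticSymbol t l ξ) * s) := by
  simp only [hη _ _]
  rw [Finset.prod_mul_distrib]
  congr 1
  · have h : ∀ j, (2 * Real.pi * Complex.I *
        ((scaleAt t (fun k => 1 / (2 * l k)) s j * ξ j : ℝ) : ℂ)) ^ (if j = k then i else 0) =
        if j = k then (2 * Real.pi * Complex.I *
          ((scaleAt t (fun k => 1 / (2 * l k)) s k * ξ k : ℝ) : ℂ)) ^ i else 1 := by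
      intro j
      split_ifs with hj
      · rw [hj]
      · rw [pow_zero]
    rw [Finset.prod_congr rfl fun j _ => h j, Finset.prod_ite_eq' Finset.univ k,
      if_pos (Finset.mem_univ k), ← scaleAt_pow ht hs k i]
    push_cast
    ring
  · unfold expNegPow
    rw [← Complex.exp_sum]
    congr 1
    rw [ellipticSymbol, Complex.ofReal_sum, Finset.mul_sum, ← Finset.sum_neg_distrib,
      Finset.sum_mul]
    refine Finset.sum_congr rfl fun j _ => ?_
    rw [← Complex.ofReal_pow, mul_pow (scaleAt _ _ _ _), scaleAt_pow_order hl ht hs,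
      mul_pow (2 * Real.pi) (ξ j)]
    push_cast
    ring

lemma piFourier_rayKernel (hη : IsRayFactor η l ω k i) (hl : ∀ k, 0 < l k) (ht : ∀ j, 0 < t j)
    (hω : ‖ω‖ = 1) (hc : 0 < c) (hcω : c ≤ ω.re) (hμ0 : μ ≠ 0) (hμ : c * ‖μ‖ ≤ (ω * μ).re)
    (hε : 0 < ε) (ξ : Fin n → ℝ) :
    piFourier (scaleKernel (rayWeight ω μ ((i : ℝ) / (2 * l k))) η t
        (fun k => 1 / (2 * l k)) ε) ξ =
      ((t k ^ ((i : ℝ) / (2 * l k)) * ‖μ‖ ^ (1 - (i : ℝ) / (2 * l k)) : ℝ) : ℂ) *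
        (2 * Real.pi * Complex.I * ξ k) ^ i *
          Complex.exp (-(ω * (μ + ellipticSymbol t l ξ)) * ε) / (μ + ellipticSymbol t l ξ) := by
  have hP := ellipticSymbol_nonneg (l := l) ht ξ
  have hμ' : 0 < ‖μ‖ := norm_pos_iff.2 hμ0
  have hre : 0 < (ω * (μ + ellipticSymbol t l ξ)).re :=
    lt_of_lt_of_le (by positivity) (le_re_mul_add_ofReal hcω hμ hP)
  have hne : μ + ellipticSymbol t l ξ ≠ 0 := by
    intro h
    simp [h] at hre
  have hω0 : ω ≠ 0 := by
    rintro rfl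
    simp at hω
  have hγ0 : 0 ≤ (i : ℝ) / (2 * l k) := by positivity
  rw [piFourier_scaleKernel ht hε measurable_rayWeight
    (integrableOn_rayWeight hω (lt_of_lt_of_le (by positivity) hμ) hγ0 hε)]
  have h : ∀ s ∈ Ioi ε, rayWeight ω μ ((i : ℝ) / (2 * l k)) s *
      ∏ j, 𝓕 (η j) (scaleAt t (fun k => 1 / (2 * l k)) s j * ξ j) =
      ω * ((t k ^ ((i : ℝ) / (2 * l k)) * ‖μ‖ ^ (1 - (i : ℝ) / (2 * l k)) : ℝ) : ℂ) *
        (2 * Real.pi * Complex.I * ξ k) ^ i *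
          Complex.exp (-(ω * (μ + ellipticSymbol t l ξ)) * s) := by
    intro s hs
    have hs0 : 0 < s := hε.trans hs
    have h1 : s ^ (-((i : ℝ) / (2 * l k))) * s ^ ((i : ℝ) / (2 * l k)) = 1 := by
      rw [← Real.rpow_add hs0, neg_add_cancel, Real.rpow_zero]
    rw [prod_fourier_rayFactor hη hl ht hs0, rayWeight,
      show -(ω * (μ + ellipticSymbol t l ξ)) * (s : ℂ) =
        -(ω * μ) * s + -(ω * ellipticSymbol t l ξ) * s by ring, Complex.exp_add]
    have h2 : ((s ^ (-((i : ℝ) / (2 * l k))) : ℝ) : ℂ) *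
        ((s ^ ((i : ℝ) / (2 * l k)) : ℝ) : ℂ) = 1 := by
      exact_mod_cast h1
    simp only [Complex.ofReal_mul]
    linear_combination (ω * Complex.exp (-(ω * μ) * s) * ((‖μ‖ ^ (1 - (i : ℝ) / (2 * l k)) : ℝ) : ℂ)
      * ((t k ^ ((i : ℝ) / (2 * l k)) : ℝ) : ℂ) * (2 * Real.pi * Complex.I * ξ k) ^ i *
          Complex.exp (-(ω * ellipticSymbol t l ξ) * s)) * h2
  rw [setIntegral_congr_fun measurableSet_Ioi h, integral_const_mul,
    integral_exp_mul_complex_Ioi (by rw [Complex.neg_re]; linarith)]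
  field_simp

lemma norm_piFourier_rayKernel_le (hη : IsRayFactor η l ω k i) (hl : ∀ k, 0 < l k)
    (ht : ∀ j, 0 < t j) (hω : ‖ω‖ = 1) (hc : 0 < c) (hcω : c ≤ ω.re) (hμ0 : μ ≠ 0)
    (hμ : c * ‖μ‖ ≤ (ω * μ).re) (hε : 0 < ε) (hi : i ≤ 2 * l k) (ξ : Fin n → ℝ) :
    ‖piFourier (scaleKernel (rayWeight ω μ ((i : ℝ) / (2 * l k))) η t
        (fun k => 1 / (2 * l k)) ε) ξ‖ ≤ c⁻¹ := by
  rw [piFourier_rayKernel hη hl ht hω hc hcω hμ0 hμ hε]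
  set P := ellipticSymbol t l ξ with hPdef
  set γ := (i : ℝ) / (2 * l k) with hγ
  have hlk : (0 : ℝ) < l k := by exact_mod_cast hl k
  have hγ0 : 0 ≤ γ := by positivity
  have hγ1 : γ ≤ 1 := (div_le_one (by positivity)).2 (by exact_mod_cast hi)
  have hP : 0 ≤ P := ellipticSymbol_nonneg ht ξ
  have hμ' : 0 < ‖μ‖ := norm_pos_iff.2 hμ0
  have hre : 0 < (ω * (μ + P)).re :=
    lt_of_lt_of_le (by positivity) (le_re_mul_add_ofReal hcω hμ hP)
  have hden := le_norm_add_ofReal hω hcω hμ hP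
  have hexp : ‖Complex.exp (-(ω * (μ + P)) * ε)‖ ≤ 1 := by
    rw [Complex.norm_exp, Complex.re_mul_ofReal, Complex.neg_re]
    exact Real.exp_le_one_iff.2 (by nlinarith)
  have hxi : ‖(2 * Real.pi * Complex.I * ξ k) ^ i‖ = |2 * Real.pi * ξ k| ^ i := by
    rw [norm_pow, show (2 * Real.pi * Complex.I * ξ k : ℂ) =
      ((2 * Real.pi * ξ k : ℝ) : ℂ) * Complex.I by push_cast; ring, norm_mul, Complex.norm_I,
      mul_one, Complex.norm_real, Real.norm_eq_abs]
  have hpow : t k ^ γ * |2 * Real.pi * ξ k| ^ i =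
      (t k * (2 * Real.pi * ξ k) ^ (2 * l k)) ^ γ := by
    rw [Real.mul_rpow (ht k).le ((even_two_mul _).pow_nonneg _), ← (even_two_mul (l k)).pow_abs,
      ← Real.rpow_natCast_mul (abs_nonneg _), ← Real.rpow_natCast]
    congr 2
    rw [hγ]
    push_cast
    field_simp
  have hle : t k * (2 * Real.pi * ξ k) ^ (2 * l k) ≤ P :=
    Finset.single_le_sum (f := fun j => t j * (2 * Real.pi * ξ j) ^ (2 * l j))
      (fun j _ => ellipticSymbol_term_nonneg ht ξ j) (Finset.mem_univ k)
  have hnum := rpow_mul_rpow_le_add hμ'.le (ellipticSymbol_term_nonneg (l := l) ht ξ k) hγ0 hγ1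
  rw [norm_div, norm_mul, norm_mul, hxi,
    Complex.norm_of_nonneg (mul_nonneg (Real.rpow_nonneg (ht k).le _) (by positivity)),
    div_le_iff₀ (lt_of_lt_of_le (by positivity) hden)]
  have h1 : t k ^ γ * ‖μ‖ ^ (1 - γ) * |2 * Real.pi * ξ k| ^ i ≤ ‖μ‖ + P := by
    rw [show t k ^ γ * ‖μ‖ ^ (1 - γ) * |2 * Real.pi * ξ k| ^ i =
      ‖μ‖ ^ (1 - γ) * (t k ^ γ * |2 * Real.pi * ξ k| ^ i) by ring, hpow]
    linarith
  have h2 : ‖μ‖ + P ≤ c⁻¹ * ‖μ + P‖ := by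
    rw [inv_mul_eq_div, le_div_iff₀ hc, mul_comm]
    exact hden
  have h0 : 0 ≤ t k ^ γ * ‖μ‖ ^ (1 - γ) * |2 * Real.pi * ξ k| ^ i :=
    mul_nonneg (mul_nonneg (Real.rpow_nonneg (ht k).le _) (by positivity)) (by positivity)
  exact (mul_le_of_le_one_right h0 hexp).trans (h1.trans h2)

end Resolvent

section Coercive

open scoped SchwartzMap FourierTransform

variable {n : ℕ} {t : Fin n → ℝ} {l : Fin n → ℕ} {η : Fin n → 𝓢(ℝ, ℂ)} {c p : ℝ} {ω μ : ℂ}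
  {k : Fin n} {i : ℕ} {u f : 𝓢(Fin n → ℝ, ℂ)}

lemma fourier_onEuclidean_pdIter (u : 𝓢(Fin n → ℝ, ℂ)) (k : Fin n) (i : ℕ)
    (ξ : EuclideanSpace ℝ (Fin n)) :
    𝓕 (onEuclidean (pdIter n k i u)) ξ =
      (2 * Real.pi * Complex.I * ξ k) ^ i * 𝓕 (onEuclidean u) ξ := by
  induction i with
  | zero => rw [pow_zero, one_mul]; rfl
  | succ i ih =>
    rw [pow_succ', mul_assoc, ← ih, ← fourier_onEuclidean_lineDeriv, pdIter,
      Function.iterate_succ_apply']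
    rfl

/-- `u` solves the anisotropic elliptic equation with parameters `t`, `μ` and right side `f`. -/
def SolvesElliptic (l : Fin n → ℕ) (t : Fin n → ℝ) (μ : ℂ) (u f : 𝓢(Fin n → ℝ, ℂ)) : Prop :=
  ∀ x, (∑ k, ((-1 : ℝ) ^ (l k) * t k) • pdIter n k (2 * l k) u x) + μ * u x = f x

lemma fourier_eq_of_solvesElliptic (h : SolvesElliptic l t μ u f)
    (ξ : EuclideanSpace ℝ (Fin n)) :
    𝓕 (onEuclidean f) ξ = (μ + ellipticSymbol t l ξ.ofLp) * 𝓕 (onEuclidean u) ξ := by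
  have hf : onEuclidean f = (∑ k, (((-1 : ℝ) ^ (l k) * t k : ℝ) : ℂ) •
      onEuclidean (pdIter n k (2 * l k) u)) + μ • onEuclidean u := by
    ext x
    rw [onEuclidean_apply, ← h x.ofLp]
    simp [sum_apply, onEuclidean_apply]
  have hF : 𝓕 (onEuclidean f) = (∑ k, (((-1 : ℝ) ^ (l k) * t k : ℝ) : ℂ) •
      𝓕 (onEuclidean (pdIter n k (2 * l k) u))) + μ • 𝓕 (onEuclidean u) := by
    rw [hf]
    simp only [FourierTransform.fourier_add, FourierTransform.fourier_smul,
      FourierTransform.fourier_sum]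
  rw [hF]
  simp only [add_apply, sum_apply, smul_apply, smul_eq_mul,
    fourier_onEuclidean_pdIter]
  rw [ellipticSymbol, Complex.ofReal_sum, add_mul, Finset.sum_mul, add_comm]
  congr 1
  refine Finset.sum_congr rfl fun j _ => ?_
  have hI : (Complex.I : ℂ) ^ (2 * l j) = (-1) ^ l j := by rw [pow_mul, Complex.I_sq]
  have h1 : ((-1 : ℂ) ^ l j) * (-1) ^ l j = 1 := by rw [← mul_pow]; norm_num
  rw [show (2 * Real.pi * Complex.I * ξ j : ℂ) = (2 * Real.pi * ξ j : ℂ) * Complex.I by ring,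
    mul_pow _ Complex.I, hI]
  push_cast
  linear_combination ((t j : ℂ) * (2 * Real.pi * ξ j) ^ (2 * l j) * 𝓕 (onEuclidean u) ξ) * h1

/-- The regularised symbols converge to the identity after Fourier inversion. -/
lemma tendsto_fourierInv_exp_mul (g : 𝓢(Fin n → ℝ, ℂ)) {m : (Fin n → ℝ) → ℂ} (hm : Continuous m)
    (hm0 : ∀ ξ, 0 ≤ (m ξ).re) {ε : ℕ → ℝ} (hε0 : ∀ N, 0 < ε N) (hε : Tendsto ε atTop (𝓝 0))
    (x : EuclideanSpace ℝ (Fin n)) :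
    Tendsto (fun N => 𝓕⁻ (fun ξ : EuclideanSpace ℝ (Fin n) =>
      Complex.exp (-(m ξ.ofLp) * ε N) * 𝓕 (onEuclidean g) ξ) x) atTop (𝓝 (g x.ofLp)) := by
  have hinv : g x.ofLp = 𝓕⁻ (fun ξ => 𝓕 (onEuclidean g) ξ) x := by
    rw [← onEuclidean_apply, ← SchwartzMap.fourierInv_coe,
      FourierTransform.fourierInv_fourier_eq]
  rw [hinv]
  simp only [Real.fourierInv_eq']
  have hcm : Continuous fun ξ : EuclideanSpace ℝ (Fin n) => m ξ.ofLp := by fun_prop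
  have hcg : Continuous fun ξ => 𝓕 (onEuclidean g) ξ := (𝓕 (onEuclidean g)).continuous
  refine tendsto_integral_of_dominated_convergence (fun ξ => ‖𝓕 (onEuclidean g) ξ‖)
    (fun N => Continuous.aestronglyMeasurable (by fun_prop))
    (𝓕 (onEuclidean g)).integrable.norm (fun N => ae_of_all _ fun ξ => ?_)
    (ae_of_all _ fun ξ => ?_)
  · rw [norm_smul, Complex.norm_exp_ofReal_mul_I, one_mul, norm_mul]
    refine mul_le_of_le_one_left (norm_nonneg _) ?_
    rw [Complex.norm_exp, Complex.re_mul_ofReal, Complex.neg_re]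
    exact Real.exp_le_one_iff.2 (by nlinarith [hm0 ξ.ofLp, hε0 N])
  · refine Tendsto.const_smul ?_ _
    have h1 : Tendsto (fun N => Complex.exp (-(m ξ.ofLp) * ε N)) atTop (𝓝 1) := by
      have h2 : Continuous fun e : ℝ => Complex.exp (-(m ξ.ofLp) * e) := by fun_prop
      have h3 := (h2.tendsto 0).comp hε
      simpa [Function.comp_def] using h3
    simpa using h1.mul_const (𝓕 (onEuclidean g) ξ)

lemma kconv_rayKernel (hη : IsRayFactor η l ω k i) (hl : ∀ k, 0 < l k) (ht : ∀ j, 0 < t j)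
    (hω : ‖ω‖ = 1) (hc : 0 < c) (hcω : c ≤ ω.re) (hμ0 : μ ≠ 0) (hμ : c * ‖μ‖ ≤ (ω * μ).re)
    (h : SolvesElliptic l t μ u f) {ε : ℝ} (hε : 0 < ε) (x : EuclideanSpace ℝ (Fin n)) :
    kconv (scaleKernel (rayWeight ω μ ((i : ℝ) / (2 * l k))) η t (fun k => 1 / (2 * l k)) ε) f
        x.ofLp =
      𝓕⁻ (fun ξ : EuclideanSpace ℝ (Fin n) =>
        Complex.exp (-(ω * (μ + ellipticSymbol t l ξ.ofLp)) * ε) *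
          𝓕 (onEuclidean (((t k ^ ((i : ℝ) / (2 * l k)) *
            ‖μ‖ ^ (1 - (i : ℝ) / (2 * l k)) : ℝ) : ℂ) • pdIter n k i u)) ξ) x := by
  have hμ' : 0 < ‖μ‖ := norm_pos_iff.2 hμ0
  have hK := integrable_scaleKernel (η := η) (a := fun k => 1 / (2 * l k)) ht hε
    measurable_rayWeight (integrableOn_rayWeight (γ := (i : ℝ) / (2 * l k)) hω
      (lt_of_lt_of_le (mul_pos hc hμ') hμ) (by positivity) hε)
  rw [kconv_schwartz_eq_fourierInv hK]
  refine congrArg (fun F : EuclideanSpace ℝ (Fin n) → ℂ => 𝓕⁻ F x) (funext fun ξ => ?_)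
  have hden : (μ + ellipticSymbol t l ξ.ofLp : ℂ) ≠ 0 := by
    have hP := ellipticSymbol_nonneg (l := l) ht ξ.ofLp
    exact norm_pos_iff.1 (lt_of_lt_of_le (by positivity) (le_norm_add_ofReal hω hcω hμ hP))
  have hsm : ∀ (a : ℂ) (g : 𝓢(Fin n → ℝ, ℂ)), onEuclidean (a • g) = a • onEuclidean g :=
    fun a g => rfl
  rw [piFourier_rayKernel hη hl ht hω hc hcω hμ0 hμ hε, fourier_eq_of_solvesElliptic h, hsm,
    FourierTransform.fourier_smul, smul_apply, fourier_onEuclidean_pdIter, smul_eq_mul]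
  field_simp

lemma lintegral_rpow_le_of_tendsto {F : ℕ → (Fin n → ℝ) → ℂ} {G : (Fin n → ℝ) → ℂ} {D : ℝ≥0∞}
    (hF : ∀ N, Measurable (F N)) (hG : ∀ x, Tendsto (fun N => F N x) atTop (𝓝 (G x)))
    (hD : ∀ N, ∫⁻ x, ‖F N x‖ₑ ^ p ≤ D) : ∫⁻ x, ‖G x‖ₑ ^ p ≤ D := by
  have h : ∀ x, ‖G x‖ₑ ^ p = liminf (fun N => ‖F N x‖ₑ ^ p) atTop := fun x =>
    (((ENNReal.continuous_rpow_const (y := p)).tendsto _).comp (hG x).enorm).liminf_eq.symm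
  simp only [h]
  refine (lintegral_liminf_le fun N => (hF N).enorm.pow_const p).trans ?_
  exact liminf_le_of_le_of_tendsto hD tendsto_const_nhds

lemma exists_lintegral_pdIter_le [NeZero n] (hl : ∀ k, 0 < l k) (hp : 1 < p) (hω : ‖ω‖ = 1)
    (hc : 0 < c) (hcω : c ≤ ω.re) (k : Fin n) (hi : i ≤ 2 * l k) :
    ∃ C : ℝ≥0∞, C ≠ ∞ ∧ ∀ μ : ℂ, μ ≠ 0 → c * ‖μ‖ ≤ (ω * μ).re → ∀ t : Fin n → ℝ,
      (∀ j, 0 < t j) → ∀ u f : 𝓢(Fin n → ℝ, ℂ), SolvesElliptic l t μ u f →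
      ∫⁻ x, ‖((t k ^ ((i : ℝ) / (2 * l k)) * ‖μ‖ ^ (1 - (i : ℝ) / (2 * l k)) : ℝ) : ℂ) *
        pdIter n k i u x‖ₑ ^ p ≤ C * ∫⁻ x, ‖f x‖ₑ ^ p := by
  obtain ⟨η, hη⟩ := exists_isRayFactor hl (hc.trans_le hcω) k i
  obtain ⟨b, hb⟩ : ∃ b : ℝ≥0, (b : ℝ) = c⁻¹ := ⟨⟨c⁻¹, (inv_pos.2 hc).le⟩, rfl⟩
  obtain ⟨C, hC, hmain⟩ := exists_strong_type (boxRatio l) hp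
    (B := (b : ℝ≥0∞) ^ 2)
    (H := hormanderConst η (fun k => 1 / (2 * l k)) (1 + c⁻¹))
    (ENNReal.pow_ne_top ENNReal.coe_ne_top) (hormanderConst_ne_top _ _ _)
  refine ⟨C, hC, fun μ hμ0 hμ t ht u f h => ?_⟩
  have hlk : (0 : ℝ) < l k := by exact_mod_cast hl k
  have hγ0 : 0 ≤ (i : ℝ) / (2 * l k) := by positivity
  have hγ1 : (i : ℝ) / (2 * l k) ≤ 1 := (div_le_one (by positivity)).2 (by exact_mod_cast hi)
  have hμ' : 0 < ‖μ‖ := norm_pos_iff.2 hμ0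
  let ε : ℕ → ℝ := fun N => 1 / ((N : ℝ) + 1)
  have hε : ∀ N, 0 < ε N := fun N => Nat.one_div_pos_of_nat
  let K : ℕ → (Fin n → ℝ) → ℂ := fun N =>
    scaleKernel (rayWeight ω μ ((i : ℝ) / (2 * l k))) η t (fun k => 1 / (2 * l k)) (ε N)
  have hwi : ∀ N, IntegrableOn (rayWeight ω μ ((i : ℝ) / (2 * l k))) (Ioi (ε N)) := fun N =>
    integrableOn_rayWeight hω (lt_of_lt_of_le (mul_pos hc hμ') hμ) hγ0 (hε N)
  have hCZ : ∀ N, IsCZKernel (anisotropicScale l hl ht) (K N) _ _ := fun N =>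
    isCZKernel_scaleKernel (η := η) hl ht (hε N) measurable_rayWeight (hwi N)
      (by positivity : 0 ≤ 1 + c⁻¹)
      (fun s hs => norm_rayWeight_le hω hc hμ hγ0 hγ1 hs) (B := b)
      (hb ▸ norm_piFourier_rayKernel_le hη hl ht hω hc hcω hμ0 hμ (hε N) hi)
  have hsymb : Continuous fun ξ : Fin n → ℝ => ω * (μ + ellipticSymbol t l ξ) := by
    unfold ellipticSymbol
    fun_prop
  refine lintegral_rpow_le_of_tendsto (F := fun N => kconv (K N) f)
    (fun N => ?_) (fun x => ?_)
    (fun N => hmain _ _ _ (hCZ N) f.continuous f.integrable f.exists_norm_le)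
  · exact (continuous_kconv (hCZ N).integrable f.continuous f.exists_norm_le).measurable
  · have hlim := tendsto_fourierInv_exp_mul (((t k ^ ((i : ℝ) / (2 * l k)) *
      ‖μ‖ ^ (1 - (i : ℝ) / (2 * l k)) : ℝ) : ℂ) • pdIter n k i u) hsymb (fun ξ => ?_) hε
      tendsto_one_div_add_atTop_nhds_zero_nat (WithLp.toLp 2 x)
    · refine hlim.congr fun N => ?_
      exact (kconv_rayKernel hη hl ht hω hc hcω hμ0 hμ h (hε N) (WithLp.toLp 2 x)).symm
    · have hP := ellipticSymbol_nonneg (l := l) ht ξ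
      exact (mul_nonneg hc.le (by positivity)).trans (le_re_mul_add_ofReal hcω hμ hP)

end Coercive

section Conclusion

open scoped SchwartzMap

variable {n : ℕ} {l : Fin n → ℕ} {p φ : ℝ}

lemma LpN_nonneg (g : (Fin n → ℝ) → ℂ) : 0 ≤ LpN n p g :=
  Real.rpow_nonneg (integral_nonneg fun _ => Real.rpow_nonneg (norm_nonneg _) _) _

lemma LpN_eq_toReal_lintegral (hp : 0 < p) (g : 𝓢(Fin n → ℝ, ℂ)) :
    LpN n p (fun x => g x) = (∫⁻ x, ‖g x‖ₑ ^ p).toReal ^ (1 / p) := by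
  have hc : Continuous fun x => ‖g x‖ ^ p :=
    g.continuous.norm.rpow_const fun _ => Or.inr hp.le
  rw [LpN, lintegral_enorm_rpow _ hp.le, integral_eq_lintegral_of_nonneg_ae
    (ae_of_all _ fun _ => Real.rpow_nonneg (norm_nonneg _) _) hc.aestronglyMeasurable]

lemma lintegral_enorm_rpow_schwartz_ne_top (hp : 0 < p) (g : 𝓢(Fin n → ℝ, ℂ)) :
    ∫⁻ x, ‖g x‖ₑ ^ p ≠ ∞ := by
  have h := (g.memLp (ENNReal.ofReal p) volume).2
  have := lintegral_rpow_enorm_lt_top_of_eLpNorm_lt_top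
    (by simpa using hp) ENNReal.ofReal_ne_top h
  rw [ENNReal.toReal_ofReal hp.le] at this
  exact this.ne

lemma mul_LpN_le_of_lintegral_le (hp : 0 < p) {C : ℝ≥0∞} (hC : C ≠ ∞) {κ : ℝ} (hκ : 0 ≤ κ)
    {g f : 𝓢(Fin n → ℝ, ℂ)} (h : ∫⁻ x, ‖(κ : ℂ) * g x‖ₑ ^ p ≤ C * ∫⁻ x, ‖f x‖ₑ ^ p) :
    κ * LpN n p (fun x => g x) ≤ C.toReal ^ (1 / p) * LpN n p (fun x => f x) := by
  have h1 : ∫⁻ x, ‖(κ : ℂ) * g x‖ₑ ^ p = ENNReal.ofReal (κ ^ p) * ∫⁻ x, ‖g x‖ₑ ^ p := by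
    rw [← lintegral_const_mul' _ _ ENNReal.ofReal_ne_top]
    refine lintegral_congr fun x => ?_
    rw [enorm_mul, ENNReal.mul_rpow_of_nonneg _ _ hp.le, ← ofReal_norm, Complex.norm_of_nonneg hκ,
      ENNReal.ofReal_rpow_of_nonneg hκ hp.le]
  rw [h1] at h
  have h2 := ENNReal.toReal_mono
    (ENNReal.mul_ne_top hC (lintegral_enorm_rpow_schwartz_ne_top hp f)) h
  rw [ENNReal.toReal_mul, ENNReal.toReal_mul, ENNReal.toReal_ofReal (by positivity)] at h2
  have h3 := Real.rpow_le_rpow (mul_nonneg (by positivity) ENNReal.toReal_nonneg) h2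
    (by positivity : 0 ≤ 1 / p)
  rw [Real.mul_rpow (by positivity) ENNReal.toReal_nonneg,
    Real.mul_rpow ENNReal.toReal_nonneg ENNReal.toReal_nonneg, ← Real.rpow_mul hκ,
    mul_one_div_cancel hp.ne', Real.rpow_one] at h3
  rwa [LpN_eq_toReal_lintegral hp, LpN_eq_toReal_lintegral hp]

/-- The unit vectors `exp (∓ i φ / 2)` which rotate the upper and the lower half of the sector into
the right half plane. -/
def sectorRay (φ : ℝ) (b : Bool) : ℂ :=
  Complex.exp (((if b then -(φ / 2) else φ / 2 : ℝ) : ℂ) * Complex.I)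

lemma norm_sectorRay (φ : ℝ) (b : Bool) : ‖sectorRay φ b‖ = 1 := Complex.norm_exp_ofReal_mul_I _

lemma re_sectorRay (φ : ℝ) (b : Bool) : (sectorRay φ b).re = Real.cos (φ / 2) := by
  rw [sectorRay, Complex.exp_ofReal_mul_I_re]
  cases b <;> simp

lemma cos_half_pos (hφ0 : 0 ≤ φ) (hφπ : φ < Real.pi) : 0 < Real.cos (φ / 2) :=
  Real.cos_pos_of_mem_Ioo ⟨by linarith [Real.pi_pos], by linarith⟩

lemma exists_sectorRay (hφ0 : 0 ≤ φ) (hφπ : φ < Real.pi) {z : ℂ} (hz : z ∈ Sector φ) :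
    ∃ b, Real.cos (φ / 2) * (1 + ‖z‖) ≤ (sectorRay φ b * (1 + z)).re := by
  have key : ∀ b, (sectorRay φ b * (1 + z)).re = Real.cos (φ / 2) +
      ‖z‖ * Real.cos (z.arg + if b then -(φ / 2) else φ / 2) := by
    intro b
    rw [mul_add, mul_one, Complex.add_re, re_sectorRay]
    congr 1
    nth_rewrite 1 [← Complex.norm_mul_exp_arg_mul_I z]
    rw [sectorRay, mul_left_comm, ← Complex.exp_add, ← add_mul, ← Complex.ofReal_add,
      Complex.re_ofReal_mul, Complex.exp_ofReal_mul_I_re, add_comm (z.arg)]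
  have hcos : ∀ y : ℝ, |y| ≤ φ / 2 → Real.cos (φ / 2) ≤ Real.cos y := fun y hy => by
    rw [← Real.cos_abs y]
    exact Real.cos_le_cos_of_nonneg_of_le_pi (abs_nonneg _) (by linarith) hy
  have hfin : ∀ b, |z.arg + if b then -(φ / 2) else φ / 2| ≤ φ / 2 →
      Real.cos (φ / 2) * (1 + ‖z‖) ≤ (sectorRay φ b * (1 + z)).re := fun b hb => by
    rw [key]
    nlinarith [hcos _ hb, norm_nonneg z]
  have harg : |z.arg| ≤ φ := by
    rcases hz with rfl | h
    · simpa using hφ0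
    · exact h
  obtain ⟨h1, h2⟩ := abs_le.1 harg
  rcases le_total 0 z.arg with h | h
  · exact ⟨true, hfin _ (by rw [if_pos rfl]; exact abs_le.2 ⟨by linarith, by linarith⟩)⟩
  · exact ⟨false, hfin _ (by
      rw [if_neg (by simp)]; exact abs_le.2 ⟨by linarith, by linarith⟩)⟩

lemma cos_half_mul_le_norm_one_add (hφ0 : 0 ≤ φ) (hφπ : φ < Real.pi) {z : ℂ} (hz : z ∈ Sector φ) :
    Real.cos (φ / 2) * (1 + ‖z‖) ≤ ‖1 + z‖ := by
  obtain ⟨b, hb⟩ := exists_sectorRay hφ0 hφπ hz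
  refine hb.trans ((Complex.re_le_norm _).trans ?_)
  rw [norm_mul, norm_sectorRay, one_mul]

lemma exists_LpN_pdIter_le [NeZero n] (hl : ∀ k, 0 < l k) (hp : 1 < p) (hφ0 : 0 ≤ φ)
    (hφπ : φ < Real.pi) (k : Fin n) (i : ℕ) :
    ∃ D : ℝ, 0 ≤ D ∧ (i ≤ 2 * l k → ∀ z ∈ Sector φ, ∀ t : Fin n → ℝ, (∀ j, 0 < t j) →
      ∀ u f : 𝓢(Fin n → ℝ, ℂ), SolvesElliptic l t (1 + z) u f →
      t k ^ ((i : ℝ) / (2 * l k)) * (1 + ‖z‖) ^ (1 - (i : ℝ) / (2 * l k)) *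
        LpN n p (fun x => pdIter n k i u x) ≤ D * LpN n p (fun x => f x)) := by
  by_cases hi : i ≤ 2 * l k
  swap
  · exact ⟨0, le_rfl, fun h => absurd h hi⟩
  have hc := cos_half_pos hφ0 hφπ
  have hp0 : 0 < p := by linarith
  set c := Real.cos (φ / 2) with hcdef
  choose C hC hmain using fun b => exists_lintegral_pdIter_le (i := i) hl hp (norm_sectorRay φ b) hc
    (re_sectorRay φ b).ge k hi
  refine ⟨c⁻¹ * ∑ b, (C b).toReal ^ (1 / p), by positivity, fun _ z hz t ht u f h => ?_⟩
  obtain ⟨b, hb⟩ := exists_sectorRay hφ0 hφπ hz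
  have hz1 : 0 < 1 + ‖z‖ := by positivity
  have hn := cos_half_mul_le_norm_one_add hφ0 hφπ hz
  have hμ0 : (1 + z) ≠ 0 := norm_pos_iff.1 (lt_of_lt_of_le (mul_pos hc hz1) hn)
  have hμ : c * ‖1 + z‖ ≤ (sectorRay φ b * (1 + z)).re := by
    refine le_trans (mul_le_mul_of_nonneg_left ?_ hc.le) hb
    exact (norm_add_le _ _).trans (by simp)
  have hlk : (0 : ℝ) < l k := by exact_mod_cast hl k
  set γ := (i : ℝ) / (2 * l k) with hγ
  have hγ0 : 0 ≤ γ := by positivity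
  have hγ1 : γ ≤ 1 := (div_le_one (by positivity)).2 (by exact_mod_cast hi)
  have htγ : 0 ≤ t k ^ γ := Real.rpow_nonneg (ht k).le _
  have hest := mul_LpN_le_of_lintegral_le hp0 (hC b)
    (mul_nonneg htγ (Real.rpow_nonneg (norm_nonneg (1 + z)) (1 - γ)))
    (hmain b (1 + z) hμ0 hμ t ht u f h)
  have hrpow : (1 + ‖z‖) ^ (1 - γ) ≤ c⁻¹ * ‖1 + z‖ ^ (1 - γ) := by
    have h1 : c ≤ c ^ (1 - γ) := by
      have := Real.rpow_le_rpow_of_exponent_ge hc (Real.cos_le_one _) (by linarith : 1 - γ ≤ 1)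
      rwa [Real.rpow_one] at this
    have h2 := Real.rpow_le_rpow (by positivity) hn (by linarith : 0 ≤ 1 - γ)
    rw [Real.mul_rpow hc.le hz1.le] at h2
    rw [inv_mul_eq_div, le_div_iff₀ hc, mul_comm]
    exact (mul_le_mul_of_nonneg_right h1 (by positivity)).trans h2
  have hu := LpN_nonneg (p := p) (fun x => pdIter n k i u x)
  calc _ ≤ t k ^ γ * (c⁻¹ * ‖1 + z‖ ^ (1 - γ)) * LpN n p (fun x => pdIter n k i u x) :=
        mul_le_mul_of_nonneg_right (mul_le_mul_of_nonneg_left hrpow htγ) hu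
    _ = c⁻¹ * (t k ^ γ * ‖1 + z‖ ^ (1 - γ) * LpN n p (fun x => pdIter n k i u x)) := by ring
    _ ≤ c⁻¹ * ((C b).toReal ^ (1 / p) * LpN n p (fun x => f x)) :=
        mul_le_mul_of_nonneg_left hest (inv_nonneg.2 hc.le)
    _ ≤ c⁻¹ * ((∑ b, (C b).toReal ^ (1 / p)) * LpN n p (fun x => f x)) := by
        refine mul_le_mul_of_nonneg_left (mul_le_mul_of_nonneg_right ?_ (LpN_nonneg _))
          (inv_nonneg.2 hc.le)
        exact Finset.single_le_sum (f := fun b => (C b).toReal ^ (1 / p))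
          (fun b _ => by positivity) (Finset.mem_univ b)
    _ = _ := by ring

lemma exists_LpN_le_of_isEmpty {l : Fin 0 → ℕ} (hp : 0 < p) (hφ0 : 0 ≤ φ) (hφπ : φ < Real.pi) :
    ∃ D : ℝ, 0 < D ∧ ∀ z ∈ Sector φ, ∀ t : Fin 0 → ℝ, ∀ u f : 𝓢(Fin 0 → ℝ, ℂ),
      SolvesElliptic l t (1 + z) u f →
        LpN 0 p (fun x => u x) ≤ D * LpN 0 p (fun x => f x) := by
  have hc := cos_half_pos hφ0 hφπ
  refine ⟨(Real.cos (φ / 2))⁻¹, inv_pos.2 hc, fun z hz t u f h => ?_⟩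
  have hn := cos_half_mul_le_norm_one_add hφ0 hφπ hz
  have hle : ∫⁻ x, ‖(Real.cos (φ / 2) : ℂ) * u x‖ₑ ^ p ≤ 1 * ∫⁻ x, ‖f x‖ₑ ^ p := by
    rw [one_mul]
    refine lintegral_mono fun x => ENNReal.rpow_le_rpow ?_ hp.le
    rw [← h x, Finset.univ_eq_empty, Finset.sum_empty, zero_add, enorm_mul, enorm_mul]
    refine mul_le_mul_left ?_ _
    rw [enorm_le_iff_norm_le, Complex.norm_of_nonneg hc.le]
    nlinarith [norm_nonneg z]
  have := mul_LpN_le_of_lintegral_le hp ENNReal.one_ne_top hc.le hle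
  rw [ENNReal.toReal_one, Real.one_rpow, one_mul] at this
  rw [inv_mul_eq_div, le_div_iff₀ hc, mul_comm]
  exact this

end Conclusion

/-- The scalar instance (`E = ℂ`, `A = I`) of the uniform coercive estimate (5.5) of
Theorem 5.1: if `∑ k, (-1)^(l k) t k ∂ₖ^(2 l k) u + (1 + λ) u = f` with `λ ∈ S_φ`, then
`∑ k, ∑ i ≤ 2 l k, t k ^ (i/(2 l k)) |λ| ^ (1 - i/(2 l k)) ‖∂ₖ^i u‖_{L^p} + ‖u‖_{L^p}
  ≤ C ‖f‖_{L^p}`. -/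
theorem scalar_coercive_estimate (n : ℕ) (l : Fin n → ℕ) (hl : ∀ k, 0 < l k)
    (p : ℝ) (hp : 1 < p) (φ : ℝ) (hφ0 : 0 ≤ φ) (hφπ : φ < Real.pi) :
    ∃ C : ℝ, 0 < C ∧ ∀ z : ℂ, z ∈ Sector φ → ∀ t : Fin n → ℝ, (∀ k, 0 < t k) →
      ∀ u f : SchwartzMap (Fin n → ℝ) ℂ,
      (∀ x, (∑ k, ((-1 : ℝ) ^ (l k) * t k) • pdIter n k (2 * l k) u x) + (1 + z) * u x = f x) →
      (∑ k, ∑ i ∈ Finset.range (2 * l k + 1),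
          t k ^ ((i : ℝ) / (2 * l k)) * ‖z‖ ^ (1 - (i : ℝ) / (2 * l k)) *
            LpN n p (fun x => pdIter n k i u x)) +
        LpN n p (fun x => u x)
      ≤ C * LpN n p (fun x => f x) := by
  rcases Nat.eq_zero_or_pos n with rfl | hn
  · obtain ⟨D, hD, h⟩ := exists_LpN_le_of_isEmpty (l := l) (p := p) (by linarith) hφ0 hφπ
    refine ⟨D, hD, fun z hz t _ u f hf => ?_⟩
    rw [Finset.univ_eq_empty, Finset.sum_empty, zero_add]
    exact h z hz t u f hf
  have : NeZero n := ⟨hn.ne'⟩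
  choose D hD0 hD using exists_LpN_pdIter_le hl hp hφ0 hφπ
  refine ⟨(∑ k, ∑ i ∈ Finset.range (2 * l k + 1), D k i) + D 0 0 + 1,
    add_pos_of_nonneg_of_pos (add_nonneg (Finset.sum_nonneg fun k _ => Finset.sum_nonneg
      fun i _ => hD0 k i) (hD0 0 0)) one_pos, fun z hz t ht u f hf => ?_⟩
  have hu := LpN_nonneg (p := p) (fun x => u x)
  have hfN := LpN_nonneg (p := p) (fun x => f x)
  rw [add_mul, add_mul, one_mul]
  refine le_add_of_le_of_nonneg (add_le_add ?_ ?_) hfN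
  · simp only [Finset.sum_mul]
    refine Finset.sum_le_sum fun k _ => Finset.sum_le_sum fun i hi => ?_
    have hi' : i ≤ 2 * l k := Nat.lt_succ_iff.1 (Finset.mem_range.1 hi)
    refine le_trans ?_ (hD k i hi' z hz t ht u f hf)
    have hlk : (0 : ℝ) < l k := by exact_mod_cast hl k
    have hγ1 : (i : ℝ) / (2 * l k) ≤ 1 := (div_le_one (by positivity)).2 (by exact_mod_cast hi')
    refine mul_le_mul_of_nonneg_right (mul_le_mul_of_nonneg_left ?_
      (Real.rpow_nonneg (ht k).le _)) (LpN_nonneg _)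
    exact Real.rpow_le_rpow (norm_nonneg _) (by linarith) (by linarith)
  · refine le_trans ?_ (hD 0 0 (Nat.zero_le _) z hz t ht u f hf)
    rw [Nat.cast_zero, zero_div, Real.rpow_zero, one_mul, sub_zero, Real.rpow_one]
    exact le_mul_of_one_le_left hu (by linarith [norm_nonneg z])
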